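/- If W is a 2-dimensional Coxeter group, then W is biautomatic, witnessed by its standard language 𝓛: the language 𝓛 ⊆ S* is regular, every element of W is represented by some word of 𝓛, and there exists a constant C > 0 such that (ii) for all s ∈ S, g ∈ W, g' = gs, all v, v' ∈ 𝓛 representing g, g' and all i ≥ 1 one has ℓ(v(i)⁻¹ v'(i)) ≤ C, and (iii) for all s ∈ S, g ∈ W, g' = sg, all v, v' ∈ 𝓛 representing g, g' and all i ≥ 1 one has ℓ(v(i)⁻¹ s⁻¹ v'(i)) ≤ C. -/

import Mathlib

namespace CoxeterPaper

open CoxeterSystem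

attribute [local instance] Classical.propDecidable

variable {B : Type} [DecidableEq B] [Fintype B]
variable {W : Type} [Group W] {M : CoxeterMatrix B}

/-- The right descent set `T(g) = {s ∈ S : ℓ(gs) < ℓ(g)}`, as a set of indices. -/
def descentSet (cs : CoxeterSystem M W) (g : W) : Set B :=
  {i | cs.IsRightDescent g i}

/-- The subgroup `⟨T(g)⟩` generated by the right descent set of `g`. -/
def descSubgroup (cs : CoxeterSystem M W) (g : W) : Subgroup W :=
  Subgroup.closure (cs.simple '' descentSet cs g)

/-- `w(g)`: the longest element of `⟨T(g)⟩` (defined via choice; for `g ≠ 1` the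
subgroup `⟨T(g)⟩` is finite and has a unique longest element). -/
noncomputable def wg (cs : CoxeterSystem M W) (g : W) : W :=
  if h : ∃ w₀ ∈ descSubgroup cs g, ∀ u ∈ descSubgroup cs g, cs.length u ≤ cs.length w₀
  then h.choose else 1

/-- `Π(g) = g · w(g)`. -/
noncomputable def PiMap (cs : CoxeterSystem M W) (g : W) : W := g * wg cs g

/-- The standard language `𝓛 ⊆ S*`: the empty word is in `𝓛` (and it is the only word of `𝓛`
representing the identity); a word `v` of length `n` representing `g ≠ 1` is in `𝓛` iff,
setting `k = ℓ(w(g))`, the prefix `v(n-k)` is in `𝓛` and `v(n-k+1, n)` represents `w(g)`. -/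
inductive StdLang (cs : CoxeterSystem M W) : List B → Prop
  | nil : StdLang cs []
  | step (v : List B) (hne : cs.wordProd v ≠ 1)
      (hpre : StdLang cs (v.take (v.length - cs.length (wg cs (cs.wordProd v)))))
      (hsuf : cs.wordProd (v.drop (v.length - cs.length (wg cs (cs.wordProd v))))
        = wg cs (cs.wordProd v)) : StdLang cs v

/-- A Coxeter group is 2-dimensional if every triple of distinct generators
generates an infinite subgroup. -/
def TwoDimensional (cs : CoxeterSystem M W) : Prop :=
  ∀ i j k : B, i ≠ j → i ≠ k → j ≠ k →
    Infinite (Subgroup.closure {cs.simple i, cs.simple j, cs.simple k} : Subgroup W)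

/-- The wall of the reflection `ρ` separates `g` and `h`. -/
def Separates (cs : CoxeterSystem M W) (ρ g h : W) : Prop :=
  Xor' (cs.length (ρ * g) < cs.length g) (cs.length (ρ * h) < cs.length h)

/-- `h` is adjacent to the wall of the reflection `ρ`. -/
def AdjacentWall (cs : CoxeterSystem M W) (ρ h : W) : Prop :=
  ∃ i : B, ρ = h * cs.simple i * h⁻¹

/-- The wall of `ρ'` separates `g` from the wall of `ρ`. -/
def SeparatesFromWall (cs : CoxeterSystem M W) (ρ' g ρ : W) : Prop :=
  ∀ h : W, AdjacentWall cs ρ h → Separates cs ρ' g h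

/-- `𝓦(g)`: the set of walls (identified with their reflections) separating `g` from the
identity and not separated from `g` by any other wall. -/
def WallsNear (cs : CoxeterSystem M W) (g : W) : Set W :=
  {ρ | cs.IsReflection ρ ∧ cs.length (ρ * g) < cs.length g ∧
    ∀ ρ' : W, cs.IsReflection ρ' → ρ' ≠ ρ → ¬ SeparatesFromWall cs ρ' g ρ}

section

set_option linter.unusedSectionVars false
set_option linter.unusedDecidableInType false
set_option linter.unusedFintypeInType false
set_option autoImplicit false

/-- The number `2 cos (π / m)`, with value `2` for `m = ∞`; the canonical bilinear form is
`-cosNum / 2`. -/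
noncomputable def cosNum (M : CoxeterMatrix B) (s t : B) : ℝ :=
  if M s t = 0 then 2 else 2 * Real.cos (Real.pi / M s t)

/-- The second-kind Chebyshev recursion. -/
noncomputable def chebU (c : ℝ) : ℕ → ℝ
  | 0 => 0
  | 1 => 1
  | (k + 2) => c * chebU c (k + 1) - chebU c k


theorem cosNum_symm (s t : B) : cosNum M s t = cosNum M t s := by
  unfold cosNum; rw [M.symmetric s t]

theorem cosNum_self (s : B) : cosNum M s s = -2 := by
  unfold cosNum; simp

theorem two_le_coxeter {s t : B} (h : s ≠ t) (hM : M s t ≠ 0) : 2 ≤ M s t := by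
  have := M.off_diagonal s t h
  omega

theorem chebU_mul_sin (θ : ℝ) (k : ℕ) :
    chebU (2 * Real.cos θ) k * Real.sin θ = Real.sin (k * θ) := by
  induction k using Nat.twoStepInduction with
  | zero => simp [chebU]
  | one => simp [chebU]
  | more k ih1 ih2 =>
    rw [chebU, sub_mul, ih1, mul_assoc, ih2]
    have e1 : ((k + 2 : ℕ) : ℝ) * θ = ((k + 1 : ℕ) : ℝ) * θ + θ := by push_cast; ring
    have e2 : (k : ℝ) * θ = ((k + 1 : ℕ) : ℝ) * θ - θ := by push_cast; ring
    rw [e1, e2, Real.sin_add, Real.sin_sub]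
    ring

theorem chebU_invariant (c : ℝ) (k : ℕ) :
    chebU c (k + 1) ^ 2 - c * chebU c k * chebU c (k + 1) + chebU c k ^ 2 = 1 := by
  induction k with
  | zero => simp [chebU]
  | succ k ih => rw [chebU]; linear_combination ih

theorem chebU_cosNum_self {s t : B} (hst : s ≠ t) (h : M s t ≠ 0) :
    chebU (cosNum M s t) (M s t) = 0 := by
  have h2 := two_le_coxeter hst h
  have hm : (2 : ℝ) ≤ M s t := by exact_mod_cast h2
  have hpi := Real.pi_pos
  have := chebU_mul_sin (Real.pi / M s t) (M s t)
  rw [mul_div_cancel₀ _ (by positivity), Real.sin_pi] at this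
  have hs : 0 < Real.sin (Real.pi / M s t) := by
    apply Real.sin_pos_of_pos_of_lt_pi (by positivity)
    rw [div_lt_iff₀ (by linarith)]; nlinarith
  rw [cosNum, if_neg h]
  rcases mul_eq_zero.1 this with h | h
  · exact h
  · exact absurd h hs.ne'

theorem chebU_cosNum_ge_one {s t : B} (hst : s ≠ t) {k : ℕ} (hk : k ≠ 0)
    (h : M s t ≠ 0 → k < M s t) : 1 ≤ chebU (cosNum M s t) k := by
  by_cases h0 : M s t = 0
  · rw [cosNum, if_pos h0]
    have : ∀ n : ℕ, chebU 2 n = n := by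
      intro n
      induction n using Nat.twoStepInduction with
      | zero => simp [chebU]
      | one => simp [chebU]
      | more n h1 h2 => rw [chebU, h1, h2]; push_cast; ring
    rw [this]
    exact_mod_cast Nat.one_le_iff_ne_zero.2 hk
  · have h2 := two_le_coxeter hst h0
    have hm : (2 : ℝ) ≤ M s t := by exact_mod_cast h2
    have hpi := Real.pi_pos
    have hk1 : (1 : ℝ) ≤ k := by exact_mod_cast Nat.one_le_iff_ne_zero.2 hk
    have hk2 : (k : ℝ) + 1 ≤ M s t := by exact_mod_cast h h0
    have key := chebU_mul_sin (Real.pi / M s t) k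
    rw [cosNum, if_neg h0]
    set θ := Real.pi / M s t with hθ
    have hmθ : M s t * θ = Real.pi := by rw [hθ]; field_simp
    have hθ0 : 0 < θ := by positivity
    have hs : 0 < Real.sin θ := by
      apply Real.sin_pos_of_pos_of_lt_pi hθ0
      nlinarith
    have hle : Real.sin θ ≤ Real.sin (k * θ) := by
      by_cases hc : k * θ ≤ Real.pi / 2
      · apply Real.sin_le_sin_of_le_of_le_pi_div_two
        · linarith
        · exact hc
        · nlinarith
      · rw [← Real.sin_pi_sub (k * θ)]
        apply Real.sin_le_sin_of_le_of_le_pi_div_two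
        · linarith
        · linarith
        · nlinarith
    by_contra hlt
    push Not at hlt
    nlinarith

theorem cosNum_range {s t : B} (hst : s ≠ t) :
    cosNum M s t = 0 ∧ M s t = 2 ∨ cosNum M s t = 1 ∧ M s t = 3 ∨
      2 ≤ cosNum M s t ^ 2 ∧ 1 < cosNum M s t ∧ (M s t = 0 ∨ 4 ≤ M s t) := by
  by_cases h0 : M s t = 0
  · right; right; rw [cosNum, if_pos h0]; norm_num [h0]
  · have h2 := two_le_coxeter hst h0
    rcases Nat.lt_or_ge (M s t) 4 with h4 | h4
    · have : M s t = 2 ∨ M s t = 3 := by omega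
      rcases this with h | h
      · left; rw [cosNum, if_neg h0, h]; simp
      · right; left; rw [cosNum, if_neg h0, h]; simp
    · right; right
      have hm : (4 : ℝ) ≤ M s t := by exact_mod_cast h4
      have hpi := Real.pi_pos
      have hc : Real.cos (Real.pi / 4) ≤ Real.cos (Real.pi / M s t) := by
        apply Real.cos_le_cos_of_nonneg_of_le_pi
        · positivity
        · linarith
        · exact div_le_div_of_nonneg_left hpi.le (by norm_num) hm
      rw [Real.cos_pi_div_four] at hc
      rw [cosNum, if_neg h0]
      have h22 : Real.sqrt 2 ^ 2 = 2 := Real.sq_sqrt (by norm_num)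
      have h20 : 0 ≤ Real.sqrt 2 := Real.sqrt_nonneg 2
      refine ⟨by nlinarith, by nlinarith, Or.inr h4⟩

theorem cosNum_nonneg {s t : B} (hst : s ≠ t) : 0 ≤ cosNum M s t := by
  rcases cosNum_range (M := M) hst with h | h | h
  · exact h.1.ge
  · rw [h.1]; norm_num
  · linarith [h.2.1]

theorem cosNum_le_two (s t : B) : cosNum M s t ≤ 2 := by
  unfold cosNum
  split_ifs
  · exact le_rfl
  · linarith [Real.cos_le_one (Real.pi / M s t)]

theorem cosNum_lt_two {s t : B} (h : M s t ≠ 0) : cosNum M s t < 2 := by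
  rw [cosNum, if_neg h]
  have hm : (1 : ℝ) ≤ M s t := by exact_mod_cast Nat.one_le_iff_ne_zero.2 h
  have hpi := Real.pi_pos
  have : Real.cos (Real.pi / M s t) < Real.cos 0 := by
    apply Real.cos_lt_cos_of_nonneg_of_le_pi le_rfl
    · rw [div_le_iff₀ (by linarith)]; nlinarith
    · positivity
  rw [Real.cos_zero] at this
  linarith

/-- The simple reflection `σ_s` of the geometric representation. -/
noncomputable def simpleRefl (M : CoxeterMatrix B) (s : B) : Module.End ℝ (B → ℝ) where
  toFun v := v + (∑ t, cosNum M s t * v t) • Pi.single s (1 : ℝ)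
  map_add' v w := by
    simp only [Pi.add_apply, mul_add, Finset.sum_add_distrib, add_smul]
    abel
  map_smul' r v := by
    simp only [Pi.smul_apply, smul_eq_mul, RingHom.id_apply, smul_add, smul_smul, Finset.mul_sum]
    congr 2
    exact Finset.sum_congr rfl fun _ _ => by ring

/-- The linear form `v ↦ ∑ t, c_st v_t`. -/
noncomputable def pairing (M : CoxeterMatrix B) (s : B) : (B → ℝ) →ₗ[ℝ] ℝ where
  toFun v := ∑ t, cosNum M s t * v t
  map_add' v w := by simp only [Pi.add_apply, mul_add, Finset.sum_add_distrib]
  map_smul' r v := by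
    simp only [Pi.smul_apply, smul_eq_mul, RingHom.id_apply, Finset.mul_sum]
    exact Finset.sum_congr rfl fun _ _ => by ring

theorem pairing_apply (s : B) (v : B → ℝ) : pairing M s v = ∑ t, cosNum M s t * v t := rfl

theorem simpleRefl_apply (s : B) (v : B → ℝ) :
    simpleRefl M s v = v + pairing M s v • Pi.single s (1 : ℝ) := rfl

theorem pairing_single (s t : B) : pairing M s (Pi.single t (1 : ℝ)) = cosNum M s t := by
  rw [pairing_apply, Finset.sum_eq_single t]
  · simp
  · intro b _ hb; simp [hb]
  · simp

theorem simpleRefl_pow_apply (s t : B) (k : ℕ) (v : B → ℝ) :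
    ((simpleRefl M s * simpleRefl M t) ^ k) v = v
      + (chebU (cosNum M s t) k ^ 2 * pairing M s v
        + chebU (cosNum M s t) k * chebU (cosNum M s t) (k + 1) * pairing M t v) •
          Pi.single s (1 : ℝ)
      + (chebU (cosNum M s t) k * (cosNum M s t * chebU (cosNum M s t) k
          - chebU (cosNum M s t) (k + 1)) * pairing M s v
        + chebU (cosNum M s t) k ^ 2 * pairing M t v) • Pi.single t (1 : ℝ) := by
  induction k with
  | zero => simp [chebU]
  | succ k ih =>
    rw [pow_succ', Module.End.mul_apply, ih, Module.End.mul_apply]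
    have inv := chebU_invariant (cosNum M s t) k
    have rec' : chebU (cosNum M s t) (k + 1 + 1)
      = cosNum M s t * chebU (cosNum M s t) (k + 1) - chebU (cosNum M s t) k := rfl
    rw [rec']
    generalize chebU (cosNum M s t) k = x at *
    generalize chebU (cosNum M s t) (k + 1) = y at *
    simp only [simpleRefl_apply, map_add, map_smul, pairing_single, cosNum_self,
      cosNum_symm (M := M) t s]
    generalize pairing M s v = a
    generalize pairing M t v = b
    generalize cosNum M s t = c at *
    ext i
    simp only [Pi.add_apply, Pi.smul_apply, smul_eq_mul]
    generalize (Pi.single s (1 : ℝ) : B → ℝ) i = p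
    generalize (Pi.single t (1 : ℝ) : B → ℝ) i = q
    linear_combination (-1 : ℝ) * (p * (a  + c * b) + q * b) * inv

theorem simpleRefl_isLiftable : M.IsLiftable (simpleRefl M) := by
  intro s t
  by_cases hst : s = t
  · subst hst
    rw [M.diagonal, pow_one]
    refine LinearMap.ext fun v => ?_
    simp only [Module.End.mul_apply, simpleRefl_apply, map_add, map_smul, pairing_single,
      cosNum_self, Module.End.one_apply]
    ext i
    simp only [Pi.add_apply, Pi.smul_apply, smul_eq_mul]
    ring
  · by_cases h0 : M s t = 0
    · rw [h0, pow_zero]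
    · refine LinearMap.ext fun v => ?_
      rw [simpleRefl_pow_apply, chebU_cosNum_self hst h0]
      simp

/-- The geometric representation. -/
noncomputable def geomRep (cs : CoxeterSystem M W) : W →* Module.End ℝ (B → ℝ) :=
  cs.lift ⟨simpleRefl M, simpleRefl_isLiftable⟩

/-- The root `x α_u`. -/
noncomputable def root (cs : CoxeterSystem M W) (x : W) (u : B) : B → ℝ :=
  geomRep cs x (Pi.single u 1)

theorem geomRep_simple (cs : CoxeterSystem M W) (s : B) :
    geomRep cs (cs.simple s) = simpleRefl M s := cs.lift_apply_simple _ s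

theorem root_one (cs : CoxeterSystem M W) (u : B) : root cs 1 u = Pi.single u 1 := by
  simp [root]

theorem root_mul_simple (cs : CoxeterSystem M W) (x : W) (s u : B) :
    root cs (x * cs.simple s) u = root cs x u + cosNum M s u • root cs x s := by
  simp only [root]
  rw [map_mul, Module.End.mul_apply, geomRep_simple, simpleRefl_apply, pairing_single, map_add,
    map_smul]

theorem geomRep_apply (cs : CoxeterSystem M W) (x : W) (v : B → ℝ) :
    geomRep cs x v = ∑ u, v u • root cs x u := by
  conv_lhs => rw [← Finset.univ_sum_single v]
  rw [map_sum]
  refine Finset.sum_congr rfl fun u _ => ?_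
  rw [root, ← map_smul]
  congr 1
  ext i
  by_cases h : i = u
  · subst h; simp
  · simp [h]

theorem wordProd_alternatingWord_braid (cs : CoxeterSystem M W) (s t : B) :
    cs.wordProd (alternatingWord s t (M s t)) = cs.wordProd (alternatingWord t s (M s t)) := by
  have := cs.wordProd_braidWord_eq s t
  rwa [braidWord, braidWord, M.symmetric t s] at this

theorem wordProd_alternatingWord_pred (cs : CoxeterSystem M W) (s t : B) (k : ℕ) :
    cs.wordProd (alternatingWord t s (k + 1)) =
      cs.wordProd (alternatingWord s t k) * cs.simple s := by
  rw [alternatingWord_succ, wordProd_concat]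

theorem exists_strip (cs : CoxeterSystem M W) {s t : B} (hst : s ≠ t) (x : W)
    (hx : ¬ cs.IsRightDescent x s) :
    ∃ (y : W) (j : ℕ), ¬ cs.IsRightDescent y s ∧ ¬ cs.IsRightDescent y t ∧
      cs.length x = cs.length y + j ∧ x = y * cs.wordProd (alternatingWord s t j) ∧
      (M s t ≠ 0 → j < M s t) ∧
      root cs x s = chebU (cosNum M s t) (j + 1) • root cs y (if Even j then s else t)
        + chebU (cosNum M s t) j • root cs y (if Even j then t else s) := by
  suffices H : ∀ (n : ℕ) (y : W) (j : ℕ), cs.length y = n →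
      ¬ cs.IsRightDescent y (if Even j then s else t) →
      cs.length x = cs.length y + j → x = y * cs.wordProd (alternatingWord s t j) →
      (M s t ≠ 0 → j < M s t) →
      root cs x s = chebU (cosNum M s t) (j + 1) • root cs y (if Even j then s else t)
        + chebU (cosNum M s t) j • root cs y (if Even j then t else s) →
      ∃ (y : W) (j : ℕ), ¬ cs.IsRightDescent y s ∧ ¬ cs.IsRightDescent y t ∧
      cs.length x = cs.length y + j ∧ x = y * cs.wordProd (alternatingWord s t j) ∧
      (M s t ≠ 0 → j < M s t) ∧
      root cs x s = chebU (cosNum M s t) (j + 1) • root cs y (if Even j then s else t)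
        + chebU (cosNum M s t) j • root cs y (if Even j then t else s) by
    refine H _ x 0 rfl (by simpa using hx) (by simp) (by simp [alternatingWord]) ?_ ?_
    · intro h; exact Nat.pos_of_ne_zero h
    · simp [chebU]
  intro n
  induction n with
  | zero =>
    intro y j hy h1 h2 h3 h4 h5
    have hy1 : y = 1 := cs.length_eq_zero_iff.1 hy
    exact ⟨y, j, by rw [hy1]; exact cs.not_isRightDescent_one _,
      by rw [hy1]; exact cs.not_isRightDescent_one _, h2, h3, h4, h5⟩
  | succ n ih =>
    intro y j hy h1 h2 h3 h4 h5
    by_cases hd : cs.IsRightDescent y (if Even j then t else s)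
    · have hlen := cs.isRightDescent_iff.1 hd
      set b := (if Even j then t else s) with hb
      set a := (if Even j then s else t) with ha
      have hab : a ≠ b := by rw [ha, hb]; split_ifs; exacts [hst, hst.symm]
      have ha' : (if Even (j + 1) then s else t) = b := by
        rw [hb]; by_cases h : Even j <;> simp [h, Nat.even_add_one]
      have hb' : (if Even (j + 1) then t else s) = a := by
        rw [ha]; by_cases h : Even j <;> simp [h, Nat.even_add_one]
      have hword : x = y * cs.simple b * cs.wordProd (alternatingWord s t (j + 1)) := by
        rw [alternatingWord_succ', wordProd_cons, ← hb, mul_assoc, simple_mul_simple_cancel_left, h3]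
      apply ih (y * cs.simple b) (j + 1) (by omega)
      · rw [ha', ← cs.isRightDescent_iff_not_isRightDescent_mul]; exact hd
      · omega
      · exact hword
      · intro h0
        have hj := h4 h0
        by_contra hcon
        have hjm : M s t = j + 1 := by omega
        apply hx
        rw [← hjm, wordProd_alternatingWord_braid, hjm, wordProd_alternatingWord_pred] at hword
        have hxs : x * cs.simple s = y * cs.simple b * cs.wordProd (alternatingWord s t j) := by
          rw [hword, ← mul_assoc, simple_mul_simple_cancel_right]
        rw [IsRightDescent, hxs]
        have := cs.length_mul_le (y * cs.simple b) (cs.wordProd (alternatingWord s t j))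
        have h6 := cs.length_wordProd_le (alternatingWord s t j)
        rw [length_alternatingWord] at h6
        omega
      · rw [ha', hb', h5]
        have e1 : root cs y a = root cs (y * cs.simple b) a
            + cosNum M s t • root cs (y * cs.simple b) b := by
          have := root_mul_simple cs (y * cs.simple b) b a
          rw [simple_mul_simple_cancel_right] at this
          rw [this]
          congr 2
          rw [ha, hb]; split_ifs
          · exact cosNum_symm _ _
          · rfl
        have e2 : root cs y b = - root cs (y * cs.simple b) b := by
          have := root_mul_simple cs (y * cs.simple b) b b
          rw [simple_mul_simple_cancel_right, cosNum_self] at this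
          rw [this]; ext i; simp; ring
        rw [e1, e2]
        have rec' : chebU (cosNum M s t) (j + 1 + 1)
          = cosNum M s t * chebU (cosNum M s t) (j + 1) - chebU (cosNum M s t) j := rfl
        rw [rec']
        ext i
        simp only [Pi.add_apply, Pi.smul_apply, smul_eq_mul, Pi.neg_apply]
        ring
    · refine ⟨y, j, ?_, ?_, h2, h3, h4, h5⟩
      · split_ifs at h1 hd
        · exact h1
        · exact hd
      · split_ifs at h1 hd
        · exact hd
        · exact h1

theorem root_coord_of_not_descent (cs : CoxeterSystem M W) (x : W) (s : B)
    (hx : ¬ cs.IsRightDescent x s) (t : B) : root cs x s t = 0 ∨ 1 ≤ root cs x s t := by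
  induction hn : cs.length x using Nat.strong_induction_on generalizing x s with
  | _ n ih =>
    by_cases h1 : x = 1
    · subst h1
      rw [root_one]
      by_cases h : t = s
      · subst h; simp
      · simp [h]
    · obtain ⟨b, hb⟩ := cs.exists_rightDescent_of_ne_one h1
      have hsb : s ≠ b := by rintro rfl; exact hx hb
      obtain ⟨y, j, hys, hyb, hl, hxy, hj, hr⟩ := exists_strip cs hsb x hx
      have hj0 : j ≠ 0 := by
        rintro rfl
        apply hyb
        rw [hxy] at hb
        simpa [alternatingWord] using hb
      have hlt : cs.length y < n := by omega
      have i1 := ih _ hlt y s hys rfl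
      have i2 := ih _ hlt y b hyb rfl
      have g1 : 1 ≤ chebU (cosNum M s b) j := chebU_cosNum_ge_one hsb hj0 hj
      have g2 : chebU (cosNum M s b) (j + 1) = 0 ∨ 1 ≤ chebU (cosNum M s b) (j + 1) := by
        by_cases h0 : M s b ≠ 0 ∧ j + 1 = M s b
        · left; rw [h0.2]; exact chebU_cosNum_self hsb h0.1
        · right
          apply chebU_cosNum_ge_one hsb (by omega)
          intro h; have := hj h; by_contra hc; exact h0 ⟨h, by omega⟩
      have gen : ∀ p q a b : ℝ, (p = 0 ∨ 1 ≤ p) → (1 ≤ q) → (a = 0 ∨ 1 ≤ a) → (b = 0 ∨ 1 ≤ b) →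
          (p * a + q * b = 0 ∨ 1 ≤ p * a + q * b) := by
        rintro p q a b (rfl | hp) hq (rfl | ha) (rfl | hb)
        · simp
        · right; nlinarith
        · simp
        · right; nlinarith
        · simp
        · right; nlinarith
        · right; nlinarith
        · right; nlinarith
      rw [hr]
      simp only [Pi.add_apply, Pi.smul_apply, smul_eq_mul]
      split_ifs
      · exact gen _ _ _ _ g2 g1 i1 i2
      · exact gen _ _ _ _ g2 g1 i2 i1

theorem root_mul_simple_self (cs : CoxeterSystem M W) (x : W) (s : B) :
    root cs (x * cs.simple s) s = - root cs x s := by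
  rw [root_mul_simple, cosNum_self]; ext i; simp; ring

theorem root_nonneg (cs : CoxeterSystem M W) {x : W} {s : B}
    (hx : ¬ cs.IsRightDescent x s) (t : B) : 0 ≤ root cs x s t := by
  rcases root_coord_of_not_descent cs x s hx t with h | h <;> linarith

theorem root_coord_of_descent (cs : CoxeterSystem M W) (x : W) (s : B)
    (hx : cs.IsRightDescent x s) (t : B) : root cs x s t = 0 ∨ root cs x s t ≤ -1 := by
  have h := root_coord_of_not_descent cs (x * cs.simple s) s
    (cs.isRightDescent_iff_not_isRightDescent_mul.1 hx) t
  rw [root_mul_simple_self, Pi.neg_apply] at h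
  rcases h with h | h
  · left; linarith
  · right; linarith

theorem root_nonpos (cs : CoxeterSystem M W) {x : W} {s : B}
    (hx : cs.IsRightDescent x s) (t : B) : root cs x s t ≤ 0 := by
  rcases root_coord_of_descent cs x s hx t with h | h <;> linarith

theorem geomRep_inv_apply (cs : CoxeterSystem M W) (x : W) (v : B → ℝ) :
    geomRep cs x⁻¹ (geomRep cs x v) = v := by
  rw [← Module.End.mul_apply, ← map_mul, inv_mul_cancel, map_one, Module.End.one_apply]

theorem root_ne_zero (cs : CoxeterSystem M W) (x : W) (s : B) : root cs x s ≠ 0 := by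
  intro h
  have h1 := geomRep_inv_apply cs x (Pi.single s 1)
  have h2 : geomRep cs x (Pi.single s 1) = 0 := h
  rw [h2, map_zero] at h1
  have := congrFun h1 s
  simp at this

theorem eq_one_of_no_descent (cs : CoxeterSystem M W) {x : W}
    (h : ∀ s, ¬ cs.IsRightDescent x s) : x = 1 := by
  by_contra h1
  obtain ⟨b, hb⟩ := cs.exists_rightDescent_of_ne_one h1
  exact h b hb

theorem descent_of_root_coord_neg (cs : CoxeterSystem M W) {x : W} {s t : B}
    (h : root cs x s t < 0) : cs.IsRightDescent x s := by
  by_contra hc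
  linarith [root_nonneg cs hc t]

theorem not_descent_of_root_coord_pos (cs : CoxeterSystem M W) {x : W} {s t : B}
    (h : 0 < root cs x s t) : ¬ cs.IsRightDescent x s := by
  intro hc
  linarith [root_nonpos cs hc t]

theorem exists_root_coord_ne_zero (cs : CoxeterSystem M W) (x : W) (s : B) :
    ∃ t, root cs x s t ≠ 0 := by
  by_contra h
  push Not at h
  exact root_ne_zero cs x s (funext h)

theorem eq_one_of_root_eq (cs : CoxeterSystem M W) {x : W}
    (h : ∀ s, root cs x s = Pi.single s 1) : x = 1 := by
  apply eq_one_of_no_descent cs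
  intro s hs
  have := root_nonpos cs hs s
  rw [h s] at this
  simp at this
  linarith

theorem geomRep_injective (cs : CoxeterSystem M W) : Function.Injective (geomRep cs) := by
  rw [injective_iff_map_eq_one]
  intro x hx
  apply eq_one_of_root_eq cs
  intro s
  rw [root, hx, Module.End.one_apply]

/-- The value of the linear functional `f` on the root `x α_u`. -/
noncomputable def num (cs : CoxeterSystem M W) (f : B → ℝ) (x : W) (u : B) : ℝ :=
  ∑ t, f t * root cs x u t

theorem num_mul_simple (cs : CoxeterSystem M W) (f : B → ℝ) (x : W) (s u : B) :
    num cs f (x * cs.simple s) u = num cs f x u + cosNum M s u * num cs f x s := by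
  simp only [num, root_mul_simple, Pi.add_apply, Pi.smul_apply, smul_eq_mul, Finset.mul_sum,
    ← Finset.sum_add_distrib]
  exact Finset.sum_congr rfl fun _ _ => by ring

theorem num_mul_simple_self (cs : CoxeterSystem M W) (f : B → ℝ) (x : W) (s : B) :
    num cs f (x * cs.simple s) s = - num cs f x s := by
  rw [num_mul_simple, cosNum_self]; ring

theorem num_nonneg (cs : CoxeterSystem M W) {f : B → ℝ} (hf : ∀ t, 0 ≤ f t) {x : W} {u : B}
    (h : ¬ cs.IsRightDescent x u) : 0 ≤ num cs f x u :=
  Finset.sum_nonneg fun t _ => mul_nonneg (hf t) (root_nonneg cs h t)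

theorem descent_of_num_neg (cs : CoxeterSystem M W) {f : B → ℝ} (hf : ∀ t, 0 ≤ f t) {x : W} {u : B}
    (h : num cs f x u < 0) : cs.IsRightDescent x u := by
  by_contra hc
  linarith [num_nonneg cs hf hc]

theorem num_neg_iff (cs : CoxeterSystem M W) {f : B → ℝ} (hf : ∀ t, 0 < f t) {x : W} {u : B} :
    num cs f x u < 0 ↔ cs.IsRightDescent x u := by
  refine ⟨descent_of_num_neg cs fun t => (hf t).le, fun h => ?_⟩
  obtain ⟨t, ht⟩ := exists_root_coord_ne_zero cs x u
  have h1 : f t * root cs x u t < 0 :=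
    mul_neg_of_pos_of_neg (hf t) (lt_of_le_of_ne (root_nonpos cs h t) ht)
  exact Finset.sum_neg' (fun t _ => mul_nonpos_of_nonneg_of_nonpos (hf t).le (root_nonpos cs h t))
    ⟨t, Finset.mem_univ t, h1⟩

theorem geomRep_coord_nonneg (cs : CoxeterSystem M W) {p : B → ℝ} (hp : ∀ t, 0 ≤ p t)
    (hk : ∀ u, 0 ≤ pairing M u p) (x : W) (t : B) : 0 ≤ geomRep cs x p t := by
  induction hn : cs.length x generalizing x with
  | zero =>
    rw [cs.length_eq_zero_iff.1 hn]
    simpa using hp t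
  | succ n ih =>
    have h1 : x ≠ 1 := by rintro rfl; simp at hn
    obtain ⟨s, hs⟩ := cs.exists_rightDescent_of_ne_one h1
    have hl := cs.isRightDescent_iff.1 hs
    have hx : x = (x * cs.simple s) * cs.simple s := by simp
    rw [hx, map_mul, Module.End.mul_apply, geomRep_simple, simpleRefl_apply, map_add, map_smul]
    have i1 := ih (x * cs.simple s) (by omega)
    have i2 : 0 ≤ root cs (x * cs.simple s) s t :=
      root_nonneg cs (cs.isRightDescent_iff_not_isRightDescent_mul.1 hs) t
    exact add_nonneg i1 (mul_nonneg (hk s) i2)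

theorem sum_mul_num_nonneg (cs : CoxeterSystem M W) {f : B → ℝ} (hf : ∀ t, 0 ≤ f t)
    {p : B → ℝ} (hp : ∀ t, 0 ≤ p t)
    (hk : ∀ u, 0 ≤ pairing M u p) (x : W) : 0 ≤ ∑ u, p u * num cs f x u := by
  have h : ∑ u, p u * num cs f x u = ∑ t, f t * geomRep cs x p t := by
    simp only [geomRep_apply, num, Finset.mul_sum, Finset.sum_apply, Pi.smul_apply, smul_eq_mul]
    rw [Finset.sum_comm]
    exact Finset.sum_congr rfl fun _ _ => Finset.sum_congr rfl fun _ _ => by ring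
  rw [h]
  exact Finset.sum_nonneg fun t _ => mul_nonneg (hf t) (geomRep_coord_nonneg cs hp hk x t)

theorem sum_single_mul (u : B) (p : ℝ) (g : B → ℝ) :
    ∑ v, (p • (Pi.single u 1 : B → ℝ)) v * g v = p * g u := by
  rw [Finset.sum_eq_single u]
  · simp
  · intro b _ hb; simp [hb]
  · simp

theorem num_add_num_nonneg (cs : CoxeterSystem M W) {f : B → ℝ} (hf : ∀ t, 0 ≤ f t) {s t : B}
    (h0 : M s t = 0) (x : W) : 0 ≤ num cs f x s + num cs f x t := by
  have hst : s ≠ t := by rintro rfl; simp at h0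
  have h2 : cosNum M s t = 2 := by rw [cosNum, if_pos h0]
  have key := sum_mul_num_nonneg cs hf (p := (1 : ℝ) • Pi.single s 1 + (1 : ℝ) • Pi.single t 1)
    (fun u => by
      simp only [one_smul, Pi.add_apply, Pi.single_apply]; split_ifs <;> norm_num)
    (fun u => by
      simp only [map_add, map_smul, pairing_single, smul_eq_mul, one_mul]
      by_cases hs : u = s
      · subst hs; rw [cosNum_self, h2]; norm_num
      · by_cases ht : u = t
        · subst ht; rw [cosNum_self, cosNum_symm, h2]; norm_num
        · exact add_nonneg (cosNum_nonneg hs) (cosNum_nonneg ht)) x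
  simp only [Pi.add_apply, add_mul, Finset.sum_add_distrib, sum_single_mul, one_mul] at key
  exact key

/-- The triangle inequality for angles `π/m`: every rank three special subgroup has an indefinite
or degenerate form. -/
def TriangleCond (M : CoxeterMatrix B) : Prop :=
  ∀ a b r : B, a ≠ b → a ≠ r → b ≠ r →
    4 ≤ cosNum M a b ^ 2 + cosNum M a r ^ 2 + cosNum M b r ^ 2
      + cosNum M a b * cosNum M a r * cosNum M b r

theorem num_triple (cs : CoxeterSystem M W) (hT : TriangleCond M) {f : B → ℝ} (hf : ∀ t, 0 ≤ f t)
    {a b r : B} (hab : a ≠ b) (har : a ≠ r) (hbr : b ≠ r) (x : W) :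
    0 ≤ (4 - cosNum M a b ^ 2) * num cs f x r
      + (2 * cosNum M a r + cosNum M a b * cosNum M b r) * num cs f x a
      + (2 * cosNum M b r + cosNum M a b * cosNum M a r) * num cs f x b := by
  have h := hT a b r hab har hbr
  have n1 := cosNum_nonneg (M := M) hab
  have n2 := cosNum_nonneg (M := M) har
  have n3 := cosNum_nonneg (M := M) hbr
  have l1 := cosNum_le_two (M := M) a b
  have k1 : 0 ≤ 4 - cosNum M a b ^ 2 := by nlinarith
  have k2 : 0 ≤ 2 * cosNum M a r + cosNum M a b * cosNum M b r := by positivity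
  have k3 : 0 ≤ 2 * cosNum M b r + cosNum M a b * cosNum M a r := by positivity
  have key := sum_mul_num_nonneg cs hf
    (p := (4 - cosNum M a b ^ 2) • Pi.single r 1
      + (2 * cosNum M a r + cosNum M a b * cosNum M b r) • Pi.single a 1
      + (2 * cosNum M b r + cosNum M a b * cosNum M a r) • Pi.single b 1)
    (fun u => by
      simp only [Pi.add_apply, Pi.smul_apply, smul_eq_mul, Pi.single_apply, mul_ite, mul_one,
        mul_zero]
      split_ifs <;> linarith)
    (fun u => by
      simp only [map_add, map_smul, pairing_single, smul_eq_mul]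
      by_cases ha : u = a
      · subst ha; rw [cosNum_self]; nlinarith
      · by_cases hb : u = b
        · subst hb; rw [cosNum_self, cosNum_symm u a]; nlinarith
        · by_cases hr : u = r
          · subst hr; rw [cosNum_self, cosNum_symm u a, cosNum_symm u b]; nlinarith
          · have := cosNum_nonneg (M := M) ha
            have := cosNum_nonneg (M := M) hb
            have := cosNum_nonneg (M := M) hr
            positivity) x
  simp only [Pi.add_apply, add_mul, Finset.sum_add_distrib, sum_single_mul] at key
  linarith

/-- The indefinite form `v, w ↦ ∑ c_st v_s w_t`. -/
noncomputable def coxForm (M : CoxeterMatrix B) (v w : B → ℝ) : ℝ := ∑ s, v s * pairing M s w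

theorem coxForm_single (s : B) (w : B → ℝ) : coxForm M (Pi.single s 1) w = pairing M s w := by
  have := sum_single_mul s 1 (fun s => pairing M s w)
  simpa [coxForm] using this

theorem coxForm_symm (v w : B → ℝ) : coxForm M v w = coxForm M w v := by
  simp only [coxForm, pairing_apply, Finset.mul_sum]
  rw [Finset.sum_comm]
  refine Finset.sum_congr rfl fun s _ => Finset.sum_congr rfl fun t _ => ?_
  rw [cosNum_symm]; ring

theorem coxForm_add_right (v w w' : B → ℝ) : coxForm M v (w + w') = coxForm M v w + coxForm M v w' := by
  simp only [coxForm, map_add, mul_add, Finset.sum_add_distrib]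

theorem coxForm_smul_right (c : ℝ) (v w : B → ℝ) : coxForm M v (c • w) = c * coxForm M v w := by
  simp only [coxForm, map_smul, smul_eq_mul, Finset.mul_sum]
  exact Finset.sum_congr rfl fun _ _ => by ring

theorem coxForm_simpleRefl (s : B) (v w : B → ℝ) :
    coxForm M (simpleRefl M s v) (simpleRefl M s w) = coxForm M v w := by
  rw [simpleRefl_apply, simpleRefl_apply]
  rw [coxForm_add_right, coxForm_smul_right, coxForm_symm _ (Pi.single s 1), coxForm_single,
    coxForm_symm _ w, coxForm_add_right, coxForm_smul_right, coxForm_symm w (Pi.single s 1),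
    coxForm_single, map_add, map_smul, pairing_single, cosNum_self, coxForm_symm w v, smul_eq_mul]
  ring

theorem coxForm_geomRep (cs : CoxeterSystem M W) (x : W) (v w : B → ℝ) :
    coxForm M (geomRep cs x v) (geomRep cs x w) = coxForm M v w := by
  induction x using cs.simple_induction_left with
  | one => simp
  | mul_simple_left x i ih =>
    rw [map_mul, Module.End.mul_apply, Module.End.mul_apply, geomRep_simple, coxForm_simpleRefl, ih]

theorem mul_simple_eq_of_root_eq (cs : CoxeterSystem M W) {x : W} {u s : B}
    (h : root cs x u = - Pi.single s 1) : x * cs.simple u = cs.simple s * x := by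
  apply geomRep_injective cs
  refine LinearMap.ext fun v => ?_
  rw [map_mul, map_mul, Module.End.mul_apply, Module.End.mul_apply, geomRep_simple, geomRep_simple,
    simpleRefl_apply, simpleRefl_apply, map_add, map_smul]
  congr 1
  have h' : geomRep cs x (Pi.single u 1) = - Pi.single s 1 := h
  have h1 := coxForm_geomRep cs x (Pi.single u 1) v
  have h2 : - (Pi.single s 1 : B → ℝ) = (-1 : ℝ) • Pi.single s 1 := by simp
  rw [h', h2, coxForm_symm, coxForm_smul_right, coxForm_symm, coxForm_single, coxForm_single] at h1
  rw [h', ← h1]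
  simp

theorem root_eq_neg_single (cs : CoxeterSystem M W) {x : W} {u s : B}
    (hd : cs.IsRightDescent x u) (h : ∀ t, t ≠ s → root cs x u t = 0) :
    root cs x u = - Pi.single s 1 := by
  have h1 : root cs x u = (root cs x u s) • Pi.single s 1 := by
    ext t
    by_cases ht : t = s
    · subst ht; simp
    · simp [ht, h t ht]
  have hne : root cs x u s ≠ 0 := by
    intro h0; rw [h0, zero_smul] at h1; exact root_ne_zero cs x u h1
  have hle : root cs x u s ≤ -1 := (root_coord_of_descent cs x u hd s).resolve_left hne
  have h2 := geomRep_inv_apply cs x (Pi.single u 1)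
  change geomRep cs x⁻¹ (root cs x u) = _ at h2
  rw [h1, map_smul] at h2
  have h3 := congrFun h2 u
  change root cs x u s * root cs x⁻¹ s u = _ at h3
  rw [Pi.single_eq_same] at h3
  have h4 : root cs x⁻¹ s u < 0 := by nlinarith
  have h5 := (root_coord_of_descent cs x⁻¹ s (descent_of_root_coord_neg cs h4) u).resolve_left h4.ne
  have : root cs x u s = -1 := by nlinarith
  rw [h1, this]; simp

theorem finite_length_le (cs : CoxeterSystem M W) (n : ℕ) : {w : W | cs.length w ≤ n}.Finite := by
  refine ((List.finite_length_le B n).image cs.wordProd).subset ?_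
  intro w hw
  obtain ⟨ω, h1, h2⟩ := cs.exists_isReduced w
  refine ⟨ω, ?_, h2.symm⟩
  have : cs.length (cs.wordProd ω) = ω.length := h1
  simp only [Set.mem_ofPred_eq] at hw ⊢
  rw [← this, ← h2]; exact hw

theorem geomRep_coord_of_mem_closure (cs : CoxeterSystem M W) {I : Set B} {w : W}
    (hw : w ∈ Subgroup.closure (cs.simple '' I)) {t : B} (ht : t ∉ I) (v : B → ℝ) :
    geomRep cs w v t = v t := by
  have hs : ∀ i ∈ I, ∀ v : B → ℝ, geomRep cs (cs.simple i) v t = v t := by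
    intro i hi v
    have : t ≠ i := by rintro rfl; exact ht hi
    rw [geomRep_simple, simpleRefl_apply]
    simp [this]
  induction hw using Subgroup.closure_induction generalizing v with
  | mem x hx => obtain ⟨i, hi, rfl⟩ := hx; exact hs i hi v
  | one => simp
  | mul x y _ _ hx hy => rw [map_mul, Module.End.mul_apply, hx, hy]
  | inv x _ hx =>
    have h := hx (geomRep cs x⁻¹ v)
    rw [← Module.End.mul_apply, ← map_mul, mul_inv_cancel, map_one, Module.End.one_apply] at h
    exact h.symm

theorem eq_one_of_mem_closure (cs : CoxeterSystem M W) {I : Set B} {w : W}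
    (hw : w ∈ Subgroup.closure (cs.simple '' I)) (h : ∀ i ∈ I, ¬ cs.IsRightDescent w i) :
    w = 1 := by
  apply eq_one_of_no_descent cs
  intro u
  by_cases hu : u ∈ I
  · exact h u hu
  · apply not_descent_of_root_coord_pos cs (t := u)
    rw [root, geomRep_coord_of_mem_closure cs hw hu]
    simp

theorem eq_sum_three {a b r : B} (hab : a ≠ b) (har : a ≠ r) (hbr : b ≠ r) {v : B → ℝ}
    (hv : ∀ t, t ∉ ({a, b, r} : Set B) → v t = 0) :
    v = v a • Pi.single a 1 + v b • Pi.single b 1 + v r • Pi.single r 1 := by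
  ext t
  by_cases h1 : t = a
  · subst h1; simp [hab, har]
  · by_cases h2 : t = b
    · subst h2; simp [hab.symm, hbr]
    · by_cases h3 : t = r
      · subst h3; simp [har.symm, hbr.symm]
      · rw [hv t (by simp [h1, h2, h3])]; simp [h1, h2, h3]

theorem coxForm_three {a b r : B} {p q z : ℝ} {w : B → ℝ} :
    coxForm M w (p • Pi.single a 1 + q • Pi.single b 1 + z • Pi.single r 1)
      = p * pairing M a w + q * pairing M b w + z * pairing M r w := by
  rw [coxForm_add_right, coxForm_add_right, coxForm_smul_right, coxForm_smul_right,
    coxForm_smul_right, coxForm_symm w, coxForm_single, coxForm_symm w, coxForm_single,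
    coxForm_symm w, coxForm_single]

theorem triangleCond_of_twoDimensional (cs : CoxeterSystem M W) (h2 : TwoDimensional cs) :
    TriangleCond M := by
  intro a b r hab har hbr
  by_contra hdet
  push Not at hdet
  have hinf := h2 a b r hab har hbr
  have himg : ({cs.simple a, cs.simple b, cs.simple r} : Set W)
      = cs.simple '' ({a, b, r} : Set B) := by
    simp [Set.image_insert_eq]
  rw [himg] at hinf
  have n1 := cosNum_nonneg (M := M) hab
  have n2 := cosNum_nonneg (M := M) har
  have n3 := cosNum_nonneg (M := M) hbr
  have sab : cosNum M b a = cosNum M a b := cosNum_symm _ _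
  have sar : cosNum M r a = cosNum M a r := cosNum_symm _ _
  have sbr : cosNum M r b = cosNum M b r := cosNum_symm _ _
  set c := cosNum M a b
  set c1 := cosNum M a r
  set c2 := cosNum M b r
  set D := 4 - (c ^ 2 + c1 ^ 2 + c2 ^ 2 + c * c1 * c2) with hD
  have hDpos : 0 < D := by linarith
  have m3 := mul_nonneg (mul_nonneg n1 n2) n3
  have hc2 : 0 < 4 - c ^ 2 := by nlinarith
  set I : Set B := {a, b, r} with hI
  -- negative definiteness on the span
  have hneg : ∀ v : B → ℝ, (∀ t, t ∉ I → v t = 0) → coxForm M v v ≤ 0 := by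
    intro v hv
    have e := eq_sum_three hab har hbr hv
    generalize v a = p at e
    generalize v b = q at e
    generalize v r = z at e
    have : coxForm M v v = p * (-2 * p + c * q + c1 * z) + q * (c * p - 2 * q + c2 * z)
        + z * (c1 * p + c2 * q - 2 * z) := by
      conv_lhs => rw [e]
      rw [coxForm_three]
      simp only [map_add, map_smul, pairing_single, smul_eq_mul, cosNum_self, sab, sar, sbr]
      ring
    rw [this]
    have key : (4 - c ^ 2) * (2 * (p * (-2 * p + c * q + c1 * z) + q * (c * p - 2 * q + c2 * z)
        + z * (c1 * p + c2 * q - 2 * z)))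
        = -((4 - c ^ 2) * (2 * p - c * q - c1 * z) ^ 2
          + ((4 - c ^ 2) * q - (2 * c2 + c * c1) * z) ^ 2 + 4 * D * z ^ 2) := by
      rw [hD]; ring
    have h3 : 0 ≤ (4 - c ^ 2) * (2 * p - c * q - c1 * z) ^ 2
          + ((4 - c ^ 2) * q - (2 * c2 + c * c1) * z) ^ 2 + 4 * D * z ^ 2 := by positivity
    by_contra hpos
    push Not at hpos
    have := mul_pos hc2 hpos
    nlinarith
  set p := (4 - c2 ^ 2) + (2 * c + c1 * c2) + (2 * c1 + c * c2) with hp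
  set q := (4 - c1 ^ 2) + (2 * c + c1 * c2) + (2 * c2 + c * c1) with hq
  set z := (4 - c ^ 2) + (2 * c1 + c * c2) + (2 * c2 + c * c1) with hz
  set v : B → ℝ := p • Pi.single a 1 + q • Pi.single b 1 + z • Pi.single r 1 with hv
  have hpair : ∀ i ∈ I, pairing M i v = -2 * D := by
    intro i hi
    rw [hv]
    simp only [map_add, map_smul, pairing_single, smul_eq_mul]
    rcases hi with rfl | rfl | rfl
    · rw [cosNum_self, hp, hq, hz, hD]; ring
    · rw [cosNum_self, sab, hp, hq, hz, hD]; ring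
    · rw [cosNum_self, sar, sbr, hp, hq, hz, hD]; ring
  have hvI : ∀ t, t ∉ I → v t = 0 := by
    intro t ht
    have h1 : t ≠ a := by rintro rfl; exact ht (by simp [hI])
    have h2 : t ≠ b := by rintro rfl; exact ht (by simp [hI])
    have h3 : t ≠ r := by rintro rfl; exact ht (by simp [hI])
    simp [hv, h1, h2, h3]
  clear_value v
  have aI : a ∈ I := by simp [hI]
  have bI : b ∈ I := by simp [hI]
  have rI : r ∈ I := by simp [hI]
  have hbound : ∀ (n : ℕ) (w : W), cs.length w = n → w ∈ Subgroup.closure (cs.simple '' I) →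
      coxForm M v v + 4 * D ^ 2 * n ≤ coxForm M v (geomRep cs w v) := by
    intro n
    induction n with
    | zero =>
      intro w hw _
      rw [cs.length_eq_zero_iff.1 hw]; simp
    | succ n ih =>
      intro w hw hmem
      have hex : ∃ i ∈ I, cs.IsRightDescent w i := by
        by_contra hno
        push Not at hno
        have := eq_one_of_mem_closure cs hmem hno
        rw [this] at hw; simp at hw
      obtain ⟨i, hi, hdi⟩ := hex
      have hl := cs.isRightDescent_iff.1 hdi
      have hmi : cs.simple i ∈ Subgroup.closure (cs.simple '' I) :=
        Subgroup.subset_closure ⟨i, hi, rfl⟩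
      have hmem' := Subgroup.mul_mem _ hmem hmi
      have ih' := ih (w * cs.simple i) (by omega) hmem'
      have hw' : w = (w * cs.simple i) * cs.simple i := by simp
      have hnd := cs.isRightDescent_iff_not_isRightDescent_mul.1 hdi
      have hgr : geomRep cs w v = geomRep cs (w * cs.simple i) v
          + (-2 * D) • root cs (w * cs.simple i) i := by
        conv_lhs => rw [hw', map_mul, Module.End.mul_apply, geomRep_simple, simpleRefl_apply,
          hpair i hi, map_add, map_smul]
        rfl
      rw [hgr, coxForm_add_right, coxForm_smul_right]
      set ρ := root cs (w * cs.simple i) i with hρ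
      have hρI : ∀ t, t ∉ I → ρ t = 0 := by
        intro t ht
        rw [hρ, root, geomRep_coord_of_mem_closure cs hmem' ht]
        have : t ≠ i := by rintro rfl; exact ht hi
        simp [this]
      have hcoord := root_coord_of_not_descent cs (w * cs.simple i) i hnd
      have e := eq_sum_three hab har hbr hρI
      have hsum : 1 ≤ ρ a + ρ b + ρ r := by
        obtain ⟨t, ht⟩ := exists_root_coord_ne_zero cs (w * cs.simple i) i
        have htI : t ∈ I := by
          by_contra hc; exact ht (hρI t hc)
        have ga := root_nonneg cs hnd a
        have gb := root_nonneg cs hnd b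
        have gr := root_nonneg cs hnd r
        have gt := (hcoord t).resolve_left ht
        rcases htI with rfl | rfl | rfl <;> linarith
      have hcf : coxForm M v ρ = -2 * D * (ρ a + ρ b + ρ r) := by
        conv_lhs => rw [e]
        rw [coxForm_three, hpair a aI, hpair b bI, hpair r rI]; ring
      rw [hcf]
      push_cast
      nlinarith [mul_pos hDpos hDpos]
  obtain ⟨N, hN⟩ := exists_nat_gt (-2 * coxForm M v v / (4 * D ^ 2))
  have hfin : (Subgroup.closure (cs.simple '' I) : Set W).Finite := by
    refine (finite_length_le cs N).subset ?_
    intro w hw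
    have h1 := hbound _ w rfl hw
    have h3 : ∀ t, t ∉ I → (v + geomRep cs w v) t = 0 := by
      intro t ht
      rw [Pi.add_apply, geomRep_coord_of_mem_closure cs hw ht, hvI t ht]; simp
    have h4 := hneg _ h3
    rw [coxForm_add_right, coxForm_symm _ v, coxForm_symm _ (geomRep cs w v), coxForm_add_right,
      coxForm_add_right, coxForm_geomRep, coxForm_symm (geomRep cs w v) v] at h4
    have h5 : (cs.length w : ℝ) < N := by
      refine lt_of_le_of_lt ?_ hN
      rw [le_div_iff₀ (by positivity)]
      linarith
    have : cs.length w < N := by exact_mod_cast h5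
    exact this.le
  exact hinf.not_finite hfin.to_subtype

/-- The dihedral special subgroup generated by two simple reflections. -/
def dih (cs : CoxeterSystem M W) (a b : B) : Subgroup W :=
  Subgroup.closure (cs.simple '' {a, b})

/-- The element represented by the braid word; for `m_ab ≠ ∞`, the longest element of `dih`. -/
def wab (cs : CoxeterSystem M W) (a b : B) : W := cs.wordProd (alternatingWord a b (M a b))

theorem dih_symm (cs : CoxeterSystem M W) (a b : B) : dih cs a b = dih cs b a := by
  rw [dih, dih, Set.pair_comm]

theorem simple_mem_dih_left (cs : CoxeterSystem M W) (a b : B) : cs.simple a ∈ dih cs a b :=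
  Subgroup.subset_closure ⟨a, by simp, rfl⟩

theorem simple_mem_dih_right (cs : CoxeterSystem M W) (a b : B) : cs.simple b ∈ dih cs a b :=
  Subgroup.subset_closure ⟨b, by simp, rfl⟩

theorem alternatingWord_mem_dih (cs : CoxeterSystem M W) (a b : B) (k : ℕ) :
    cs.wordProd (alternatingWord a b k) ∈ dih cs a b := by
  induction k with
  | zero => simp [alternatingWord, one_mem]
  | succ k ih =>
    rw [alternatingWord_succ', wordProd_cons]
    refine mul_mem ?_ ih
    split_ifs
    exacts [simple_mem_dih_right cs a b, simple_mem_dih_left cs a b]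

theorem wab_mem_dih (cs : CoxeterSystem M W) (a b : B) : wab cs a b ∈ dih cs a b :=
  alternatingWord_mem_dih cs a b _

theorem wab_symm (cs : CoxeterSystem M W) (a b : B) : wab cs a b = wab cs b a := by
  rw [wab, wordProd_alternatingWord_braid, wab, M.symmetric a b]

theorem not_descent_of_root_nonneg (cs : CoxeterSystem M W) {x : W} {s : B}
    (h : ∀ t, 0 ≤ root cs x s t) : ¬ cs.IsRightDescent x s := by
  intro hd
  obtain ⟨t, ht⟩ := exists_root_coord_ne_zero cs x s
  exact ht (le_antisymm (root_nonpos cs hd t) (h t))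

theorem length_mul_of_mem_closure (cs : CoxeterSystem M W) {I : Set B} {h : W}
    (hh : ∀ i ∈ I, ¬ cs.IsRightDescent h i) {u : W} (hu : u ∈ Subgroup.closure (cs.simple '' I)) :
    cs.length (h * u) = cs.length h + cs.length u := by
  induction hn : cs.length u generalizing u with
  | zero => rw [cs.length_eq_zero_iff.1 hn]; simp
  | succ n ih =>
    have hex : ∃ i ∈ I, cs.IsRightDescent u i := by
      by_contra hno
      push Not at hno
      rw [eq_one_of_mem_closure cs hu hno] at hn; simp at hn
    obtain ⟨i, hi, hdi⟩ := hex
    have hl := cs.isRightDescent_iff.1 hdi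
    have hmi : cs.simple i ∈ Subgroup.closure (cs.simple '' I) :=
      Subgroup.subset_closure ⟨i, hi, rfl⟩
    have hmem' := Subgroup.mul_mem _ hu hmi
    have ih' := ih hmem' (by omega)
    have hnd : ¬ cs.IsRightDescent (h * (u * cs.simple i)) i := by
      apply not_descent_of_root_nonneg
      intro t
      have e : root cs (h * (u * cs.simple i)) i
          = ∑ v, root cs (u * cs.simple i) i v • root cs h v := by
        rw [root, map_mul, Module.End.mul_apply, geomRep_apply]; rfl
      rw [e, Finset.sum_apply]
      refine Finset.sum_nonneg fun v _ => ?_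
      by_cases hv : v ∈ I
      · exact mul_nonneg (root_nonneg cs (cs.isRightDescent_iff_not_isRightDescent_mul.1 hdi) v)
          (root_nonneg cs (hh v hv) t)
      · have : root cs (u * cs.simple i) i v = 0 := by
          rw [root, geomRep_coord_of_mem_closure cs hmem' hv]
          have : v ≠ i := by rintro rfl; exact hv hi
          simp [this]
        rw [this, zero_smul, Pi.zero_apply]
    have := cs.not_isRightDescent_iff.1 hnd
    rw [mul_assoc, simple_mul_simple_cancel_right] at this
    omega

theorem length_mul_dih (cs : CoxeterSystem M W) {a b : B} {h : W}
    (ha : ¬ cs.IsRightDescent h a) (hb : ¬ cs.IsRightDescent h b) {u : W} (hu : u ∈ dih cs a b) :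
    cs.length (h * u) = cs.length h + cs.length u := by
  apply length_mul_of_mem_closure cs _ hu
  rintro i (rfl | rfl) <;> assumption

theorem eq_one_of_mem_dih (cs : CoxeterSystem M W) {a b : B} {u : W} (hu : u ∈ dih cs a b)
    (ha : ¬ cs.IsRightDescent u a) (hb : ¬ cs.IsRightDescent u b) : u = 1 := by
  apply eq_one_of_mem_closure cs hu
  rintro i (rfl | rfl) <;> assumption

theorem root_alternatingWord (cs : CoxeterSystem M W) (s t : B) (y : W) (k : ℕ) :
    root cs (y * cs.wordProd (alternatingWord s t k)) s =
      chebU (cosNum M s t) (k + 1) • root cs y (if Even k then s else t)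
        + chebU (cosNum M s t) k • root cs y (if Even k then t else s) := by
  induction k generalizing y with
  | zero => simp [chebU, alternatingWord]
  | succ k ih =>
    rw [alternatingWord_succ', wordProd_cons, ← mul_assoc, ih, root_mul_simple, root_mul_simple]
    have rec' : chebU (cosNum M s t) (k + 1 + 1)
        = cosNum M s t * chebU (cosNum M s t) (k + 1) - chebU (cosNum M s t) k := rfl
    rw [rec']
    by_cases h : Even k
    · simp only [h, Nat.even_add_one, if_true, not_true_eq_false, if_false, cosNum_self,
        cosNum_symm (M := M) t s]
      ext i; simp only [Pi.add_apply, Pi.smul_apply, smul_eq_mul]; ring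
    · simp only [h, Nat.even_add_one, if_true, not_false_eq_true, if_false, cosNum_self]
      ext i; simp only [Pi.add_apply, Pi.smul_apply, smul_eq_mul]; ring

theorem chebU_cosNum_nonneg {s t : B} (hst : s ≠ t) {k : ℕ} (h : M s t ≠ 0 → k ≤ M s t) :
    0 ≤ chebU (cosNum M s t) k := by
  by_cases hk : k = 0
  · subst hk; simp [chebU]
  · by_cases h0 : M s t ≠ 0 ∧ k = M s t
    · rw [h0.2, chebU_cosNum_self hst h0.1]
    · have := chebU_cosNum_ge_one hst hk (M := M) (by
        intro h1; have := h h1; by_contra hc; exact h0 ⟨h1, by omega⟩)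
      linarith

theorem alternatingWord_not_descent (cs : CoxeterSystem M W) {s t : B} (hst : s ≠ t) {k : ℕ}
    (hk : M s t ≠ 0 → k < M s t) :
    ¬ cs.IsRightDescent (cs.wordProd (alternatingWord s t k)) s := by
  apply not_descent_of_root_nonneg
  intro i
  have e := root_alternatingWord cs s t 1 k
  rw [one_mul] at e
  rw [e, root_one, root_one]
  have h1 := chebU_cosNum_nonneg (M := M) hst (k := k) (fun h => (hk h).le)
  have h2 := chebU_cosNum_nonneg (M := M) hst (k := k + 1) (fun h => hk h)
  have h3 : ∀ u : B, 0 ≤ (Pi.single u (1 : ℝ) : B → ℝ) i := by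
    intro u; rw [Pi.single_apply]; split_ifs <;> norm_num
  exact add_nonneg (mul_nonneg h2 (h3 _)) (mul_nonneg h1 (h3 _))

theorem length_wordProd_alternatingWord (cs : CoxeterSystem M W) {s t : B} (hst : s ≠ t) {k : ℕ}
    (hk : M s t ≠ 0 → k ≤ M s t) : cs.length (cs.wordProd (alternatingWord s t k)) = k := by
  induction k generalizing s t with
  | zero => simp [alternatingWord]
  | succ k ih =>
    rw [wordProd_alternatingWord_pred]
    have hk' : M t s ≠ 0 → k < M t s := by rw [M.symmetric t s]; exact fun h => hk h
    rw [cs.not_isRightDescent_iff.1 (alternatingWord_not_descent cs hst.symm hk'),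
      ih hst.symm fun h => (hk' h).le]

theorem eq_alternatingWord_of_not_descent (cs : CoxeterSystem M W) {a b : B} (hab : a ≠ b) {u : W}
    (hu : u ∈ dih cs a b) (ha : ¬ cs.IsRightDescent u a) :
    ∃ j, (M a b ≠ 0 → j < M a b) ∧ u = cs.wordProd (alternatingWord a b j) := by
  obtain ⟨y, j, h1, h2, _, h4, h5, _⟩ := exists_strip cs hab u ha
  have hy : y ∈ dih cs a b := by
    have : y = u * (cs.wordProd (alternatingWord a b j))⁻¹ := by rw [h4]; group
    rw [this]
    exact mul_mem hu (inv_mem (alternatingWord_mem_dih cs a b j))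
  rw [eq_one_of_mem_dih cs hy h1 h2, one_mul] at h4
  exact ⟨j, h5, h4⟩

theorem length_lt_of_not_descent (cs : CoxeterSystem M W) {a b : B} (hab : a ≠ b)
    (hm : M a b ≠ 0) {u : W} (hu : u ∈ dih cs a b) (ha : ¬ cs.IsRightDescent u a) :
    cs.length u < M a b := by
  obtain ⟨j, h1, h2⟩ := eq_alternatingWord_of_not_descent cs hab hu ha
  rw [h2, length_wordProd_alternatingWord cs hab fun h => (h1 h).le]
  exact h1 hm

theorem length_wab (cs : CoxeterSystem M W) {a b : B} (hab : a ≠ b) :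
    cs.length (wab cs a b) = M a b :=
  length_wordProd_alternatingWord cs hab fun _ => le_rfl

theorem wab_descent_left (cs : CoxeterSystem M W) {a b : B} (hab : a ≠ b) (hm : M a b ≠ 0) :
    cs.IsRightDescent (wab cs a b) a := by
  by_contra h
  have := length_lt_of_not_descent cs hab hm (wab_mem_dih cs a b) h
  rw [length_wab cs hab] at this
  exact lt_irrefl _ this

theorem no_both_descents (cs : CoxeterSystem M W) {a b : B} (h0 : M a b = 0) {x : W}
    (ha : cs.IsRightDescent x a) (hb : cs.IsRightDescent x b) : False := by
  have key := num_add_num_nonneg cs (f := fun _ => 1) (fun _ => zero_le_one) h0 x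
  have h1 := (num_neg_iff cs (f := fun _ => 1) (fun _ => zero_lt_one)).2 ha
  have h2 := (num_neg_iff cs (f := fun _ => 1) (fun _ => zero_lt_one)).2 hb
  linarith

theorem eq_wab_of_descents (cs : CoxeterSystem M W) {a b : B} (hab : a ≠ b) {u : W}
    (hu : u ∈ dih cs a b) (ha : cs.IsRightDescent u a) (hb : cs.IsRightDescent u b) :
    u = wab cs a b := by
  have hm : M a b ≠ 0 := fun h0 => no_both_descents cs h0 ha hb
  obtain ⟨j, h1, h2⟩ := eq_alternatingWord_of_not_descent cs hab
    (mul_mem hu (simple_mem_dih_left cs a b)) (cs.isRightDescent_iff_not_isRightDescent_mul.1 ha)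
  have h3 : u = cs.wordProd (alternatingWord b a (j + 1)) := by
    rw [wordProd_alternatingWord_pred, ← h2, simple_mul_simple_cancel_right]
  have h4 : j + 1 = M a b := by
    by_contra hne
    have hlt : j + 1 < M a b := by have := h1 hm; omega
    rw [h3] at hb
    exact alternatingWord_not_descent cs hab.symm (fun _ => by rwa [M.symmetric b a]) hb
  rw [h3, h4, wab, wordProd_alternatingWord_braid]

theorem length_le_of_mem_dih (cs : CoxeterSystem M W) {a b : B} (hab : a ≠ b) (hm : M a b ≠ 0)
    {u : W} (hu : u ∈ dih cs a b) : cs.length u ≤ M a b := by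
  by_cases ha : cs.IsRightDescent u a
  · by_cases hb : cs.IsRightDescent u b
    · rw [eq_wab_of_descents cs hab hu ha hb, length_wab cs hab]
    · rw [dih_symm] at hu
      have := length_lt_of_not_descent cs hab.symm (by rwa [M.symmetric b a]) hu hb
      rw [M.symmetric b a] at this
      exact this.le
  · exact (length_lt_of_not_descent cs hab hm hu ha).le

theorem wab_mul_self (cs : CoxeterSystem M W) {a b : B} (hab : a ≠ b) (hm : M a b ≠ 0) :
    wab cs a b * wab cs a b = 1 := by
  have hi := inv_mem (wab_mem_dih cs a b)
  have hl : cs.length (wab cs a b)⁻¹ = M a b := by rw [cs.length_inv, length_wab cs hab]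
  have : (wab cs a b)⁻¹ = wab cs a b := by
    apply eq_wab_of_descents cs hab hi
    · by_contra h
      have := length_lt_of_not_descent cs hab hm hi h
      omega
    · by_contra h
      rw [dih_symm] at hi
      have := length_lt_of_not_descent cs hab.symm (by rwa [M.symmetric b a]) hi h
      rw [M.symmetric b a] at this
      omega
  exact inv_eq_iff_mul_eq_one.1 this

theorem exists_dih_decomp (cs : CoxeterSystem M W) (a b : B) (x : W) :
    ∃ h u, u ∈ dih cs a b ∧ ¬ cs.IsRightDescent h a ∧ ¬ cs.IsRightDescent h b ∧ x = h * u ∧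
      cs.length x = cs.length h + cs.length u := by
  suffices H : ∃ h u, u ∈ dih cs a b ∧ ¬ cs.IsRightDescent h a ∧ ¬ cs.IsRightDescent h b ∧
      x = h * u by
    obtain ⟨h, u, h1, h2, h3, h4⟩ := H
    exact ⟨h, u, h1, h2, h3, h4, by rw [h4]; exact length_mul_dih cs h2 h3 h1⟩
  induction hn : cs.length x using Nat.strong_induction_on generalizing x with
  | _ n ih =>
    by_cases hd : cs.IsRightDescent x a ∨ cs.IsRightDescent x b
    · have : ∃ i, cs.simple i ∈ dih cs a b ∧ cs.IsRightDescent x i := by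
        rcases hd with h | h
        exacts [⟨a, simple_mem_dih_left cs a b, h⟩, ⟨b, simple_mem_dih_right cs a b, h⟩]
      obtain ⟨i, hi, hd⟩ := this
      have hl := cs.isRightDescent_iff.1 hd
      obtain ⟨h, u, h1, h2, h3, h4⟩ := ih _ (by omega) (x * cs.simple i) rfl
      refine ⟨h, u * cs.simple i, mul_mem h1 hi, h2, h3, ?_⟩
      rw [← mul_assoc, ← h4, simple_mul_simple_cancel_right]
    · push Not at hd
      exact ⟨x, 1, one_mem _, hd.1, hd.2, by simp⟩

theorem descent_mul_iff (cs : CoxeterSystem M W) {a b : B} {h : W}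
    (ha : ¬ cs.IsRightDescent h a) (hb : ¬ cs.IsRightDescent h b) {u : W} (hu : u ∈ dih cs a b)
    {i : B} (hi : cs.simple i ∈ dih cs a b) :
    cs.IsRightDescent (h * u) i ↔ cs.IsRightDescent u i := by
  rw [IsRightDescent, IsRightDescent, mul_assoc, length_mul_dih cs ha hb hu,
    length_mul_dih cs ha hb (mul_mem hu hi)]
  omega

theorem exists_eq_mul_wab (cs : CoxeterSystem M W) {a b : B} (hab : a ≠ b) {x : W}
    (ha : cs.IsRightDescent x a) (hb : cs.IsRightDescent x b) :
    M a b ≠ 0 ∧ ∃ h, ¬ cs.IsRightDescent h a ∧ ¬ cs.IsRightDescent h b ∧ x = h * wab cs a b ∧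
      cs.length x = cs.length h + M a b := by
  have hm : M a b ≠ 0 := fun h0 => no_both_descents cs h0 ha hb
  obtain ⟨h, u, h1, h2, h3, h4, h5⟩ := exists_dih_decomp cs a b x
  rw [h4, descent_mul_iff cs h2 h3 h1 (simple_mem_dih_left cs a b)] at ha
  rw [h4, descent_mul_iff cs h2 h3 h1 (simple_mem_dih_right cs a b)] at hb
  have := eq_wab_of_descents cs hab h1 ha hb
  subst this
  rw [length_wab cs hab] at h5
  exact ⟨hm, h, h2, h3, h4, h5⟩

/-- One step of the path of `x` determined by the dominant functional `f`: multiplication by the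
longest element of the subgroup generated by the `u` with `num cs f x u < 0`. -/
def Step (cs : CoxeterSystem M W) (f : B → ℝ) (x y : W) : Prop :=
  (∃ a, num cs f x a < 0 ∧ (∀ u, u ≠ a → 0 ≤ num cs f x u) ∧ y = x * cs.simple a) ∨
    ∃ a b, a ≠ b ∧ num cs f x a < 0 ∧ num cs f x b < 0 ∧ y = x * wab cs a b

/-- `n`-fold iteration of `Step`. -/
def StepN (cs : CoxeterSystem M W) (f : B → ℝ) : ℕ → W → W → Prop
  | 0, x, y => x = y
  | n + 1, x, y => ∃ z, Step cs f x z ∧ StepN cs f n z y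

/-- Two elements lie in a common finite residue of rank at most two. -/
def Close (cs : CoxeterSystem M W) (x y : W) : Prop :=
  x = y ∨ ∃ a b, a ≠ b ∧ M a b ≠ 0 ∧ x⁻¹ * y ∈ dih cs a b

/-- The paths of `x` and `y` pass through close elements again after at most three steps. -/
def Meet (cs : CoxeterSystem M W) (f : B → ℝ) (x y : W) : Prop :=
  ∃ i j x' y', i ≤ 3 ∧ j ≤ 3 ∧ 0 < i + j ∧ StepN cs f i x x' ∧ StepN cs f j y y' ∧ Close cs x' y'

theorem Close.symm {cs : CoxeterSystem M W} {x y : W} (h : Close cs x y) : Close cs y x := by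
  rcases h with rfl | ⟨a, b, h1, h2, h3⟩
  · exact Or.inl rfl
  · refine Or.inr ⟨a, b, h1, h2, ?_⟩
    have := inv_mem h3
    rwa [mul_inv_rev, inv_inv] at this

theorem Close.of_mem {cs : CoxeterSystem M W} {x y : W} (h : W) {a b : B} (hab : a ≠ b)
    (hm : M a b ≠ 0) {u v : W} (hu : u ∈ dih cs a b) (hv : v ∈ dih cs a b)
    (hx : x = h * u) (hy : y = h * v) : Close cs x y := by
  refine Or.inr ⟨a, b, hab, hm, ?_⟩
  have : x⁻¹ * y = u⁻¹ * v := by rw [hx, hy]; group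
  rw [this]
  exact mul_mem (inv_mem hu) hv

theorem Meet.symm {cs : CoxeterSystem M W} {f : B → ℝ} {x y : W} (h : Meet cs f x y) :
    Meet cs f y x := by
  obtain ⟨i, j, x', y', h1, h2, h3, h4, h5, h6⟩ := h
  exact ⟨j, i, y', x', h2, h1, by omega, h5, h4, h6.symm⟩

theorem step_two {cs : CoxeterSystem M W} {f : B → ℝ} {x : W} {a b : B} (hab : a ≠ b)
    (ha : num cs f x a < 0) (hb : num cs f x b < 0) : Step cs f x (x * wab cs a b) :=
  Or.inr ⟨a, b, hab, ha, hb, rfl⟩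

theorem step_one {cs : CoxeterSystem M W} {f : B → ℝ} {x : W} {a : B}
    (ha : num cs f x a < 0) (h : ∀ u, u ≠ a → 0 ≤ num cs f x u) : Step cs f x (x * cs.simple a) :=
  Or.inl ⟨a, ha, h, rfl⟩

theorem stepN_one {cs : CoxeterSystem M W} {f : B → ℝ} {x y : W} (h : Step cs f x y) :
    StepN cs f 1 x y := ⟨y, h, rfl⟩

theorem StepN.trans {cs : CoxeterSystem M W} {f : B → ℝ} {m n : ℕ} {x y z : W}
    (h1 : StepN cs f m x y) (h2 : StepN cs f n y z) : StepN cs f (m + n) x z := by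
  induction m generalizing x with
  | zero => rw [Nat.zero_add]; cases h1; exact h2
  | succ m ih =>
    obtain ⟨w, hw, h⟩ := h1
    rw [Nat.add_right_comm]
    exact ⟨w, hw, ih h⟩

theorem cosNum_eq_zero_iff {a b : B} (hab : a ≠ b) : cosNum M a b = 0 ↔ M a b = 2 := by
  rcases cosNum_range (M := M) hab with h | h | h
  · simp [h.1, h.2]
  · simp [h.1, h.2]
  · constructor
    · intro h0; linarith [h.2.1]
    · intro h0; have := h.2.2; omega

theorem cosNum_eq_one_iff {a b : B} (hab : a ≠ b) : cosNum M a b = 1 ↔ M a b = 3 := by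
  rcases cosNum_range (M := M) hab with h | h | h
  · simp [h.1, h.2]
  · simp [h.1, h.2]
  · constructor
    · intro h0; linarith [h.2.1]
    · intro h0; have := h.2.2; omega

theorem cosNum_cases {a b : B} (hab : a ≠ b) :
    cosNum M a b = 0 ∨ cosNum M a b = 1 ∨ (2 ≤ cosNum M a b ^ 2 ∧ 1 < cosNum M a b) := by
  rcases cosNum_range (M := M) hab with h | h | h
  · exact Or.inl h.1
  · exact Or.inr (Or.inl h.1)
  · exact Or.inr (Or.inr ⟨h.1, h.2.1⟩)

theorem wab_of_cosNum_zero (cs : CoxeterSystem M W) {a b : B} (hab : a ≠ b)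
    (h : cosNum M a b = 0) : wab cs a b = cs.simple a * cs.simple b := by
  rw [wab, (cosNum_eq_zero_iff hab).1 h]
  simp [alternatingWord, wordProd_cons]

theorem simple_comm_of_cosNum_zero (cs : CoxeterSystem M W) {a b : B} (hab : a ≠ b)
    (h : cosNum M a b = 0) : cs.simple a * cs.simple b = cs.simple b * cs.simple a := by
  rw [← wab_of_cosNum_zero cs hab h, wab_symm,
    wab_of_cosNum_zero cs hab.symm (by rwa [cosNum_symm])]

theorem wab_of_cosNum_one (cs : CoxeterSystem M W) {a b : B} (hab : a ≠ b)
    (h : cosNum M a b = 1) : wab cs a b = cs.simple a * cs.simple b * cs.simple a := by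
  rw [wab_symm, wab, M.symmetric b a, (cosNum_eq_one_iff hab).1 h]
  simp [alternatingWord, wordProd_cons, mul_assoc]

theorem simple_braid_of_cosNum_one (cs : CoxeterSystem M W) {a b : B} (hab : a ≠ b)
    (h : cosNum M a b = 1) : cs.simple a * cs.simple b * cs.simple a
      = cs.simple b * cs.simple a * cs.simple b := by
  rw [← wab_of_cosNum_one cs hab h, wab_symm,
    wab_of_cosNum_one cs hab.symm (by rwa [cosNum_symm])]

/-- The standing situation: a dominant functional on a two-dimensional Coxeter group. -/
structure Setting (cs : CoxeterSystem M W) (f : B → ℝ) : Prop where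
  tri : TriangleCond M
  dom : ∀ t, 0 ≤ f t

variable {cs : CoxeterSystem M W} {f : B → ℝ}

theorem Setting.finite_of_neg (S : Setting cs f) {x : W} {a b : B}
    (h : num cs f x a + num cs f x b < 0) : M a b ≠ 0 := by
  intro h0
  linarith [num_add_num_nonneg cs S.dom h0 x]

theorem Setting.nonneg_of_two (S : Setting cs f) {x : W} {a b r : B} (hab : a ≠ b) (har : a ≠ r)
    (hbr : b ≠ r) (ha : num cs f x a < 0) (hb : num cs f x b < 0) : 0 < num cs f x r := by
  have hm := S.finite_of_neg (a := a) (b := b) (x := x) (by linarith)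
  have h := num_triple cs S.tri S.dom hab har hbr x
  have ht := S.tri a b r hab har hbr
  have n1 := cosNum_nonneg (M := M) hab
  have n2 := cosNum_nonneg (M := M) har
  have n3 := cosNum_nonneg (M := M) hbr
  have l1 := cosNum_lt_two hm
  generalize cosNum M a b = c at *
  generalize cosNum M a r = c1 at *
  generalize cosNum M b r = c2 at *
  have k : 0 < 4 - c ^ 2 := by nlinarith
  by_contra hr
  push Not at hr
  have e1 : (4 - c ^ 2) * num cs f x r ≤ 0 := mul_nonpos_of_nonneg_of_nonpos k.le hr
  have z2 : 0 ≤ c * c2 := mul_nonneg n1 n3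
  have z3 : 0 ≤ c * c1 := mul_nonneg n1 n2
  have e2 : (2 * c1 + c * c2) * num cs f x a ≤ 0 :=
    mul_nonpos_of_nonneg_of_nonpos (by linarith) ha.le
  have e3 : (2 * c2 + c * c1) * num cs f x b ≤ 0 :=
    mul_nonpos_of_nonneg_of_nonpos (by linarith) hb.le
  have e2' : (2 * c1 + c * c2) * num cs f x a = 0 := by linarith
  have e3' : (2 * c2 + c * c1) * num cs f x b = 0 := by linarith
  have g1 : c1 = 0 := by
    rcases mul_eq_zero.1 e2' with h | h
    · linarith
    · linarith
  have g2 : c2 = 0 := by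
    rcases mul_eq_zero.1 e3' with h | h
    · linarith
    · linarith
  subst g1 g2
  nlinarith

theorem Setting.false_of_three (S : Setting cs f) {x : W} {a b r : B} (hab : a ≠ b) (har : a ≠ r)
    (hbr : b ≠ r) (ha : num cs f x a < 0) (hb : num cs f x b < 0) (hr : num cs f x r ≤ 0) :
    False := by
  linarith [S.nonneg_of_two hab har hbr ha hb]

/-- The possible values of a Gram coefficient `2 cos (π / m)`. -/
def CosVal (c : ℝ) : Prop := c = 0 ∨ c = 1 ∨ (2 ≤ c ^ 2 ∧ 1 < c)

theorem CosVal.nonneg {c : ℝ} (h : CosVal c) : 0 ≤ c := by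
  rcases h with h | h | h <;> linarith [h]

theorem CosVal.eq_zero_or {c : ℝ} (h : CosVal c) : c = 0 ∨ 1 ≤ c := by
  rcases h with h | h | h
  · exact Or.inl h
  · exact Or.inr h.ge
  · exact Or.inr h.2.le

theorem CosVal.sq_ge_two {c : ℝ} (h : CosVal c) (h0 : c ≠ 0) (h1 : c ≠ 1) : 2 ≤ c ^ 2 := by
  rcases h with h | h | h
  · exact absurd h h0
  · exact absurd h h1
  · exact h.1

theorem cosVal {a b : B} (hab : a ≠ b) : CosVal (cosNum M a b) := cosNum_cases hab

theorem chain_real_two {c p q A B' R : ℝ} (hc : CosVal c) (hp : CosVal p) (hq : CosVal q)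
    (hT : 4 ≤ c ^ 2 + p ^ 2 + q ^ 2 + c * p * q) (hA : 0 < A) (hB : 0 ≤ B')
    (h1 : 0 ≤ -A + c * (B' + c * A)) (h2 : R + p * A + q * (B' + c * A) < 0)
    (hw : 0 ≤ (4 - p ^ 2) * B' + (2 * c + p * q) * A + (2 * q + p * c) * R) :
    (q = 0 ∧ 1 ≤ c) ∨ (p = 0 ∧ q = 1 ∧ 3 ≤ c ^ 2) := by
  have c0 := hc.nonneg
  have p0 := hp.nonneg
  have q0 := hq.nonneg
  have c1 : 1 ≤ c := by
    rcases hc.eq_zero_or with h | h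
    · subst h; linarith
    · exact h
  rcases hq.eq_zero_or with h | q1
  · exact Or.inl ⟨h, c1⟩
  right
  have hpos : 0 < 2 * q + p * c := by nlinarith [mul_nonneg p0 c0]
  have k : 0 < (4 - p ^ 2 - 2 * q ^ 2 - p * c * q) * B'
      + (c * (2 - 2 * q ^ 2 - p ^ 2) - p * q - c ^ 2 * (p * q)) * A := by
    nlinarith [mul_lt_mul_of_pos_left h2 hpos]
  have e1 : c * (2 - 2 * q ^ 2 - p ^ 2) - p * q - c ^ 2 * (p * q) ≤ 0 := by
    have : c * (2 - 2 * q ^ 2 - p ^ 2) ≤ 0 :=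
      mul_nonpos_of_nonneg_of_nonpos c0 (by nlinarith)
    have : 0 ≤ p * q := mul_nonneg p0 q0
    nlinarith [mul_nonneg (sq_nonneg c) this]
  have e2 : 0 < 4 - p ^ 2 - 2 * q ^ 2 - p * c * q := by
    by_contra h
    push Not at h
    nlinarith [mul_nonneg hA.le (neg_nonneg.2 e1), mul_nonneg hB (neg_nonneg.2 h)]
  have pcq : 0 ≤ p * c * q := by positivity
  have q1' : q = 1 := by
    rcases hq with h | h | h
    · linarith
    · exact h
    · nlinarith [h.1]
  subst q1'
  have p0' : p = 0 := by
    rcases hp.eq_zero_or with h | h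
    · exact h
    · nlinarith
  subst p0'
  refine ⟨rfl, rfl, by nlinarith⟩

theorem chain_real_three {c p A B' R : ℝ} (hc : CosVal c) (hp : CosVal p)
    (hT : 4 ≤ c ^ 2 + p ^ 2) (hA : 0 < A) (hB : 0 ≤ B')
    (h1 : 0 ≤ (c ^ 2 - 1) * B' + (c ^ 3 - 2 * c) * A) (c1 : 1 ≤ c) (c2 : c < 2)
    (h2 : R + c ^ 2 * p * A + c * p * B' < 0)
    (hw : 0 ≤ (4 - p ^ 2) * B' + 2 * c * A + p * c * R) : False := by
  have p0 := hp.nonneg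
  have hp' : p ≠ 0 := by rintro rfl; nlinarith
  have p1 : 1 ≤ p := by
    rcases hp.eq_zero_or with h | h
    · exact absurd h hp'
    · exact h
  have cc : 2 ≤ c ^ 2 := by
    apply hc.sq_ge_two (by linarith)
    rintro rfl
    nlinarith
  have pc : 0 < p * c := by positivity
  have pp : 1 ≤ p ^ 2 := by nlinarith
  have key : (4 - p ^ 2 - c ^ 2 * p ^ 2) * B' + (2 * c - c ^ 3 * p ^ 2) * A > 0 := by
    nlinarith [mul_lt_mul_of_pos_left h2 pc]
  have k1 : 4 - p ^ 2 - c ^ 2 * p ^ 2 ≤ 0 := by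
    nlinarith [mul_nonneg (sub_nonneg.2 pp) (sub_nonneg.2 cc)]
  have k2 : 2 * c - c ^ 3 * p ^ 2 ≤ 0 := by
    have : 2 ≤ c ^ 2 * p ^ 2 := by nlinarith [mul_nonneg (sub_nonneg.2 pp) (sub_nonneg.2 cc)]
    nlinarith
  nlinarith [mul_nonneg hA.le (neg_nonneg.2 k2), mul_nonneg hB (neg_nonneg.2 k1)]

/-- The possible positions of `x` in its residue of type `{a, b}`, relative to the element `h` of
the residue at which `num cs f · a` and `num cs f · b` are nonnegative, when `num cs f x r` is
negative and `x` lies on the side of `a`. -/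
def ChainAt (cs : CoxeterSystem M W) (f : B → ℝ) (a b r : B) (h x : W) : Prop :=
  0 ≤ num cs f h a ∧ 0 ≤ num cs f h b ∧ num cs f h r < 0 ∧
  (x = h ∨
   (0 < num cs f h a ∧ num cs f h r + cosNum M a r * num cs f h a < 0 ∧
      (x = h * cs.simple a ∨
        (cosNum M b r = 0 ∧ 1 ≤ cosNum M a b ∧ x = h * cs.simple a * cs.simple b))) ∨
   (0 < num cs f h a ∧ cosNum M a r = 0 ∧ cosNum M b r = 1 ∧ 3 ≤ cosNum M a b ^ 2 ∧
      num cs f h r + num cs f h b + cosNum M a b * num cs f h a < 0 ∧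
      (x = h * cs.simple a * cs.simple b ∨
        x = h * cs.simple a * cs.simple b * cs.simple a)))

theorem Setting.chainAt_step (S : Setting cs f) {a b r : B} (hab : a ≠ b) (har : a ≠ r)
    (hbr : b ≠ r) (hm : M a b ≠ 0) {h x' x : W} (H : ChainAt cs f a b r h x')
    (hr : num cs f x r < 0)
    (he : (x = x' * cs.simple a ∧ 0 < num cs f x' a ∧ 0 ≤ num cs f x b) ∨
      (x = x' * cs.simple b ∧ 0 < num cs f x' b ∧ 0 ≤ num cs f x a)) :
    ChainAt cs f a b r h x ∨ ChainAt cs f b a r h x := by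
  obtain ⟨hA, hB, hR, H⟩ := H
  have sba : cosNum M b a = cosNum M a b := cosNum_symm _ _
  have sra : cosNum M r a = cosNum M a r := cosNum_symm _ _
  have srb : cosNum M r b = cosNum M b r := cosNum_symm _ _
  have c0 := cosNum_nonneg (M := M) hab
  have p0 := cosNum_nonneg (M := M) har
  have q0 := cosNum_nonneg (M := M) hbr
  have c2 := cosNum_lt_two hm
  have vc := cosVal (M := M) hab
  have vp := cosVal (M := M) har
  have vq := cosVal (M := M) hbr
  have hT := S.tri a b r hab har hbr
  have hw := num_triple cs S.tri S.dom har hab hbr.symm h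
  rw [srb] at hw
  rcases H with rfl | ⟨hA', hS, rfl | ⟨hq, hc1, rfl⟩⟩ | ⟨hA', hp, hq, hc, hS, rfl | rfl⟩
  · rcases he with ⟨rfl, h1, h2⟩ | ⟨rfl, h1, h2⟩
    · rw [num_mul_simple] at hr
      exact Or.inl ⟨hA, hB, hR, Or.inr (Or.inl ⟨h1, hr, Or.inl rfl⟩)⟩
    · rw [num_mul_simple] at hr
      exact Or.inr ⟨hB, hA, hR, Or.inr (Or.inl ⟨h1, hr, Or.inl rfl⟩)⟩
  · rcases he with ⟨rfl, h1, h2⟩ | ⟨rfl, h1, h2⟩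
    · rw [num_mul_simple_self] at h1
      linarith
    · simp only [num_mul_simple, cosNum_self, sba] at hr h1 h2
      rcases chain_real_two vc vp vq hT hA' hB (R := num cs f h r) (by linarith) (by linarith)
        (by linarith) with ⟨e1, e2⟩ | ⟨e1, e2, e3⟩
      · exact Or.inl ⟨hA, hB, hR, Or.inr (Or.inl ⟨hA', hS, Or.inr ⟨e1, e2, rfl⟩⟩)⟩
      · refine Or.inl ⟨hA, hB, hR, Or.inr (Or.inr ⟨hA', e1, e2, e3, ?_, Or.inl rfl⟩)⟩
        rw [e1, e2] at hr
        linarith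
  · exfalso
    rw [hq] at hT hw
    rcases he with ⟨rfl, h1, h2⟩ | ⟨rfl, h1, h2⟩
    · simp only [num_mul_simple, cosNum_self, sba, hq] at hr h1 h2
      exact chain_real_three (R := num cs f h r) vc vp (by linarith) hA' hB (by nlinarith) hc1 c2
        (by nlinarith) (by linarith)
    · simp only [num_mul_simple, cosNum_self, sba, hq] at hr h1 h2
      nlinarith
  · rcases he with ⟨rfl, h1, h2⟩ | ⟨rfl, h1, h2⟩
    · exact Or.inl ⟨hA, hB, hR, Or.inr (Or.inr ⟨hA', hp, hq, hc, hS, Or.inr rfl⟩)⟩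
    · simp only [num_mul_simple, cosNum_self, sba, hq] at hr h1 h2
      nlinarith
  · exfalso
    rcases he with ⟨rfl, h1, h2⟩ | ⟨rfl, h1, h2⟩
    · simp only [num_mul_simple, cosNum_self, sba, hq, hp] at hr h1 h2
      nlinarith [mul_nonneg c0 hB, mul_nonneg (sub_nonneg.2 hc) hA]
    · simp only [num_mul_simple, cosNum_self, sba, hq, hp] at hr h1 h2
      rw [hp, hq] at hw
      generalize cosNum M a b = c at *
      have e1 : 1 ≤ c := by nlinarith
      have e2 : 0 ≤ (2*c^3 - 4 * c) * num cs f h a := by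
        apply mul_nonneg _ hA'.le
        nlinarith
      nlinarith

theorem Setting.chain (S : Setting cs f) {a b r : B} (hab : a ≠ b) (har : a ≠ r) (hbr : b ≠ r)
    (hm : M a b ≠ 0) : ∀ (n : ℕ) (x : W), cs.length x = n → num cs f x r < 0 →
      ∃ h, ChainAt cs f a b r h x ∨ ChainAt cs f b a r h x := by
  intro n
  induction n using Nat.strong_induction_on with
  | _ n ih =>
    intro x hx hr
    have sub : ∀ e, num cs f x e < 0 → cs.length (x * cs.simple e) < n := by
      intro e he
      have := descent_of_num_neg cs S.dom he
      rw [← hx]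
      exact this
    have p0 := cosNum_nonneg (M := M) har
    have q0 := cosNum_nonneg (M := M) hbr
    by_cases h1 : num cs f x a < 0
    · have h2 : 0 ≤ num cs f x b := by
        by_contra h2
        push Not at h2
        exact S.false_of_three hab har hbr h1 h2 hr.le
      have h3 : num cs f (x * cs.simple a) r < 0 := by
        rw [num_mul_simple]
        nlinarith
      have ex : x = x * cs.simple a * cs.simple a := by simp
      have h4 : 0 < num cs f (x * cs.simple a) a := by
        rw [num_mul_simple_self]
        linarith
      obtain ⟨h, H | H⟩ := ih _ (sub a h1) _ rfl h3
      · exact ⟨h, S.chainAt_step hab har hbr hm H hr (Or.inl ⟨ex, h4, h2⟩)⟩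
      · exact ⟨h, (S.chainAt_step hab.symm hbr har (by rwa [M.symmetric]) H hr
          (Or.inr ⟨ex, h4, h2⟩)).symm⟩
    · push Not at h1
      by_cases h2 : num cs f x b < 0
      · have h3 : num cs f (x * cs.simple b) r < 0 := by
          rw [num_mul_simple]
          nlinarith
        have ex : x = x * cs.simple b * cs.simple b := by simp
        have h4 : 0 < num cs f (x * cs.simple b) b := by
          rw [num_mul_simple_self]
          linarith
        obtain ⟨h, H | H⟩ := ih _ (sub b h2) _ rfl h3
        · exact ⟨h, S.chainAt_step hab har hbr hm H hr (Or.inr ⟨ex, h4, h1⟩)⟩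
        · exact ⟨h, (S.chainAt_step hab.symm hbr har (by rwa [M.symmetric]) H hr
            (Or.inl ⟨ex, h4, h1⟩)).symm⟩
      · push Not at h2
        exact ⟨x, Or.inl ⟨h1, h2, hr, Or.inl rfl⟩⟩

/-- A pattern of signs that would force too many descents in the residue of type `{a, b}`. -/
theorem Setting.false_of_long (S : Setting cs f) {w : W} {a b u : B} (hab : a ≠ b) (hua : u ≠ a)
    (hub : u ≠ b) (ha : 0 < num cs f w a) (hb : num cs f w b + cosNum M a b * num cs f w a < 0)
    (hc : 3 ≤ cosNum M a b ^ 2) (hu : num cs f w u < 0) : False := by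
  have sba : cosNum M b a = cosNum M a b := cosNum_symm _ _
  have c0 := cosNum_nonneg (M := M) hab
  have c1 : 1 ≤ cosNum M a b := by nlinarith
  have hm : M a b ≠ 0 := S.finite_of_neg (x := w) (by nlinarith)
  have key : ∀ A B' c : ℝ, 3 ≤ c ^ 2 → 1 ≤ c → 0 < A → 0 ≤ B' →
      0 ≤ c * B' ∧ 0 ≤ c ^ 2 * B' - 3 * B' ∧ 0 < c * A ∧ 0 ≤ c ^ 2 * A - 3 * A ∧
      0 ≤ c ^ 3 * A - 3 * (c * A) ∧ 0 ≤ c ^ 3 * B' - 3 * (c * B') ∧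
      0 ≤ c ^ 4 * A - 3 * (c ^ 2 * A) := by
    intro A B' c h1 h2 h3 h4
    have h5 : 0 ≤ c * B' := by positivity
    have h6 : 0 < c * A := by positivity
    have h7 : 0 < c ^ 2 * A := by positivity
    refine ⟨h5, ?_, h6, ?_, ?_, ?_, ?_⟩ <;> nlinarith
  obtain ⟨h, H | H⟩ := S.chain hab hua.symm hub.symm hm _ w rfl hu
  · obtain ⟨hA, hB, hR, H⟩ := H
    rcases H with rfl | ⟨hA', hS, rfl | ⟨hq, hc1, rfl⟩⟩ | ⟨hA', hp, hq, hc, hS, rfl | rfl⟩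
    · nlinarith
    all_goals
      obtain ⟨k1, k2, k3, k4, k5, k6, k7⟩ := key _ _ _ hc c1 hA' hB
      simp only [num_mul_simple, cosNum_self, sba] at ha hb
      nlinarith
  · obtain ⟨hB, hA, hR, H⟩ := H
    rw [sba] at H
    rcases H with rfl | ⟨hA', hS, rfl | ⟨hq, hc1, rfl⟩⟩ | ⟨hA', hp, hq, hc, hS, rfl | rfl⟩
    · nlinarith
    all_goals
      obtain ⟨k1, k2, k3, k4, k5, k6, k7⟩ := key _ _ _ hc c1 hA' hA
      simp only [num_mul_simple, cosNum_self, sba] at ha hb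
      nlinarith

theorem simple_inj (cs : CoxeterSystem M W) {i j : B} (h : cs.simple i = cs.simple j) : i = j := by
  by_contra hij
  have h1 := root_mul_simple cs 1 i j
  rw [h, root_mul_simple_self, root_one, root_one] at h1
  have h2 := congrFun h1 j
  simp [Ne.symm hij] at h2
  linarith

theorem num_mul (cs : CoxeterSystem M W) (f : B → ℝ) (h v : W) (u : B) :
    num cs f (h * v) u = ∑ t, root cs v u t * num cs f h t := by
  have e : root cs v u = ∑ t, root cs v u t • (Pi.single t 1 : B → ℝ) := by
    ext i
    simp [Finset.sum_apply, Pi.single_apply]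
  have e2 : root cs (h * v) u = ∑ t, root cs v u t • root cs h t := by
    have : root cs (h * v) u = geomRep cs h (root cs v u) := by
      rw [root, root, map_mul, Module.End.mul_apply]
    rw [this]
    conv_lhs => rw [e]
    rw [map_sum]
    simp only [map_smul]
    rfl
  rw [num, e2]
  simp only [Finset.sum_apply, Pi.smul_apply, smul_eq_mul, num, Finset.mul_sum]
  rw [Finset.sum_comm]
  refine Finset.sum_congr rfl fun t _ => Finset.sum_congr rfl fun i _ => by ring

theorem root_coord_of_mem_dih (cs : CoxeterSystem M W) {a b e t : B} {v : W}
    (hv : v ∈ dih cs a b) (he : e = a ∨ e = b) (ha : t ≠ a) (hb : t ≠ b) : root cs v e t = 0 := by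
  have ht : t ∉ ({a, b} : Set B) := by
    rintro (h | h)
    · exact ha h
    · exact hb h
  rw [root, geomRep_coord_of_mem_closure cs hv ht]
  rcases he with rfl | rfl
  · simp [ha]
  · simp [hb]

theorem num_mul_of_mem_dih (cs : CoxeterSystem M W) (f : B → ℝ) {a b e : B} (hab : a ≠ b)
    (h : W) {v : W} (hv : v ∈ dih cs a b) (he : e = a ∨ e = b) :
    num cs f (h * v) e = root cs v e a * num cs f h a + root cs v e b * num cs f h b := by
  rw [num_mul, ← Finset.sum_pair (f := fun t => root cs v e t * num cs f h t) hab]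
  symm
  apply Finset.sum_subset (Finset.subset_univ _)
  intro t _ ht
  simp only [Finset.mem_insert, Finset.mem_singleton, not_or] at ht
  rw [root_coord_of_mem_dih cs hv he ht.1 ht.2, zero_mul]

theorem Setting.not_both_zero (S : Setting cs f) {h : W} {a b r : B} (hab : a ≠ b) (har : a ≠ r)
    (hbr : b ≠ r) (hm : M a b ≠ 0) (hr : num cs f h r < 0) (ha : num cs f h a = 0)
    (hb : num cs f h b = 0) : False := by
  have h1 := num_triple cs S.tri S.dom hab har hbr h
  rw [ha, hb] at h1
  have c0 := cosNum_nonneg (M := M) hab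
  have c2 := cosNum_lt_two hm
  nlinarith [mul_pos (show 0 < 4 - cosNum M a b ^ 2 by nlinarith) (neg_pos.2 hr)]

theorem Setting.bottom_descent (S : Setting cs f) {h : W} {a b r : B} (hab : a ≠ b) (har : a ≠ r)
    (hbr : b ≠ r) (hm : M a b ≠ 0) (hr : num cs f h r < 0) (ha : 0 ≤ num cs f h a)
    (hb : 0 ≤ num cs f h b) {v : W} (hv : v ∈ dih cs a b) {e : B} (he : e = a ∨ e = b)
    (hd : cs.IsRightDescent v e) (hn : 0 ≤ num cs f (h * v) e) :
    num cs f (h * v) e = 0 ∧ ((num cs f h a = 0 ∧ v * cs.simple e = cs.simple a * v) ∨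
      (num cs f h b = 0 ∧ v * cs.simple e = cs.simple b * v)) := by
  rw [num_mul_of_mem_dih cs f hab h hv he] at *
  have p1 : root cs v e a * num cs f h a ≤ 0 :=
    mul_nonpos_of_nonpos_of_nonneg (root_nonpos cs hd a) ha
  have p2 : root cs v e b * num cs f h b ≤ 0 :=
    mul_nonpos_of_nonpos_of_nonneg (root_nonpos cs hd b) hb
  have q1 : root cs v e a * num cs f h a = 0 := by linarith
  have q2 : root cs v e b * num cs f h b = 0 := by linarith
  refine ⟨by linarith, ?_⟩
  rcases ha.eq_or_lt with ha0 | ha0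
  · left
    refine ⟨ha0.symm, ?_⟩
    have hb0 : num cs f h b ≠ 0 := fun hb0 =>
      S.not_both_zero hab har hbr hm hr ha0.symm hb0
    have hz : root cs v e b = 0 := by
      rcases mul_eq_zero.1 q2 with h | h
      · exact h
      · exact absurd h hb0
    apply mul_simple_eq_of_root_eq
    apply root_eq_neg_single cs hd
    intro t ht
    by_cases htb : t = b
    · rw [htb, hz]
    · exact root_coord_of_mem_dih cs hv he ht htb
  · have hz : root cs v e a = 0 := by
      rcases mul_eq_zero.1 q1 with h | h
      · exact h
      · exact absurd h ha0.ne'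
    have e1 : root cs v e = - Pi.single b 1 := by
      apply root_eq_neg_single cs hd
      intro t ht
      by_cases hta : t = a
      · rw [hta, hz]
      · exact root_coord_of_mem_dih cs hv he hta ht
    right
    refine ⟨?_, mul_simple_eq_of_root_eq cs e1⟩
    rw [e1] at q2
    simpa using q2

theorem Setting.bottom_unique (S : Setting cs f) {h : W} {a b r : B} (hab : a ≠ b) (har : a ≠ r)
    (hbr : b ≠ r) (hm : M a b ≠ 0) (hr : num cs f h r < 0) (ha : 0 ≤ num cs f h a)
    (hb : 0 ≤ num cs f h b) {v : W} (hv : v ∈ dih cs a b) (ha' : 0 ≤ num cs f (h * v) a)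
    (hb' : 0 ≤ num cs f (h * v) b) :
    v = 1 ∨ (num cs f h a = 0 ∧ v = cs.simple a) ∨ (num cs f h b = 0 ∧ v = cs.simple b) := by
  by_cases hv1 : v = 1
  · exact Or.inl hv1
  right
  have hdesc : ∀ {v : W}, v ∈ dih cs a b → v ≠ 1 → ∃ e, (e = a ∨ e = b) ∧
      cs.IsRightDescent v e := by
    intro v hv h1
    by_contra hcon
    push Not at hcon
    exact h1 (eq_one_of_mem_dih cs hv (hcon a (Or.inl rfl)) (hcon b (Or.inr rfl)))
  have hn : ∀ {e}, e = a ∨ e = b → 0 ≤ num cs f (h * v) e := by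
    rintro e (rfl | rfl) <;> assumption
  obtain ⟨e, he, hd⟩ := hdesc hv hv1
  obtain ⟨h0, h1⟩ := S.bottom_descent hab har hbr hm hr ha hb hv he hd (hn he)
  have hev : cs.simple e ∈ dih cs a b := by
    rcases he with rfl | rfl
    · exact simple_mem_dih_left cs e b
    · exact simple_mem_dih_right cs a e
  by_cases hv' : v * cs.simple e = 1
  · have hve : v = cs.simple e := by
      rw [mul_eq_one_iff_eq_inv] at hv'
      simpa using hv'
    rcases h1 with ⟨h2, h3⟩ | ⟨h2, h3⟩
    · left
      refine ⟨h2, ?_⟩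
      rw [hve] at h3
      rw [hve]
      exact mul_right_cancel h3
    · right
      refine ⟨h2, ?_⟩
      rw [hve] at h3
      rw [hve]
      exact mul_right_cancel h3
  · exfalso
    have hvm := mul_mem hv hev
    obtain ⟨e', he', hd'⟩ := hdesc hvm hv'
    have hne : e ≠ e' := by
      rintro rfl
      exact (cs.isRightDescent_iff_not_isRightDescent_mul.1 hd) hd'
    have hn' : 0 ≤ num cs f (h * (v * cs.simple e)) e' := by
      rw [← mul_assoc, num_mul_simple, h0, mul_zero, add_zero]
      exact hn he'
    obtain ⟨-, h1'⟩ := S.bottom_descent hab har hbr hm hr ha hb hvm he' hd' hn'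
    apply hne
    apply simple_inj cs
    have fin : ∀ g : W, v * cs.simple e = g * v →
        v * cs.simple e * cs.simple e' = g * (v * cs.simple e) → cs.simple e = cs.simple e' := by
      intro g g1 g2
      rw [← mul_assoc, ← g1] at g2
      have := mul_left_cancel g2
      exact this.symm
    rcases h1 with ⟨h2, h3⟩ | ⟨h2, h3⟩ <;> rcases h1' with ⟨h2', h3'⟩ | ⟨h2', h3'⟩
    · exact fin _ h3 h3'
    · exact (S.not_both_zero hab har hbr hm hr h2 h2').elim
    · exact (S.not_both_zero hab har hbr hm hr h2' h2).elim
    · exact fin _ h3 h3'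

/-- `x` lies in the coset `h ⟨s_a, s_b⟩`. -/
def InCoset (cs : CoxeterSystem M W) (a b : B) (h x : W) : Prop := h⁻¹ * x ∈ dih cs a b

theorem InCoset.refl (a b : B) (h : W) : InCoset cs a b h h := by
  rw [InCoset, inv_mul_cancel]
  exact one_mem _

theorem InCoset.mul {a b : B} {h x u : W} (H : InCoset cs a b h x) (hu : u ∈ dih cs a b) :
    InCoset cs a b h (x * u) := by
  rw [InCoset, ← mul_assoc]
  exact MulMemClass.mul_mem H hu

theorem InCoset.left {a b : B} {h x : W} (H : InCoset cs a b h x) :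
    InCoset cs a b h (x * cs.simple a) := H.mul (simple_mem_dih_left cs a b)

theorem InCoset.right {a b : B} {h x : W} (H : InCoset cs a b h x) :
    InCoset cs a b h (x * cs.simple b) := H.mul (simple_mem_dih_right cs a b)

theorem InCoset.wab {a b : B} {h x : W} (H : InCoset cs a b h x) :
    InCoset cs a b h (x * wab cs a b) := H.mul (wab_mem_dih cs a b)

theorem InCoset.close {a b : B} {h x y : W} (hab : a ≠ b) (hm : M a b ≠ 0)
    (H1 : InCoset cs a b h x) (H2 : InCoset cs a b h y) : Close cs x y :=
  Close.of_mem h hab hm H1 H2 (by simp) (by simp)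

theorem step_comm {x : W} {a b : B} (hab : a ≠ b) (h0 : cosNum M a b = 0)
    (ha : num cs f x a < 0) (hb : num cs f x b < 0) :
    Step cs f x (x * cs.simple a * cs.simple b) := by
  have := step_two (cs := cs) (f := f) hab ha hb
  rwa [wab_of_cosNum_zero cs hab h0, ← mul_assoc] at this

theorem step_braid {x : W} {a b : B} (hab : a ≠ b) (h0 : cosNum M a b = 1)
    (ha : num cs f x a < 0) (hb : num cs f x b < 0) :
    Step cs f x (x * cs.simple a * cs.simple b * cs.simple a) := by
  have := step_two (cs := cs) (f := f) hab ha hb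
  rwa [wab_of_cosNum_one cs hab h0, ← mul_assoc, ← mul_assoc] at this

theorem mul_comm_simple {a b : B} (hab : a ≠ b) (h0 : cosNum M a b = 0) (x : W) :
    x * cs.simple a * cs.simple b = x * cs.simple b * cs.simple a := by
  rw [mul_assoc, simple_comm_of_cosNum_zero cs hab h0, mul_assoc]

theorem mul_braid_simple {a b : B} (hab : a ≠ b) (h0 : cosNum M a b = 1) (x : W) :
    x * cs.simple a * cs.simple b * cs.simple a = x * cs.simple b * cs.simple a * cs.simple b := by
  have := simple_braid_of_cosNum_one cs hab h0
  simp only [mul_assoc] at this ⊢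
  rw [this]

theorem finite_of_cosNum_lt {a b : B} (hab : a ≠ b) (h : cosNum M a b < 2) : M a b ≠ 0 := by
  rcases cosNum_range (M := M) hab with h1 | h1 | h1
  · omega
  · omega
  · intro h0
    rw [cosNum, if_pos h0] at h
    exact lt_irrefl _ h

/-- A pattern of signs that determines two steps. -/
theorem Setting.two_steps (S : Setting cs f) {e : W} {a b r : B} (hab : a ≠ b) (har : a ≠ r)
    (hbr : b ≠ r) (h0 : cosNum M a r = 0) (hb : num cs f e b < 0)
    (hr : 0 ≤ num cs f e r) (ha : 0 ≤ num cs f e a) (hr' : num cs f (e * cs.simple b) r < 0)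
    (ha' : num cs f (e * cs.simple b) a < 0) :
    StepN cs f 2 e (e * cs.simple b * cs.simple r * cs.simple a) := by
  refine ⟨e * cs.simple b, step_one hb ?_, _, step_comm har.symm (by rwa [cosNum_symm]) hr' ha', rfl⟩
  intro u hu
  by_contra hn
  push Not at hn
  by_cases hua : u = a
  · subst hua; linarith
  by_cases hur : u = r
  · subst hur; linarith
  refine S.false_of_three har (Ne.symm hua) (Ne.symm hur) ha' hr' ?_
  rw [num_mul_simple]
  nlinarith [cosNum_nonneg (M := M) (Ne.symm hu)]

theorem Setting.cosNum_of_opposite (S : Setting cs f) {h : W} {a r q : B} (har : a ≠ r)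
    (haq : a ≠ q) (hrq : r ≠ q) (hA : 0 < num cs f h a) (hR : num cs f h r < 0)
    (hQ : num cs f h q < 0) (hS : num cs f h r + cosNum M a r * num cs f h a < 0) :
    cosNum M a r = 0 ∨ (cosNum M a r = 1 ∧ cosNum M r q = 0) := by
  have sra : cosNum M r a = cosNum M a r := cosNum_symm _ _
  have vg := cosVal (M := M) har
  rcases vg.eq_zero_or with g0 | g1
  · exact Or.inl g0
  have hm : M a r ≠ 0 := by
    apply S.finite_of_neg (x := h * cs.simple a)
    rw [num_mul_simple_self, num_mul_simple]
    linarith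
  have key : ∀ A R g : ℝ, 1 ≤ g → 0 ≤ A → 0 ≤ R → 0 ≤ g * A ∧ 0 ≤ g * R ∧
      0 ≤ (g ^ 2 - 1) * A ∧ 0 ≤ (g ^ 2 - 1) * R := by
    intro A R g h1 h2 h3
    have : 0 ≤ g ^ 2 - 1 := by nlinarith
    refine ⟨?_, ?_, ?_, ?_⟩ <;> positivity
  have key2 : ∀ A R g : ℝ, 1 ≤ g → 2 ≤ g ^ 2 → 0 ≤ A → 0 ≤ R → 0 ≤ (g ^ 3 - 2 * g) * A := by
    intro A R g h1 h2 h3 h4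
    apply mul_nonneg _ h3
    nlinarith
  have key3 : ∀ A R g : ℝ, 3 ≤ g ^ 2 → 0 ≤ A → 0 ≤ (g ^ 4 - 3 * g ^ 2 + 1) * A := by
    intro A R g h1 h3
    apply mul_nonneg _ h3
    nlinarith
  obtain ⟨h', H | H⟩ := S.chain har haq hrq hm _ h rfl hQ
  · obtain ⟨hA0, hB0, hR0, H⟩ := H
    obtain ⟨k1, k2, k3, k4⟩ := key _ _ _ g1 hA0 hB0
    rcases H with rfl | ⟨hA', hS', rfl | ⟨hq, hc1, rfl⟩⟩ | ⟨hA', hp, hq, hc, hS', rfl | rfl⟩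
    · linarith
    · rw [num_mul_simple_self] at hA; linarith
    · refine Or.inr ⟨?_, hq⟩
      by_contra h1
      have g2 := vg.sq_ge_two (by linarith) h1
      have k5 := key2 _ _ _ g1 g2 hA0 hB0
      simp only [num_mul_simple, cosNum_self, sra] at hA hR hS
      nlinarith
    · have k5 := key2 _ _ _ g1 (by linarith) hA0 hB0
      simp only [num_mul_simple, cosNum_self, sra] at hA hR hS
      nlinarith
    · simp only [num_mul_simple, cosNum_self, sra] at hA hR hS
      nlinarith
  · obtain ⟨hB0, hA0, hR0, H⟩ := H
    rw [sra] at H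
    obtain ⟨k1, k2, k3, k4⟩ := key _ _ _ g1 hA0 hB0
    rcases H with rfl | ⟨hA', hS', rfl | ⟨hq, hc1, rfl⟩⟩ | ⟨hA', hp, hq, hc, hS', rfl | rfl⟩
    · linarith
    · simp only [num_mul_simple, cosNum_self, sra] at hA hR hS
      nlinarith
    · simp only [num_mul_simple, cosNum_self, sra] at hA hR hS
      nlinarith
    · simp only [num_mul_simple, cosNum_self, sra] at hA hR hS
      nlinarith
    · have k5 := key2 _ _ _ g1 (by linarith) hA0 hB0
      have k6 := key3 _ 0 _ hc hB0
      simp only [num_mul_simple, cosNum_self, sra] at hA hR hS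
      nlinarith

theorem Meet.of_coset {i j : ℕ} {x y x' y' : W} (hi : i ≤ 3) (hj : j ≤ 3) (hij : 0 < i + j)
    (hx : StepN cs f i x x') (hy : StepN cs f j y y') {a b : B} (hab : a ≠ b) (hm : M a b ≠ 0)
    {h : W} (h1 : InCoset cs a b h x') (h2 : InCoset cs a b h y') : Meet cs f x y :=
  ⟨i, j, x', y', hi, hj, hij, hx, hy, h1.close hab hm h2⟩

theorem stepN_zero {x : W} : StepN cs f 0 x x := rfl

theorem Setting.side_finite (S : Setting cs f) {h : W} {a r : B}
    (hA : 0 < num cs f h a) (hS : num cs f h r + cosNum M a r * num cs f h a < 0) :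
    M a r ≠ 0 := by
  apply S.finite_of_neg (x := h * cs.simple a)
  rw [num_mul_simple_self, num_mul_simple]
  linarith

theorem side_step {h : W} {a r : B} (har : a ≠ r)
    (hA : 0 < num cs f h a) (hS : num cs f h r + cosNum M a r * num cs f h a < 0) :
    Step cs f (h * cs.simple a) (h * cs.simple a * wab cs a r) := by
  apply step_two har
  · rw [num_mul_simple_self]; linarith
  · rw [num_mul_simple]; linarith

theorem side_step_comm {h : W} {a r : B} (har : a ≠ r) (h0 : cosNum M a r = 0)
    (hA : 0 < num cs f h a) (hR : num cs f h r < 0) :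
    Step cs f (h * cs.simple a) (h * cs.simple r) := by
  have := step_comm (cs := cs) (f := f) (x := h * cs.simple a) har h0
    (by rw [num_mul_simple_self]; linarith) (by rw [num_mul_simple, h0]; linarith)
  simpa using this

/-- Step at the second element of a side, when its second letter commutes with `r`. -/
theorem side_step_two_comm {h : W} {a b r : B} (hbr : b ≠ r)
    (h0 : cosNum M b r = 0) (hA : 0 < num cs f h a) (hB : 0 ≤ num cs f h b)
    (hc : 1 ≤ cosNum M a b) (hS : num cs f h r + cosNum M a r * num cs f h a < 0) :
    Step cs f (h * cs.simple a * cs.simple b) (h * cs.simple a * cs.simple r) := by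
  have hb : 0 < num cs f (h * cs.simple a) b := by
    rw [num_mul_simple]
    nlinarith
  exact side_step_comm hbr h0 hb (by rw [num_mul_simple]; linarith)

theorem Setting.exotic_steps (S : Setting cs f) {h : W} {a b r : B} (hab : a ≠ b) (har : a ≠ r)
    (hbr : b ≠ r) (hA : 0 < num cs f h a) (hB : 0 ≤ num cs f h b) (hR : num cs f h r < 0)
    (hp : cosNum M a r = 0) (hq : cosNum M b r = 1) (hc : 3 ≤ cosNum M a b ^ 2)
    (hS : num cs f h r + num cs f h b + cosNum M a b * num cs f h a < 0) :
    StepN cs f 1 h (h * cs.simple r) ∧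
    StepN cs f 1 (h * cs.simple a) (h * cs.simple r) ∧
    StepN cs f 1 (h * cs.simple a * cs.simple b) (h * cs.simple r * cs.simple a * cs.simple b) ∧
    StepN cs f 1 (h * cs.simple a * cs.simple b * cs.simple a)
      (h * cs.simple a * cs.simple b * cs.simple r) ∧
    StepN cs f 3 (h * cs.simple a * cs.simple b * cs.simple a)
      (h * cs.simple r * cs.simple a * cs.simple b * cs.simple a) := by
  have sba : cosNum M b a = cosNum M a b := cosNum_symm _ _
  have sra : cosNum M r a = cosNum M a r := cosNum_symm _ _
  have srb : cosNum M r b = cosNum M b r := cosNum_symm _ _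
  have c0 := cosNum_nonneg (M := M) hab
  have c1 : 1 ≤ cosNum M a b := by nlinarith
  have b1 : 0 < num cs f (h * cs.simple a) b := by
    rw [num_mul_simple]; nlinarith
  have b1' := b1
  rw [num_mul_simple] at b1'
  have a2 : 0 < num cs f (h * cs.simple a * cs.simple b) a := by
    simp only [num_mul_simple, cosNum_self, sba]
    nlinarith [mul_nonneg c0 hB, mul_nonneg (sub_nonneg.2 hc) hA.le]
  have r1 : num cs f (h * cs.simple a) r < 0 := by
    rw [num_mul_simple, hp]; linarith
  have r2 : num cs f (h * cs.simple a * cs.simple b) r < 0 := by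
    simp only [num_mul_simple, hp, hq]; linarith
  have step3 : StepN cs f 1 (h * cs.simple a * cs.simple b * cs.simple a)
      (h * cs.simple a * cs.simple b * cs.simple r) := stepN_one (side_step_comm har hp a2 r2)
  refine ⟨?_, stepN_one (side_step_comm har hp hA hR), ?_, step3, ?_⟩
  · refine stepN_one (step_one hR fun u hur => ?_)
    by_contra hu
    push Not at hu
    have hua : u ≠ a := by rintro rfl; linarith
    have hub : u ≠ b := by rintro rfl; linarith
    refine S.false_of_long (w := h * cs.simple r) hab hua hub ?_ ?_ hc ?_
    · rw [num_mul_simple, sra, hp]; linarith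
    · simp only [num_mul_simple, sra, hp, srb, hq]; linarith
    · rw [num_mul_simple]
      nlinarith [cosNum_nonneg (M := M) (Ne.symm hur)]
  · have := step_braid (cs := cs) (f := f) (x := h * cs.simple a * cs.simple b) hbr hq
      (by rw [num_mul_simple_self]; linarith) r2
    simp only [simple_mul_simple_cancel_right] at this
    rw [mul_comm_simple har hp] at this
    exact stepN_one this
  · have h2 := S.two_steps (e := h * cs.simple a * cs.simple b * cs.simple r) hab har hbr hp
      (by simp only [num_mul_simple, cosNum_self, hp, hq, srb]; linarith)
      (by rw [num_mul_simple_self]; linarith)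
      (by rw [num_mul_simple, sra, hp]; linarith)
      (by simp only [num_mul_simple, cosNum_self, hp, hq, srb]; linarith)
      (by
        simp only [num_mul_simple, cosNum_self, sba, sra, hp, hq, srb]
        nlinarith [mul_lt_mul_of_pos_left hS (show 0 < cosNum M a b by linarith)])
    rw [← mul_braid_simple hbr hq] at h2
    simp only [simple_mul_simple_cancel_right] at h2
    rw [mul_comm_simple har hp] at h2
    exact step3.trans h2

theorem Setting.meet_same (S : Setting cs f) {h x y : W} {a b r : B} (hab : a ≠ b) (har : a ≠ r)
    (hbr : b ≠ r) (hm : M a b ≠ 0) (Hx : ChainAt cs f a b r h x) (Hy : ChainAt cs f a b r h y)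
    (hxy : x ≠ y) : Meet cs f x y := by
  have l3 : (1 : ℕ) ≤ 3 := by omega
  obtain ⟨hA, hB, hR, Hx⟩ := Hx
  obtain ⟨-, -, -, Hy⟩ := Hy
  have m01 : 0 < num cs f h a → num cs f h r + cosNum M a r * num cs f h a < 0 →
      Meet cs f h (h * cs.simple a) := fun h1 h2 =>
    Meet.of_coset (Nat.zero_le 3) l3 one_pos stepN_zero (stepN_one (side_step har h1 h2)) har
      (S.side_finite h1 h2) (InCoset.refl a r h) (InCoset.refl a r h).left.wab
  have m02 : 0 < num cs f h a → num cs f h r + cosNum M a r * num cs f h a < 0 →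
      cosNum M b r = 0 → 1 ≤ cosNum M a b → Meet cs f h (h * cs.simple a * cs.simple b) :=
    fun h1 h2 h3 h4 =>
    Meet.of_coset (Nat.zero_le 3) l3 one_pos stepN_zero
      (stepN_one (side_step_two_comm hbr h3 h1 hB h4 h2)) har
      (S.side_finite h1 h2) (InCoset.refl a r h) (InCoset.refl a r h).left.right
  have m12 : 0 < num cs f h a → num cs f h r + cosNum M a r * num cs f h a < 0 →
      cosNum M b r = 0 → 1 ≤ cosNum M a b →
      Meet cs f (h * cs.simple a) (h * cs.simple a * cs.simple b) :=
    fun h1 h2 h3 h4 =>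
    Meet.of_coset (Nat.zero_le 3) l3 one_pos stepN_zero
      (stepN_one (side_step_two_comm hbr h3 h1 hB h4 h2)) har
      (S.side_finite h1 h2) (InCoset.refl a r h).left (InCoset.refl a r h).left.right
  have ex : 0 < num cs f h a → cosNum M a r = 0 → cosNum M b r = 1 → 3 ≤ cosNum M a b ^ 2 →
      num cs f h r + num cs f h b + cosNum M a b * num cs f h a < 0 →
      Meet cs f (h * cs.simple a) (h * cs.simple a * cs.simple b) ∧
      Meet cs f h (h * cs.simple a * cs.simple b) ∧
      Meet cs f h (h * cs.simple a * cs.simple b * cs.simple a) ∧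
      Meet cs f (h * cs.simple a) (h * cs.simple a * cs.simple b * cs.simple a) ∧
      Meet cs f (h * cs.simple a * cs.simple b)
        (h * cs.simple a * cs.simple b * cs.simple a) := by
    intro h1 h2 h3 h4 h5
    obtain ⟨s1, s2, s3, s4, s5⟩ := S.exotic_steps hab har hbr h1 hB hR h2 h3 h4 h5
    have mbr : M b r ≠ 0 := finite_of_cosNum_lt hbr (by rw [h3]; norm_num)
    have R1 := InCoset.refl (cs := cs) a b (h * cs.simple r)
    have R2 := InCoset.refl (cs := cs) b r (h * cs.simple a)
    exact ⟨Meet.of_coset l3 l3 (by omega) s2 s3 hab hm R1 R1.left.right,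
      Meet.of_coset l3 l3 (by omega) s1 s3 hab hm R1 R1.left.right,
      Meet.of_coset l3 le_rfl (by omega) s1 s5 hab hm R1 R1.left.right.left,
      Meet.of_coset (Nat.zero_le 3) l3 one_pos stepN_zero s4 hbr mbr R2 R2.left.right,
      Meet.of_coset (Nat.zero_le 3) l3 one_pos stepN_zero s4 hbr mbr R2.left R2.left.right⟩
  rcases Hx with rfl | ⟨x1, x2, rfl | ⟨x3, x4, rfl⟩⟩ | ⟨x1, x2, x3, x4, x5, rfl | rfl⟩ <;>
  rcases Hy with rfl | ⟨y1, y2, rfl | ⟨y3, y4, rfl⟩⟩ | ⟨y1, y2, y3, y4, y5, rfl | rfl⟩ <;>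
  first
    | exact absurd rfl hxy
    | (exfalso; linarith)
    | exact m01 ‹_› ‹_›
    | exact (m01 ‹_› ‹_›).symm
    | exact m02 ‹_› ‹_› ‹_› ‹_›
    | exact (m02 ‹_› ‹_› ‹_› ‹_›).symm
    | exact m12 ‹_› ‹_› ‹_› ‹_›
    | exact (m12 ‹_› ‹_› ‹_› ‹_›).symm
    | exact (ex ‹_› ‹_› ‹_› ‹_› ‹_›).1
    | exact (ex ‹_› ‹_› ‹_› ‹_› ‹_›).2.1
    | exact (ex ‹_› ‹_› ‹_› ‹_› ‹_›).2.2.1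
    | exact (ex ‹_› ‹_› ‹_› ‹_› ‹_›).2.2.2.1
    | exact (ex ‹_› ‹_› ‹_› ‹_› ‹_›).2.2.2.2
    | exact (ex ‹_› ‹_› ‹_› ‹_› ‹_›).1.symm
    | exact (ex ‹_› ‹_› ‹_› ‹_› ‹_›).2.1.symm
    | exact (ex ‹_› ‹_› ‹_› ‹_› ‹_›).2.2.1.symm
    | exact (ex ‹_› ‹_› ‹_› ‹_› ‹_›).2.2.2.1.symm
    | exact (ex ‹_› ‹_› ‹_› ‹_› ‹_›).2.2.2.2.symm

theorem ChainAt.side {a b r : B} {h x : W} (H : ChainAt cs f a b r h x) (hx : x ≠ h) :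
    0 < num cs f h a ∧ num cs f h r + cosNum M a r * num cs f h a < 0 := by
  obtain ⟨hA, hB, hR, rfl | ⟨x1, x2, -⟩ | ⟨x1, x2, -⟩⟩ := H
  · exact absurd rfl hx
  · exact ⟨x1, x2⟩
  · refine ⟨x1, ?_⟩
    rw [x2]
    linarith

theorem Setting.exotic_opposite_steps (S : Setting cs f) {h : W} {a b r : B} (hab : a ≠ b)
    (har : a ≠ r) (hbr : b ≠ r) (hA : 0 ≤ num cs f h a) (hB : 0 < num cs f h b)
    (hp : cosNum M a r = 0) (hq : cosNum M b r = 1)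
    (c1 : 1 ≤ cosNum M a b) (hS : num cs f h r + num cs f h b < 0)
    (hS' : num cs f h a + cosNum M a b * (num cs f h r + num cs f h b) < 0) :
    StepN cs f 1 (h * cs.simple b) (h * cs.simple r * cs.simple b) ∧
    StepN cs f 3 (h * cs.simple b * cs.simple a)
      (h * cs.simple r * cs.simple b * cs.simple a) := by
  have sba : cosNum M b a = cosNum M a b := cosNum_symm _ _
  have sra : cosNum M r a = cosNum M a r := cosNum_symm _ _
  have srb : cosNum M r b = cosNum M b r := cosNum_symm _ _
  have r1 : num cs f (h * cs.simple b) r < 0 := by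
    rw [num_mul_simple, hq]; linarith
  have a1 : 0 < num cs f (h * cs.simple b) a := by
    rw [num_mul_simple, sba]; nlinarith
  have a1' := a1
  rw [num_mul_simple, sba] at a1'
  have st : StepN cs f 1 (h * cs.simple b * cs.simple a) (h * cs.simple b * cs.simple r) :=
    stepN_one (side_step_comm har hp a1 r1)
  constructor
  · have := step_braid (cs := cs) (f := f) (x := h * cs.simple b) hbr hq
      (by rw [num_mul_simple_self]; linarith) r1
    simp only [simple_mul_simple_cancel_right] at this
    exact stepN_one this
  · have h2 := S.two_steps (e := h * cs.simple b * cs.simple r) hab har hbr hp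
      (by simp only [num_mul_simple, cosNum_self, hq, srb]; linarith)
      (by rw [num_mul_simple_self]; linarith)
      (by rw [num_mul_simple, sra, hp]; linarith)
      (by simp only [num_mul_simple, cosNum_self, hq, srb]; linarith)
      (by
        simp only [num_mul_simple, cosNum_self, sba, sra, hp, hq, srb]
        linarith)
    rw [← mul_braid_simple hbr hq] at h2
    simp only [simple_mul_simple_cancel_right] at h2
    exact st.trans h2

theorem Setting.meet_opposite_zero (S : Setting cs f) {h x y : W} {a b r : B} (hab : a ≠ b)
    (har : a ≠ r) (hbr : b ≠ r) (hm : M a b ≠ 0) (Hx : ChainAt cs f a b r h x)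
    (Hy : ChainAt cs f b a r h y) (hx : x ≠ h) (hy : y ≠ h) (hp : cosNum M a r = 0) :
    Meet cs f x y := by
  have sba : cosNum M b a = cosNum M a b := cosNum_symm _ _
  have c0 := cosNum_nonneg (M := M) hab
  have c2 := cosNum_lt_two hm
  have hT := S.tri a b r hab har hbr
  rw [hp] at hT
  have q1 : 1 ≤ cosNum M b r := by
    rcases (cosVal (M := M) hbr).eq_zero_or with h | h
    · rw [h] at hT; nlinarith
    · exact h
  obtain ⟨xA, xS⟩ := Hx.side hx
  obtain ⟨yB, yS⟩ := Hy.side hy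
  obtain ⟨hA, hB, hR, Hx⟩ := Hx
  obtain ⟨-, -, -, Hy⟩ := Hy
  rw [sba] at Hy
  have l3 : (1 : ℕ) ≤ 3 := by omega
  have mbr := S.side_finite yB yS
  have Hy' : y = h * cs.simple b ∨ (1 ≤ cosNum M a b ∧ y = h * cs.simple b * cs.simple a) := by
    rcases Hy with rfl | ⟨-, -, rfl | ⟨-, y4, rfl⟩⟩ | ⟨-, y2, -⟩
    · exact absurd rfl hy
    · exact Or.inl rfl
    · exact Or.inr ⟨y4, rfl⟩
    · linarith
  have exo : cosNum M b r = 1 → 3 ≤ cosNum M a b ^ 2 →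
      num cs f h r + num cs f h b + cosNum M a b * num cs f h a < 0 →
      ∃ j y', j ≤ 3 ∧ StepN cs f j y y' ∧ InCoset cs a b (h * cs.simple r) y' := by
    intro h1 h2 h3
    have R1 := InCoset.refl (cs := cs) a b (h * cs.simple r)
    have c1 : 1 ≤ cosNum M a b := by nlinarith
    have h4 : num cs f h r + num cs f h b < 0 := by
      rw [h1] at yS
      linarith
    have h5 : num cs f h a + cosNum M a b * (num cs f h r + num cs f h b) < 0 := by
      nlinarith [mul_lt_mul_of_pos_left h3 (show 0 < cosNum M a b by linarith)]
    obtain ⟨s1, s2⟩ := S.exotic_opposite_steps hab har hbr hA yB hp h1 c1 h4 h5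
    rcases Hy' with rfl | ⟨-, rfl⟩
    · exact ⟨1, _, l3, s1, R1.right⟩
    · exact ⟨3, _, le_rfl, s2, R1.right.left⟩
  rcases Hx with rfl | ⟨x1, x2, rfl | ⟨x3, x4, rfl⟩⟩ | ⟨x1, x2, x3, x4, x5, rfl | rfl⟩
  · exact absurd rfl hx
  · have R1 := InCoset.refl (cs := cs) b r h
    have s1 := stepN_one (side_step_comm har hp xA hR)
    rcases Hy' with rfl | ⟨y4, rfl⟩
    · exact Meet.of_coset l3 l3 (by omega) s1 (stepN_one (side_step hbr yB yS)) hbr mbr R1.right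
        R1.left.wab
    · exact Meet.of_coset l3 l3 (by omega) s1
        (stepN_one (side_step_two_comm har hp yB hA (by rwa [sba]) yS)) hbr mbr R1.right R1.left.right
  · linarith
  · obtain ⟨j, y', h1, h2, h3⟩ := exo x3 x4 x5
    obtain ⟨-, -, s3, -, -⟩ := S.exotic_steps hab har hbr x1 hB hR x2 x3 x4 x5
    exact Meet.of_coset l3 h1 (by omega) s3 h2 hab hm (InCoset.refl a b _).left.right h3
  · obtain ⟨j, y', h1, h2, h3⟩ := exo x3 x4 x5
    obtain ⟨-, -, -, -, s5⟩ := S.exotic_steps hab har hbr x1 hB hR x2 x3 x4 x5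
    exact Meet.of_coset le_rfl h1 (by omega) s5 h2 hab hm (InCoset.refl a b _).left.right.left h3

theorem Setting.opposite_false (S : Setting cs f) {h : W} {a b r : B} (hab : a ≠ b)
    (har : a ≠ r) (hbr : b ≠ r) (hA : 0 < num cs f h a) (hB : 0 < num cs f h b)
    (p1 : 1 ≤ cosNum M a r) (q1 : 1 ≤ cosNum M b r) (q2 : 2 ≤ cosNum M b r ^ 2)
    (hSa : num cs f h r + cosNum M a r * num cs f h a < 0)
    (hSb : num cs f h r + cosNum M b r * num cs f h b < 0) : False := by
  have sba : cosNum M b a = cosNum M a b := cosNum_symm _ _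
  have sra : cosNum M r a = cosNum M a r := cosNum_symm _ _
  have srb : cosNum M r b = cosNum M b r := cosNum_symm _ _
  have mbr := S.side_finite hB hSb
  have hw := num_triple cs S.tri S.dom hab har hbr h
  have c0 : cosNum M a b ≠ 0 := by
    intro hc
    rw [hc] at hw
    linarith
  have hRA : num cs f h r + num cs f h a < 0 := by nlinarith
  have hRB : num cs f h r + num cs f h b < 0 := by nlinarith
  have ha : num cs f (h * cs.simple r) a < 0 := by
    rw [num_mul_simple, sra]
    nlinarith
  have hb : num cs f (h * cs.simple r) b < 0 := by
    rw [num_mul_simple, srb]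
    nlinarith
  have hr : 0 < num cs f (h * cs.simple r) r := by
    rw [num_mul_simple_self]
    nlinarith
  have key : num cs f (h * cs.simple r) r * (cosNum M b r ^ 2 - 1)
      + cosNum M b r * num cs f (h * cs.simple r) b < 0 := by
    rw [num_mul_simple_self, num_mul_simple, srb]
    nlinarith
  generalize h * cs.simple r = x at *
  obtain ⟨h', H | H⟩ := S.chain hbr hab.symm har.symm mbr _ x rfl ha
  · obtain ⟨hA0, hB0, hR0, H⟩ := H
    rw [sra, sba] at H
    rcases H with rfl | ⟨hA', hS', rfl | ⟨hq, hc1, rfl⟩⟩ | ⟨hA', hp, hq, hc, hS', rfl | rfl⟩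
    · linarith
    · simp only [num_mul_simple, cosNum_self] at hb hr key
      have k1 : 0 ≤ (cosNum M b r ^ 2 - 1) * num cs f h' r :=
        mul_nonneg (by linarith) hB0
      have k2 : 0 ≤ cosNum M b r * (cosNum M b r ^ 2 - 2) * num cs f h' b :=
        mul_nonneg (mul_nonneg (by linarith) (by linarith)) hA0
      nlinarith
    · linarith
    · exact c0 hp
    · exact c0 hp
  · obtain ⟨hA0, hB0, hR0, H⟩ := H
    rw [sra, sba] at H
    rcases H with rfl | ⟨hA', hS', rfl | ⟨hq, hc1, rfl⟩⟩ | ⟨hA', hp, hq, hc, hS', rfl | rfl⟩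
    · linarith
    · rw [num_mul_simple_self] at hr
      linarith
    · exact c0 hq
    · linarith
    · linarith

theorem Setting.meet_opposite_eq (S : Setting cs f) {h x y : W} {a b r : B} (hab : a ≠ b)
    (har : a ≠ r) (hbr : b ≠ r) (hm : M a b ≠ 0) (Hx : ChainAt cs f a b r h x)
    (Hy : ChainAt cs f b a r h y) (hx : x ≠ h) (hy : y ≠ h) : Meet cs f x y := by
  rcases (cosVal (M := M) har) with hp | hp | hp
  · exact S.meet_opposite_zero hab har hbr hm Hx Hy hx hy hp
  all_goals
    rcases (cosVal (M := M) hbr) with hq | hq | hq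
    · exact (S.meet_opposite_zero hab.symm hbr har (by rwa [M.symmetric]) Hy Hx hy hx hq).symm
  all_goals
    obtain ⟨xA, xS⟩ := Hx.side hx
    obtain ⟨yB, yS⟩ := Hy.side hy
  · obtain ⟨-, -, hR, Hx⟩ := Hx
    obtain ⟨-, -, -, Hy⟩ := Hy
    have hx : x = h * cs.simple a := by
      rcases Hx with rfl | ⟨x1, x2, rfl | ⟨x3, x4, rfl⟩⟩ | ⟨x1, x2, -⟩
      · exact absurd rfl hx
      · rfl
      · linarith
      · linarith
    have hy : y = h * cs.simple b := by
      rcases Hy with rfl | ⟨x1, x2, rfl | ⟨x3, x4, rfl⟩⟩ | ⟨x1, x2, -⟩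
      · exact absurd rfl hy
      · rfl
      · linarith
      · linarith
    subst hx hy
    have s1 := step_braid (cs := cs) (f := f) (x := h * cs.simple a) har hp
      (by rw [num_mul_simple_self]; linarith) (by rw [num_mul_simple]; linarith)
    have s2 := step_braid (cs := cs) (f := f) (x := h * cs.simple b) hbr hq
      (by rw [num_mul_simple_self]; linarith) (by rw [num_mul_simple]; linarith)
    simp only [simple_mul_simple_cancel_right] at s1 s2
    exact Meet.of_coset (by omega) (by omega) (by omega) (stepN_one s1) (stepN_one s2) hab hm
      (InCoset.refl a b _).left (InCoset.refl a b _).right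
  · exact (S.opposite_false hab har hbr xA yB hp.ge hq.2.le hq.1 xS yS).elim
  · exact (S.opposite_false hab.symm hbr har yB xA hq.ge hp.2.le hp.1 yS xS).elim
  · exact (S.opposite_false hab har hbr xA yB hp.2.le hq.2.le hq.1 xS yS).elim

/-- A sign pattern forcing too many descents in the residue of type `{a, q}`. -/
theorem Setting.false_of_longer (S : Setting cs f) {x : W} {a q r : B} (haq : a ≠ q) (har : a ≠ r)
    (hqr : q ≠ r) (hm : M a q ≠ 0) (hc : 3 ≤ cosNum M a q ^ 2) (hr : num cs f x r < 0)
    (ha : 0 < num cs f x a)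
    (h1 : (cosNum M a q ^ 2 - 1) * num cs f x a + cosNum M a q * num cs f x q < 0) : False := by
  have sqa : cosNum M q a = cosNum M a q := cosNum_symm _ _
  have c0 := cosNum_nonneg (M := M) haq
  have key : ∀ c P : ℝ, 0 ≤ c → 3 ≤ c ^ 2 → 0 ≤ P →
      0 ≤ c * P ∧ 0 ≤ c ^ 2 * P - 3 * P ∧ 0 ≤ c ^ 3 * P - 3 * (c * P) ∧
      0 ≤ c ^ 4 * P - 3 * (c ^ 2 * P) ∧ 0 ≤ c ^ 5 * P - 4 * (c ^ 3 * P) + 3 * (c * P) := by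
    intro c P h1 h2 h3
    have e1 : 0 ≤ c * P := by positivity
    have e2 : 0 ≤ c ^ 2 * P - 3 * P := by nlinarith
    have e3 : 0 ≤ c ^ 3 * P - 3 * (c * P) := by nlinarith
    have e4 : 0 ≤ c ^ 4 * P - 3 * (c ^ 2 * P) := by nlinarith [mul_nonneg (sq_nonneg c) e2]
    have e5 : 0 ≤ (c ^ 2 - 1) * (c ^ 3 * P - 3 * (c * P)) := mul_nonneg (by linarith) e3
    exact ⟨e1, e2, e3, e4, by nlinarith⟩
  have hq : num cs f x q < 0 := by
    by_contra hq
    push Not at hq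
    have : 0 ≤ cosNum M a q * num cs f x q := mul_nonneg c0 hq
    nlinarith
  obtain ⟨h', H | H⟩ := S.chain haq har hqr hm _ x rfl hr
  · obtain ⟨hA0, hB0, hR0, H⟩ := H
    obtain ⟨k1, k2, k3, k4, k5⟩ := key _ _ c0 hc hA0
    obtain ⟨l1, l2, l3, l4, l5⟩ := key _ _ c0 hc hB0
    rcases H with rfl | ⟨hA', hS', rfl | ⟨hq, hc1, rfl⟩⟩ | ⟨hA', hp, hq, hc, hS', rfl | rfl⟩
    · linarith
    · rw [num_mul_simple_self] at ha
      linarith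
    all_goals
      simp only [num_mul_simple, cosNum_self, sqa] at ha hq h1
      nlinarith
  · obtain ⟨hB0, hA0, hR0, H⟩ := H
    rw [sqa] at H
    obtain ⟨k1, k2, k3, k4, k5⟩ := key _ _ c0 hc hA0
    obtain ⟨l1, l2, l3, l4, l5⟩ := key _ _ c0 hc hB0
    rcases H with rfl | ⟨hA', hS', rfl | ⟨hq, hc1, rfl⟩⟩ | ⟨hA', hp, hq, hc, hS', rfl | rfl⟩
    · linarith
    all_goals
      simp only [num_mul_simple, cosNum_self, sqa] at ha hq h1
      nlinarith

theorem Setting.single_descent (S : Setting cs f) {h : W} {a r q : B} (har : a ≠ r) (haq : a ≠ q)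
    (hrq : r ≠ q) (hA : 0 < num cs f h a) (hR : num cs f h r < 0) (hQ : num cs f h q < 0)
    (hp : cosNum M a r = 1) (h0 : cosNum M r q = 0) (hS : num cs f h r + num cs f h a < 0) :
    M a q ≠ 0 ∧ Step cs f (h * cs.simple q) (h * cs.simple r * cs.simple q) := by
  have sra : cosNum M r a = cosNum M a r := cosNum_symm _ _
  have sqa : cosNum M q a = cosNum M a q := cosNum_symm _ _
  have sqr : cosNum M q r = cosNum M r q := cosNum_symm _ _
  have hT := S.tri a r q har haq hrq
  rw [hp, h0] at hT
  have c0 := cosNum_nonneg (M := M) haq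
  have hc : 3 ≤ cosNum M a q ^ 2 := by linarith
  have hm : M a q ≠ 0 := by
    apply S.finite_of_neg (x := h * cs.simple r)
    simp only [num_mul_simple, sra, hp, h0]
    linarith
  refine ⟨hm, ?_⟩
  rw [mul_comm_simple hrq h0]
  refine step_one (by rw [num_mul_simple, sqr, h0]; linarith) fun u hur => ?_
  by_contra hu
  push Not at hu
  have huq : u ≠ q := by
    rintro rfl
    rw [num_mul_simple_self] at hu
    linarith
  by_cases hua : u = a
  · subst hua
    have hu' := hu
    rw [num_mul_simple, sqa] at hu'
    refine S.false_of_longer (x := h * cs.simple r * cs.simple q * cs.simple u) haq har hrq.symm hm hc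
      ?_ ?_ ?_ <;> simp only [num_mul_simple, cosNum_self, sra, sqa, sqr, hp, h0]
    · linarith
    · nlinarith
    · nlinarith
  · refine S.false_of_long (w := h * cs.simple r * cs.simple q) haq.symm huq hua ?_ ?_
      (by rwa [sqa]) ?_
    · simp only [num_mul_simple, cosNum_self, h0]
      linarith
    · simp only [num_mul_simple, cosNum_self, sra, sqa, hp, h0]
      linarith
    · have n1 := cosNum_nonneg (M := M) (Ne.symm hur)
      rw [num_mul_simple] at hu
      simp only [num_mul_simple, h0]
      nlinarith

theorem Setting.eq_side (S : Setting cs f) {h x : W} {a b r q : B} (hab : a ≠ b)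
    (hbr : b ≠ r) (haq : a ≠ q) (hbq : b ≠ q) (hrq : r ≠ q)
    (Hx : ChainAt cs f a b r h x) (hx : x ≠ h) (hQ : num cs f h q < 0)
    (H : cosNum M b q = 0 ∨ (cosNum M b q = 1 ∧ cosNum M r q = 0)) : x = h * cs.simple a := by
  have sra : cosNum M r a = cosNum M a r := cosNum_symm _ _
  have srb : cosNum M r b = cosNum M b r := cosNum_symm _ _
  obtain ⟨hA, hB, hR, Hx⟩ := Hx
  have key : cosNum M a r = 0 → cosNum M b r = 1 → 3 ≤ cosNum M a b ^ 2 → 0 < num cs f h a →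
      num cs f h r + num cs f h b + cosNum M a b * num cs f h a < 0 → False := by
    intro h1 h2 h3 h4 h5
    refine S.false_of_long (w := h * cs.simple r) (u := q) hab haq.symm hbq.symm ?_ ?_ h3 ?_
    · rw [num_mul_simple, sra, h1]; linarith
    · simp only [num_mul_simple, sra, h1, srb, h2]; linarith
    · rw [num_mul_simple]
      nlinarith [cosNum_nonneg (M := M) hrq]
  rcases Hx with rfl | ⟨hA', hS', rfl | ⟨hq, hc1, rfl⟩⟩ | ⟨hA', hp, hq, hc, hS', rfl | rfl⟩
  · exact absurd rfl hx
  · rfl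
  · exfalso
    have hm : M r q ≠ 0 := S.finite_of_neg (x := h) (by linarith)
    have hT := S.tri b r q hbr hbq hrq
    have g0 := cosNum_nonneg (M := M) hrq
    have g2 := cosNum_lt_two hm
    rw [hq] at hT
    rcases H with h1 | ⟨h1, h2⟩
    · rw [h1] at hT
      nlinarith
    · rw [h1, h2] at hT
      linarith
  · exact (key hp hq hc hA' hS').elim
  · exact (key hp hq hc hA' hS').elim

theorem Setting.meet_opposite_ne (S : Setting cs f) {h x y : W} {a b r q : B} (hab : a ≠ b)
    (har : a ≠ r) (hbr : b ≠ r) (haq : a ≠ q) (hbq : b ≠ q) (hrq : r ≠ q)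
    (Hx : ChainAt cs f a b r h x) (Hy : ChainAt cs f b a q h y) (hx : x ≠ h) (hy : y ≠ h) :
    Meet cs f x y := by
  have sqr : cosNum M q r = cosNum M r q := cosNum_symm _ _
  obtain ⟨hA, hSa⟩ := Hx.side hx
  obtain ⟨hB, hSb⟩ := Hy.side hy
  have hR := Hx.2.2.1
  have hQ := Hy.2.2.1
  have o1 := S.cosNum_of_opposite har haq hrq hA hR hQ hSa
  have o2 := S.cosNum_of_opposite hbq hbr hrq.symm hB hQ hR hSb
  have ex := S.eq_side hab hbr haq hbq hrq Hx hx hQ (by rwa [sqr] at o2)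
  have ey := S.eq_side hab.symm haq hbr har hrq.symm Hy hy hR (by rwa [← sqr] at o1)
  subst ex ey
  have l3 : (1 : ℕ) ≤ 3 := by omega
  have braid : ∀ {a r q : B}, a ≠ r → 0 < num cs f h a → num cs f h r < 0 →
      num cs f h r + cosNum M a r * num cs f h a < 0 → cosNum M a r = 1 →
      Step cs f (h * cs.simple a) (h * cs.simple r * cs.simple a) := by
    intro a r q h1 h2 h3 h4 h5
    have s1 := step_braid (cs := cs) (f := f) (x := h * cs.simple a) h1 h5
      (by rw [num_mul_simple_self]; linarith) (by rw [num_mul_simple]; linarith)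
    simpa only [simple_mul_simple_cancel_right] using s1
  rcases o1 with p0 | ⟨p1, g0⟩ <;> rcases o2 with q0 | ⟨q1, g0'⟩
  · exact Meet.of_coset l3 l3 (by omega) (stepN_one (side_step_comm har p0 hA hR))
      (stepN_one (side_step_comm hbq q0 hB hQ)) hrq (S.finite_of_neg (x := h) (by linarith))
      (InCoset.refl r q h).left (InCoset.refl r q h).right
  · obtain ⟨hm, st⟩ := S.single_descent hbq hbr hrq.symm hB hQ hR q1 g0' (by
      rw [q1] at hSb; linarith)
    exact Meet.of_coset (by omega) l3 (by omega)
      ((stepN_one (side_step_comm har p0 hA hR)).trans (stepN_one st))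
      (stepN_one (braid (q := q) hbq hB hQ hSb q1)) hbr hm
      (InCoset.refl b r _).right (InCoset.refl b r _).left
  · obtain ⟨hm, st⟩ := S.single_descent har haq hrq hA hR hQ p1 g0 (by
      rw [p1] at hSa; linarith)
    exact Meet.of_coset l3 (by omega) (by omega)
      (stepN_one (braid (q := q) har hA hR hSa p1))
      ((stepN_one (side_step_comm hbq q0 hB hQ)).trans (stepN_one st)) haq hm
      (InCoset.refl a q _).left (InCoset.refl a q _).right
  · exfalso
    have sra : cosNum M r a = cosNum M a r := cosNum_symm _ _
    have sqa : cosNum M q a = cosNum M a q := cosNum_symm _ _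
    have sqb : cosNum M q b = cosNum M b q := cosNum_symm _ _
    have hT := S.tri a r q har haq hrq
    rw [p1, g0] at hT
    rw [p1] at hSa
    rw [q1] at hSb
    refine S.false_of_long (w := h * cs.simple r * cs.simple q) (u := b) haq.symm hbq
      hab.symm ?_ ?_ (by rw [sqa]; linarith) ?_
    · simp only [num_mul_simple, cosNum_self, g0]
      linarith
    · simp only [num_mul_simple, cosNum_self, sra, sqa, p1, g0]
      linarith
    · simp only [num_mul_simple, sqb, q1, g0]
      nlinarith [cosNum_nonneg (M := M) hbr.symm]

theorem Setting.mirror_side (S : Setting cs f) {h x : W} {a b r : B} (hab : a ≠ b)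
    (har : a ≠ r) (hbr : b ≠ r) (hm : M a b ≠ 0) (hA : num cs f h a = 0)
    (Hx : ChainAt cs f b a r h x) :
    StepN cs f 1 x (h * cs.simple r) ∨ (cosNum M a r = 0 ∧
      ∃ i x', 0 < i ∧ i ≤ 3 ∧ StepN cs f i x x' ∧ InCoset cs a b (h * cs.simple r) x') := by
  obtain ⟨hB, -, hR, H⟩ := Hx
  have sba : cosNum M b a = cosNum M a b := cosNum_symm _ _
  have srb : cosNum M r b = cosNum M b r := cosNum_symm _ _
  have hT := S.tri a b r hab har hbr
  have hN := num_triple cs S.tri S.dom har hab hbr.symm h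
  rw [hA, srb] at hN
  have c0 := cosNum_nonneg (M := M) hab
  have p0 := cosNum_nonneg (M := M) har
  have c2 := cosNum_lt_two hm
  have vp := cosVal (M := M) har
  have vq := cosVal (M := M) hbr
  have vc := cosVal (M := M) hab
  rcases H with rfl | ⟨hB', hS, H⟩ | ⟨hB', hq, hp, hc, hS, H⟩
  · left
    refine stepN_one (step_one hR fun u hu => ?_)
    by_contra hun
    by_cases hua : u = a
    · subst hua; exact hun hA.ge
    by_cases hub : u = b
    · subst hub; exact hun hB
    exact S.false_of_three (Ne.symm hu) har.symm hua hR (not_le.1 hun) hA.le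
  · have key : cosNum M b r = 0 ∨ (cosNum M b r = 1 ∧ cosNum M a r = 0) := by
      rcases vq with q | q | ⟨q, q'⟩
      · exact Or.inl q
      · rw [q] at hN hS hT ⊢
        rcases vp with p | p | ⟨p, p'⟩
        · exact Or.inr ⟨rfl, p⟩
        · rw [p] at hN hT
          rcases vc.eq_zero_or with c | c
          · rw [c] at hT; norm_num at hT
          · nlinarith
        · nlinarith [mul_nonneg p0 c0]
      · exfalso
        have t : 0 ≤ cosNum M a r * cosNum M a b := mul_nonneg p0 c0
        have t1 : (2 * cosNum M b r + cosNum M a r * cosNum M a b)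
            * (num cs f h r + cosNum M b r * num cs f h b) ≤ 0 :=
          mul_nonpos_of_nonneg_of_nonpos (by linarith) hS.le
        have t2 : 0 ≤ (cosNum M b r ^ 2 - 2) * num cs f h b :=
          mul_nonneg (by linarith) hB
        have t3 : 0 ≤ cosNum M a r * cosNum M a b * cosNum M b r * num cs f h b :=
          mul_nonneg (mul_nonneg t (by linarith)) hB
        have t4 : 2 * cosNum M b r * (num cs f h r + cosNum M b r * num cs f h b) < 0 :=
          mul_neg_of_pos_of_neg (by linarith) hS
        have t5 : cosNum M a r * cosNum M a b
            * (num cs f h r + cosNum M b r * num cs f h b) ≤ 0 :=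
          mul_nonpos_of_nonneg_of_nonpos t hS.le
        nlinarith [mul_nonneg (sq_nonneg (cosNum M a r)) hB]
    rcases key with q | ⟨q, p⟩
    · rcases H with rfl | ⟨p, -, rfl⟩
      · exact Or.inl (stepN_one (side_step_comm hbr q hB' hR))
      · exfalso
        rw [p, q] at hT
        nlinarith
    · right
      refine ⟨p, ?_⟩
      rw [p, q] at hT
      rw [q] at hS
      have c1 : 1 ≤ cosNum M a b := by nlinarith
      obtain ⟨e1, e2⟩ := S.exotic_opposite_steps hab har hbr hA.ge hB' p q c1 (by linarith)
        (by rw [hA]; nlinarith)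
      rcases H with rfl | ⟨-, -, rfl⟩
      · exact ⟨1, _, by omega, by omega, e1, (InCoset.refl a b _).right⟩
      · exact ⟨3, _, by omega, by omega, e2, (InCoset.refl a b _).right.left⟩
  · exfalso
    rw [hp, hq] at hN
    rw [hA, sba] at hS
    rw [sba] at hc
    nlinarith

theorem Setting.meet_mirror (S : Setting cs f) {h x y : W} {a b r q : B} (hab : a ≠ b)
    (har : a ≠ r) (hbr : b ≠ r) (haq : a ≠ q) (hm : M a b ≠ 0)
    (hA : num cs f h a = 0) (Hx : ChainAt cs f b a r h x)
    (Hy : ChainAt cs f b a q (h * cs.simple a) y) : Meet cs f x y := by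
  have hR := Hx.2.2.1
  have nu : ∀ u, num cs f (h * cs.simple a) u = num cs f h u := by
    intro u; rw [num_mul_simple, hA]; ring
  have hqr : q = r := by
    by_contra hne
    have hQ := Hy.2.2.1
    rw [nu] at hQ
    exact S.false_of_three (Ne.symm hne) har.symm haq.symm hR hQ hA.le
  subst hqr
  have hA' : num cs f (h * cs.simple a) a = 0 := by rw [nu, hA]
  have l3 : (1 : ℕ) ≤ 3 := by omega
  have hx := S.mirror_side hab har hbr hm hA Hx
  have hy := S.mirror_side hab har hbr hm hA' Hy
  have up : cosNum M a q = 0 → ∀ {k z : W}, (StepN cs f 1 z (k * cs.simple q) ∨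
      (cosNum M a q = 0 ∧ ∃ i x', 0 < i ∧ i ≤ 3 ∧ StepN cs f i z x' ∧
        InCoset cs a b (k * cs.simple q) x')) → ∃ i x', 0 < i ∧ i ≤ 3 ∧ StepN cs f i z x' ∧
        InCoset cs a b (k * cs.simple q) x' := by
    rintro - k z (H | ⟨-, H⟩)
    · exact ⟨1, _, by omega, l3, H, InCoset.refl a b _⟩
    · exact H
  by_cases p : cosNum M a q = 0
  · obtain ⟨i, x', i0, i3, hi, hc⟩ := up p hx
    obtain ⟨j, y', j0, j3, hj, hd⟩ := up p hy
    rw [mul_comm_simple har p] at hd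
    refine Meet.of_coset i3 j3 (by omega) hi hj hab hm hc ?_
    have := MulMemClass.mul_mem (simple_mem_dih_left cs a b) hd
    rw [InCoset]
    simpa [mul_assoc] using this
  · rcases hx with hx | hx
    · rcases hy with hy | hy
      · exact Meet.of_coset l3 l3 (by omega) hx hy har
          (S.finite_of_neg (x := h) (by rw [hA]; linarith))
          (InCoset.refl a q h).right (InCoset.refl a q h).left.right
      · exact absurd hy.1 p
    · exact absurd hx.1 p

theorem exists_step {x : W} {a : B} (ha : num cs f x a < 0) : ∃ y, Step cs f x y := by
  by_cases h : ∀ u, u ≠ a → 0 ≤ num cs f x u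
  · exact ⟨_, step_one ha h⟩
  · push Not at h
    obtain ⟨u, hu, hn⟩ := h
    exact ⟨_, step_two hu.symm ha hn⟩

theorem ChainAt.swap_bottom {a b r s : B} {h x : W} (H : ChainAt cs f a b r h x) (hr : s = r) :
    ChainAt cs f b a s h h :=
  ⟨H.2.1, H.1, hr ▸ H.2.2.1, Or.inl rfl⟩

theorem ChainAt.bottom {a b r : B} {h x : W} (H : ChainAt cs f a b r h x) :
    ChainAt cs f a b r h h :=
  ⟨H.1, H.2.1, H.2.2.1, Or.inl rfl⟩

theorem InCoset.swap {a b : B} {h x : W} (H : InCoset cs a b h x) : InCoset cs b a h x := by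
  rwa [InCoset, dih_symm]

theorem ChainAt.inCoset {a b r : B} {h x : W} (H : ChainAt cs f a b r h x) :
    InCoset cs a b h x := by
  have h0 := InCoset.refl (cs := cs) a b h
  rcases H.2.2.2 with rfl | ⟨-, -, rfl | ⟨-, -, rfl⟩⟩ | ⟨-, -, -, -, -, rfl | rfl⟩
  · exact h0
  · exact h0.left
  · exact h0.left.right
  · exact h0.left.right
  · exact h0.left.right.left

theorem Setting.meet_bottom_aux (S : Setting cs f) {h x y : W} {a b r q : B} (hab : a ≠ b)
    (har : a ≠ r) (hbr : b ≠ r) (haq : a ≠ q) (hbq : b ≠ q) (hm : M a b ≠ 0)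
    (Hx : ChainAt cs f a b r h x) (Hy : ChainAt cs f a b q h y ∨ ChainAt cs f b a q h y)
    (hxy : x ≠ y) : Meet cs f x y := by
  have hm' : M b a ≠ 0 := by rwa [M.symmetric]
  by_cases hx : x = h
  · subst hx
    rcases Hy with Hy | Hy
    · exact S.meet_same hab haq hbq hm Hy.bottom Hy hxy
    · exact S.meet_same hab.symm hbq haq hm' Hy.bottom Hy hxy
  by_cases hy : y = h
  · subst hy
    exact S.meet_same hab har hbr hm Hx Hx.bottom hxy
  by_cases hrq : r = q
  · subst hrq
    rcases Hy with Hy | Hy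
    · exact S.meet_same hab har hbr hm Hx Hy hxy
    · exact S.meet_opposite_eq hab har hbr hm Hx Hy hx hy
  · rcases Hy with Hy | Hy
    · exfalso
      obtain ⟨hA, h1⟩ := Hx.side hx
      obtain ⟨-, h2⟩ := Hy.side hy
      refine S.false_of_three (x := h * cs.simple a) har haq hrq ?_ ?_ ?_
      · rw [num_mul_simple_self]; linarith
      · rwa [num_mul_simple]
      · rw [num_mul_simple]; exact h2.le
    · exact S.meet_opposite_ne hab har hbr haq hbq hrq Hx Hy hx hy

theorem Setting.meet_bottom (S : Setting cs f) {h x y : W} {a b r q : B} (hab : a ≠ b)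
    (har : a ≠ r) (hbr : b ≠ r) (haq : a ≠ q) (hbq : b ≠ q) (hm : M a b ≠ 0)
    (Hx : ChainAt cs f a b r h x ∨ ChainAt cs f b a r h x)
    (Hy : ChainAt cs f a b q h y ∨ ChainAt cs f b a q h y)
    (hxy : x ≠ y) : Meet cs f x y := by
  rcases Hx with Hx | Hx
  · exact S.meet_bottom_aux hab har hbr haq hbq hm Hx Hy hxy
  · exact S.meet_bottom_aux hab.symm hbr har hbq haq (by rwa [M.symmetric]) Hx Hy.symm hxy

theorem ChainAt.of_zero {a b r : B} {h x : W} (hA : num cs f h a = 0)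
    (H : ChainAt cs f a b r h x ∨ ChainAt cs f b a r h x) : ChainAt cs f b a r h x := by
  rcases H with H | H
  · by_cases hx : x = h
    · subst hx; exact H.swap_bottom rfl
    · exact absurd hA (H.side hx).1.ne'
  · exact H

theorem Setting.meet_bottom_mirror (S : Setting cs f) {h x y : W} {a b r q : B} (hab : a ≠ b)
    (har : a ≠ r) (hbr : b ≠ r) (haq : a ≠ q) (hm : M a b ≠ 0) (hA : num cs f h a = 0)
    (Hx : ChainAt cs f a b r h x ∨ ChainAt cs f b a r h x)
    (Hy : ChainAt cs f a b q (h * cs.simple a) y ∨ ChainAt cs f b a q (h * cs.simple a) y) :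
    Meet cs f x y :=
  S.meet_mirror hab har hbr haq hm hA (ChainAt.of_zero hA Hx)
    (ChainAt.of_zero (by rw [num_mul_simple_self, hA, neg_zero]) Hy)

theorem Setting.chain_exists (S : Setting cs f) {a b r : B} (hab : a ≠ b) (har : a ≠ r)
    (hbr : b ≠ r) (hm : M a b ≠ 0) {x : W} (hr : num cs f x r < 0) :
    ∃ h, (ChainAt cs f a b r h x ∨ ChainAt cs f b a r h x) ∧ InCoset cs a b h x ∧
      0 ≤ num cs f h a ∧ 0 ≤ num cs f h b ∧ num cs f h r < 0 := by
  obtain ⟨h, H⟩ := S.chain hab har hbr hm _ x rfl hr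
  refine ⟨h, H, ?_⟩
  rcases H with H | H
  · exact ⟨H.inCoset, H.1, H.2.1, H.2.2.1⟩
  · exact ⟨H.inCoset.swap, H.2.1, H.1, H.2.2.1⟩

theorem Setting.meet_outside (S : Setting cs f) {x y : W} {a b r q : B} (hab : a ≠ b)
    (har : a ≠ r) (hbr : b ≠ r) (haq : a ≠ q) (hbq : b ≠ q) (hm : M a b ≠ 0)
    (hc : x⁻¹ * y ∈ dih cs a b) (hr : num cs f x r < 0) (hq : num cs f y q < 0)
    (hxy : x ≠ y) : Meet cs f x y := by
  obtain ⟨h, Hx, cx, hA, hB, hR⟩ := S.chain_exists hab har hbr hm hr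
  obtain ⟨k, Hy, cy, hA', hB', hQ⟩ := S.chain_exists hab haq hbq hm hq
  have hv : h⁻¹ * k ∈ dih cs a b := by
    have := MulMemClass.mul_mem (MulMemClass.mul_mem cx hc) (inv_mem cy)
    simpa [mul_assoc] using this
  obtain ⟨v, hvd, rfl⟩ : ∃ v ∈ dih cs a b, k = h * v := ⟨_, hv, by group⟩
  rcases S.bottom_unique hab har hbr hm hR hA hB hvd hA' hB' with rfl | ⟨h0, rfl⟩ | ⟨h0, rfl⟩
  · rw [mul_one] at Hy
    exact S.meet_bottom hab har hbr haq hbq hm Hx Hy hxy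
  · exact S.meet_bottom_mirror hab har hbr haq hm h0 Hx Hy
  · exact S.meet_bottom_mirror hab.symm hbr har hbq (by rwa [M.symmetric]) h0 Hx.symm Hy.symm

theorem Setting.not_outside (S : Setting cs f) {x y : W} {a b r : B} (hab : a ≠ b)
    (har : a ≠ r) (hbr : b ≠ r) (hm : M a b ≠ 0) (hc : x⁻¹ * y ∈ dih cs a b)
    (hx : ∀ u, 0 ≤ num cs f x u) : 0 ≤ num cs f y r := by
  by_contra hr
  obtain ⟨h, Hy, cy, hA, hB, hR⟩ := S.chain_exists hab har hbr hm (not_le.1 hr)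
  have hv : h⁻¹ * x ∈ dih cs a b := by
    have := MulMemClass.mul_mem cy (inv_mem hc)
    simpa [mul_assoc] using this
  obtain ⟨v, hvd, rfl⟩ : ∃ v ∈ dih cs a b, x = h * v := ⟨_, hv, by group⟩
  have hxr := hx r
  rcases S.bottom_unique hab har hbr hm hR hA hB hvd (hx a) (hx b) with
    rfl | ⟨h0, rfl⟩ | ⟨h0, rfl⟩
  · rw [mul_one] at hxr; linarith
  · rw [num_mul_simple, h0] at hxr; linarith
  · rw [num_mul_simple, h0] at hxr; linarith

theorem meet_inside {x y : W} {a b : B} (hab : a ≠ b) (hm : M a b ≠ 0)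
    (hc : x⁻¹ * y ∈ dih cs a b) (hx : ∀ u, u ≠ a → u ≠ b → 0 ≤ num cs f x u) :
    (∀ u, 0 ≤ num cs f x u) ∨ Meet cs f x y := by
  have hx' : ∀ {x'}, Step cs f x x' → InCoset cs a b x x' → Meet cs f x y := fun h1 h2 =>
    Meet.of_coset (i := 1) (j := 0) (by omega) (by omega) (by omega) (stepN_one h1) stepN_zero
      hab hm h2 hc
  have h0 := InCoset.refl (cs := cs) a b x
  rcases lt_or_ge (num cs f x a) 0 with ha | ha
  · right
    rcases lt_or_ge (num cs f x b) 0 with hb | hb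
    · exact hx' (step_two hab ha hb) h0.wab
    · refine hx' (step_one ha fun u hu => ?_) h0.left
      by_cases hub : u = b
      · rwa [hub]
      · exact hx u hu hub
  · rcases lt_or_ge (num cs f x b) 0 with hb | hb
    · right
      refine hx' (step_one hb fun u hu => ?_) h0.right
      by_cases hua : u = a
      · rwa [hua]
      · exact hx u hua hu
    · left
      intro u
      by_cases hua : u = a
      · rwa [hua]
      by_cases hub : u = b
      · rwa [hub]
      · exact hx u hua hub

theorem Setting.meet (S : Setting cs f) {x y : W} (hxy : Close cs x y) :
    ((∀ u, 0 ≤ num cs f x u) ∧ ∀ u, 0 ≤ num cs f y u) ∨ Meet cs f x y := by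
  by_cases hne : x = y
  · subst hne
    by_cases h : ∀ u, 0 ≤ num cs f x u
    · exact Or.inl ⟨h, h⟩
    · push Not at h
      obtain ⟨a, ha⟩ := h
      obtain ⟨z, hz⟩ := exists_step ha
      exact Or.inr ⟨1, 1, z, z, by omega, by omega, by omega, stepN_one hz, stepN_one hz,
        Or.inl rfl⟩
  · obtain ⟨a, b, hab, hm, hc⟩ := hxy.resolve_left hne
    have hc' : y⁻¹ * x ∈ dih cs a b := by simpa using inv_mem hc
    by_cases hx : ∀ u, u ≠ a → u ≠ b → 0 ≤ num cs f x u
    · rcases meet_inside hab hm hc hx with tx | h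
      · have hy : ∀ u, u ≠ a → u ≠ b → 0 ≤ num cs f y u := fun u hua hub =>
          S.not_outside hab hua.symm hub.symm hm hc tx
        rcases meet_inside hab hm hc' hy with ty | h
        · exact Or.inl ⟨tx, ty⟩
        · exact Or.inr h.symm
      · exact Or.inr h
    · by_cases hy : ∀ u, u ≠ a → u ≠ b → 0 ≤ num cs f y u
      · rcases meet_inside hab hm hc' hy with ty | h
        · exact absurd (fun u hua hub => S.not_outside hab hua.symm hub.symm hm hc' ty) hx
        · exact Or.inr h.symm
      · push Not at hx hy
        obtain ⟨r, har, hbr, hr⟩ := hx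
        obtain ⟨q, haq, hbq, hq⟩ := hy
        exact Or.inr (S.meet_outside hab har.symm hbr.symm haq.symm hbq.symm hm hc hr hq hne)

/-- The word metric. -/
noncomputable def wdist (cs : CoxeterSystem M W) (x y : W) : ℕ := cs.length (x⁻¹ * y)

theorem wdist_self (x : W) : wdist cs x x = 0 := by simp [wdist]

theorem wdist_comm (x y : W) : wdist cs x y = wdist cs y x := by
  rw [wdist, ← cs.length_inv, mul_inv_rev, inv_inv, wdist]

theorem wdist_triangle (x y z : W) : wdist cs x z ≤ wdist cs x y + wdist cs y z := by
  have := cs.length_mul_le (x⁻¹ * y) (y⁻¹ * z)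
  rwa [mul_assoc, mul_inv_cancel_left] at this

theorem wdist_mul_left (z x y : W) : wdist cs (z * x) (z * y) = wdist cs x y := by
  rw [wdist, mul_inv_rev, mul_assoc, inv_mul_cancel_left, wdist]

theorem length_le_add_wdist (x y : W) : cs.length y ≤ cs.length x + wdist cs x y := by
  simpa [wdist] using cs.length_mul_le x (x⁻¹ * y)

/-- An upper bound for all finite `m_st`. -/
def mBound (M : CoxeterMatrix B) : ℕ := 1 + ∑ p : B × B, M p.1 p.2

theorem le_mBound (a b : B) : M a b ≤ mBound M := by
  have := Finset.single_le_sum (f := fun p : B × B => M p.1 p.2) (fun _ _ => Nat.zero_le _)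
    (Finset.mem_univ (a, b))
  simp only at this
  rw [mBound]
  omega

theorem Close.wdist_le {x y : W} (h : Close cs x y) : wdist cs x y ≤ mBound M := by
  rcases h with rfl | ⟨a, b, hab, hm, hd⟩
  · rw [wdist_self]; exact Nat.zero_le _
  · exact (length_le_of_mem_dih cs hab hm hd).trans (le_mBound a b)

theorem Step.length_eq (S : Setting cs f) {x y : W} (h : Step cs f x y) :
    cs.length x = cs.length y + wdist cs x y ∧ 0 < wdist cs x y ∧ wdist cs x y ≤ mBound M := by
  rcases h with ⟨a, ha, -, rfl⟩ | ⟨a, b, hab, ha, hb, rfl⟩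
  · have hd := cs.isRightDescent_iff.1 (descent_of_num_neg cs S.dom ha)
    have : wdist cs x (x * cs.simple a) = 1 := by simp [wdist]
    rw [this, mBound]
    omega
  · obtain ⟨hm, h, -, -, hx, hl⟩ := exists_eq_mul_wab cs hab (descent_of_num_neg cs S.dom ha)
      (descent_of_num_neg cs S.dom hb)
    have e : x * wab cs a b = h := by rw [hx, mul_assoc, wab_mul_self cs hab hm, mul_one]
    have e2 : wdist cs x (x * wab cs a b) = M a b := by
      rw [wdist, inv_mul_cancel_left, length_wab cs hab]
    rw [e2, e, hl]
    exact ⟨rfl, Nat.pos_of_ne_zero hm, le_mBound a b⟩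

theorem Step.unique (S : Setting cs f) {x y z : W} (h1 : Step cs f x y) (h2 : Step cs f x z) :
    y = z := by
  rcases h1 with ⟨a, ha, ha', rfl⟩ | ⟨a, b, hab, ha, hb, rfl⟩ <;>
    rcases h2 with ⟨c, hc, hc', rfl⟩ | ⟨c, d, hcd, hc, hd, rfl⟩
  · by_cases h : c = a
    · rw [h]
    · linarith [ha' c h]
  · exfalso
    by_cases h : c = a
    · exact absurd (ha' d (fun e => hcd (h.trans e.symm))) (not_le.2 hd)
    · exact absurd (ha' c h) (not_le.2 hc)
  · exfalso
    by_cases h : a = c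
    · exact absurd (hc' b (fun e => hab (h.trans e.symm))) (not_le.2 hb)
    · exact absurd (hc' a h) (not_le.2 ha)
  · have key : ∀ u, num cs f x u < 0 → u = a ∨ u = b := by
      intro u hu
      by_contra hn
      push Not at hn
      exact S.false_of_three hab hn.1.symm hn.2.symm ha hb hu.le
    rcases key c hc with rfl | rfl <;> rcases key d hd with rfl | rfl
    · exact absurd rfl hcd
    · rfl
    · rw [wab_symm]
    · exact absurd rfl hcd

theorem StepN.facts (S : Setting cs f) {n : ℕ} {x y : W} (h : StepN cs f n x y) :
    cs.length x = cs.length y + wdist cs x y ∧ wdist cs x y ≤ n * mBound M ∧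
      n ≤ wdist cs x y := by
  induction n generalizing x with
  | zero => cases h; simp [wdist_self]
  | succ n ih =>
    obtain ⟨z, hz, h⟩ := h
    obtain ⟨h1, h2, h3⟩ := hz.length_eq S
    obtain ⟨h4, h5, h6⟩ := ih h
    have t := wdist_triangle (cs := cs) x z y
    have l := length_le_add_wdist (cs := cs) y x
    rw [wdist_comm] at l
    rw [Nat.add_mul, one_mul]
    omega

theorem StepN.split (S : Setting cs f) {i n : ℕ} {x y z : W} (h1 : StepN cs f i x y)
    (h2 : StepN cs f (i + n) x z) : StepN cs f n y z := by
  induction i generalizing x with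
  | zero => cases h1; rwa [Nat.zero_add] at h2
  | succ i ih =>
    obtain ⟨w, hw, h1⟩ := h1
    rw [Nat.add_right_comm] at h2
    obtain ⟨w', hw', h2⟩ := h2
    rw [hw'.unique S hw] at h2
    exact ih h1 h2

/-- The path of `x` determined by the functional `f` passes through `p`. -/
def OnPath (cs : CoxeterSystem M W) (f : B → ℝ) (x p : W) : Prop := ∃ n, StepN cs f n x p

theorem OnPath.refl (x : W) : OnPath cs f x x := ⟨0, rfl⟩

theorem OnPath.trans {x y z : W} (h1 : OnPath cs f x y) (h2 : OnPath cs f y z) :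
    OnPath cs f x z := by
  obtain ⟨m, h1⟩ := h1
  obtain ⟨n, h2⟩ := h2
  exact ⟨m + n, h1.trans h2⟩

theorem Step.onPath {x y : W} (h : Step cs f x y) : OnPath cs f x y := ⟨1, stepN_one h⟩

theorem OnPath.cases_step (S : Setting cs f) {x y p : W} (h : Step cs f x y)
    (hp : OnPath cs f x p) : p = x ∨ OnPath cs f y p := by
  obtain ⟨n, hn⟩ := hp
  cases n with
  | zero => cases hn; exact Or.inl rfl
  | succ n =>
    obtain ⟨z, hz, hn⟩ := hn
    rw [hz.unique S h] at hn
    exact Or.inr ⟨n, hn⟩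

theorem OnPath.eq_of_terminal {x p : W} (h : ∀ u, 0 ≤ num cs f x u)
    (hp : OnPath cs f x p) : p = x := by
  obtain ⟨n, hn⟩ := hp
  cases n with
  | zero => cases hn; rfl
  | succ n =>
    obtain ⟨z, ⟨a, ha, -, -⟩ | ⟨a, b, -, ha, -, -⟩, hn⟩ := hn
    · exact absurd (h a) (not_le.2 ha)
    · exact absurd (h a) (not_le.2 ha)

/-- Every point of the path of `x` is within `C` of a point of the path of `y`. -/
def Near (cs : CoxeterSystem M W) (f g : B → ℝ) (C : ℕ) (x y : W) : Prop :=
  ∀ p, OnPath cs f x p → ∃ q, OnPath cs g y q ∧ wdist cs p q ≤ C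

theorem Setting.near_of_close (S : Setting cs f) {x y : W} (h : Close cs x y) :
    Near cs f f (4 * mBound M) x y := by
  induction hn : cs.length x + cs.length y using Nat.strong_induction_on generalizing x y with
  | _ n ih =>
    intro p hp
    have hxy := h.wdist_le
    rcases S.meet h with ⟨tx, ty⟩ | ⟨i, j, x', y', hi, hj, hij, hx, hy, hc⟩
    · rw [hp.eq_of_terminal tx]
      exact ⟨y, OnPath.refl y, by omega⟩
    · obtain ⟨k, hk⟩ := hp
      obtain ⟨x1, x2, x3⟩ := hx.facts S
      obtain ⟨y1, y2, y3⟩ := hy.facts S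
      rcases le_or_gt k i with hki | hki
      · refine ⟨y, OnPath.refl y, ?_⟩
        obtain ⟨-, k2, -⟩ := hk.facts S
        have t := wdist_triangle (cs := cs) p x y
        rw [wdist_comm p x] at t
        have : k * mBound M ≤ 3 * mBound M := Nat.mul_le_mul_right _ (by omega)
        omega
      · obtain ⟨m, rfl⟩ : ∃ m, k = i + m := ⟨k - i, by omega⟩
        obtain ⟨q, hq, hpq⟩ := ih _ (by omega) hc rfl p ⟨m, hx.split S hk⟩
        exact ⟨q, OnPath.trans ⟨j, hy⟩ hq, hpq⟩

theorem one_le_mBound : 1 ≤ mBound M := by rw [mBound]; omega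

theorem Setting.near_mul_simple_of_neg (S : Setting cs f) {g : W} {s : B}
    (h : num cs f g s < 0) : Near cs f f (4 * mBound M) g (g * cs.simple s) ∧
      Near cs f f (4 * mBound M) (g * cs.simple s) g := by
  have hK := one_le_mBound (M := M)
  by_cases hs : ∀ u, u ≠ s → 0 ≤ num cs f g u
  · have st := step_one h hs
    constructor
    · intro p hp
      rcases hp.cases_step S st with rfl | hp
      · refine ⟨_, OnPath.refl _, ?_⟩
        simp only [wdist, inv_mul_cancel_left, length_simple]
        omega
      · exact ⟨p, hp, by rw [wdist_self]; exact Nat.zero_le _⟩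
    · intro p hp
      exact ⟨p, st.onPath.trans hp, by rw [wdist_self]; exact Nat.zero_le _⟩
  · push Not at hs
    obtain ⟨t, hts, ht⟩ := hs
    have hc : Close cs g (g * cs.simple s) :=
      Or.inr ⟨s, t, hts.symm, S.finite_of_neg (x := g) (by linarith), by
        rw [inv_mul_cancel_left]; exact simple_mem_dih_left cs s t⟩
    exact ⟨S.near_of_close hc, S.near_of_close hc.symm⟩

/-- The functional taking the value one at all simple roots. -/
def oneFun : B → ℝ := fun _ => 1

/-- The functional taking the value zero at `α_s` and one at all other simple roots. -/
noncomputable def wallFun (s : B) : B → ℝ := fun t => if t = s then 0 else 1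

theorem Setting.one (hT : TriangleCond M) : Setting cs oneFun := ⟨hT, fun _ => zero_le_one⟩

theorem Setting.wall (hT : TriangleCond M) (s : B) : Setting cs (wallFun s) :=
  ⟨hT, fun t => by unfold wallFun; split_ifs <;> norm_num⟩

theorem num_one_neg_iff {x : W} {u : B} : num cs oneFun x u < 0 ↔ cs.IsRightDescent x u :=
  num_neg_iff cs fun _ => zero_lt_one

theorem near_mul_simple (hT : TriangleCond M) (g : W) (s : B) :
    Near cs oneFun oneFun (4 * mBound M) g (g * cs.simple s) := by
  have S : Setting cs oneFun := Setting.one hT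
  by_cases h : cs.IsRightDescent g s
  · exact (S.near_mul_simple_of_neg (num_one_neg_iff.2 h)).1
  · rw [cs.not_isRightDescent_iff] at h
    have h' : cs.IsRightDescent (g * cs.simple s) s := by
      rw [cs.isRightDescent_iff, simple_mul_simple_cancel_right]
      omega
    have := (S.near_mul_simple_of_neg (num_one_neg_iff.2 h')).2
    rwa [simple_mul_simple_cancel_right] at this

theorem root_simple_mul (s : B) (x : W) (u t : B) (h : t ≠ s) :
    root cs (cs.simple s * x) u t = root cs x u t := by
  rw [root, map_mul, Module.End.mul_apply, geomRep_simple, simpleRefl_apply, ← root]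
  simp [h]

theorem num_wall_simple_mul (s : B) (x : W) (u : B) :
    num cs (wallFun s) (cs.simple s * x) u = num cs (wallFun s) x u := by
  refine Finset.sum_congr rfl fun t _ => ?_
  by_cases h : t = s
  · simp [wallFun, h]
  · rw [root_simple_mul s x u t h]

theorem Step.simple_mul {s : B} {x y : W} (h : Step cs (wallFun s) x y) :
    Step cs (wallFun s) (cs.simple s * x) (cs.simple s * y) := by
  rcases h with ⟨a, ha, ha', rfl⟩ | ⟨a, b, hab, ha, hb, rfl⟩
  · refine Or.inl ⟨a, ?_, fun u hu => ?_, (mul_assoc _ _ _).symm⟩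
    · rwa [num_wall_simple_mul]
    · rw [num_wall_simple_mul]; exact ha' u hu
  · refine Or.inr ⟨a, b, hab, ?_, ?_, (mul_assoc _ _ _).symm⟩ <;> rwa [num_wall_simple_mul]

theorem OnPath.simple_mul {s : B} {x p : W} (h : OnPath cs (wallFun s) x p) :
    OnPath cs (wallFun s) (cs.simple s * x) (cs.simple s * p) := by
  obtain ⟨n, h⟩ := h
  refine ⟨n, ?_⟩
  induction n generalizing x with
  | zero => cases h; rfl
  | succ n ih =>
    obtain ⟨z, hz, h⟩ := h
    exact ⟨_, hz.simple_mul, ih h⟩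

theorem descent_of_num_wall_neg {s : B} {x : W} {u : B} (h : num cs (wallFun s) x u < 0) :
    cs.IsRightDescent x u := by
  refine descent_of_num_neg cs (fun t => ?_) h
  unfold wallFun
  split_ifs <;> norm_num

theorem num_wall_neg_or {s : B} {x : W} {u : B} (h : cs.IsRightDescent x u) :
    num cs (wallFun s) x u < 0 ∨ x * cs.simple u = cs.simple s * x := by
  by_contra hc
  push Not at hc
  obtain ⟨h1, h2⟩ := hc
  have le : ∀ t ∈ Finset.univ, wallFun s t * root cs x u t ≤ 0 := fun t _ =>
    mul_nonpos_of_nonneg_of_nonpos (by unfold wallFun; split_ifs <;> norm_num)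
      (root_nonpos cs h t)
  have h0 : num cs (wallFun s) x u = 0 := le_antisymm (Finset.sum_nonpos le) h1
  have hz := (Finset.sum_eq_zero_iff_of_nonpos le).1 h0
  refine h2 (mul_simple_eq_of_root_eq cs (root_eq_neg_single cs h fun t ht => ?_))
  simpa [wallFun, ht] using hz t (Finset.mem_univ t)

/-- If the descents of `x` are seen by `wallFun s`, then both functionals determine the same
step. -/
theorem step_wall_of_step {s : B} {x y : W}
    (H : ∀ u, cs.IsRightDescent x u → num cs (wallFun s) x u < 0)
    (h : Step cs oneFun x y) : Step cs (wallFun s) x y := by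
  rcases h with ⟨a, ha, ha', rfl⟩ | ⟨a, b, hab, ha, hb, rfl⟩
  · refine Or.inl ⟨a, H a (num_one_neg_iff.1 ha), fun u hu => ?_, rfl⟩
    by_contra hn
    exact absurd (num_one_neg_iff.2 (descent_of_num_wall_neg (not_le.1 hn)))
      (not_lt.2 (ha' u hu))
  · exact Or.inr ⟨a, b, hab, H a (num_one_neg_iff.1 ha), H b (num_one_neg_iff.1 hb), rfl⟩

theorem terminal_one {x : W} (h : ¬ ∃ y, Step cs oneFun x y) :
    ∀ u, ¬ cs.IsRightDescent x u := fun _ hu =>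
  h (exists_step (num_one_neg_iff.2 hu))

/-- Away from the wall of `s`, the paths determined by both functionals agree. -/
theorem onPath_iff_of_not_descent (hT : TriangleCond M) {s : B} {x : W}
    (hx : cs.length x < cs.length (cs.simple s * x)) (p : W) :
    OnPath cs (wallFun s) x p ↔ OnPath cs oneFun x p := by
  have S1 : Setting cs oneFun := Setting.one hT
  have S0 : Setting cs (wallFun s) := Setting.wall hT s
  induction hn : cs.length x using Nat.strong_induction_on generalizing x with
  | _ n ih =>
    have H : ∀ u, cs.IsRightDescent x u → num cs (wallFun s) x u < 0 := fun u hu =>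
      (num_wall_neg_or hu).resolve_right fun e => by
        rw [← e] at hx
        exact lt_asymm hx hu
    by_cases hs : ∃ y, Step cs oneFun x y
    · obtain ⟨y, hy⟩ := hs
      have hy0 := step_wall_of_step H hy
      obtain ⟨l1, l2, -⟩ := hy.length_eq S1
      have l3 := length_le_add_wdist (cs := cs) (cs.simple s * y) (cs.simple s * x)
      rw [wdist_mul_left, wdist_comm] at l3
      have key := ih (cs.length y) (by omega) (x := y) (by omega) rfl
      constructor
      · intro hp
        rcases hp.cases_step S0 hy0 with rfl | hp
        · exact OnPath.refl p
        · exact hy.onPath.trans (key.1 hp)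
      · intro hp
        rcases hp.cases_step S1 hy with rfl | hp
        · exact OnPath.refl p
        · exact hy0.onPath.trans (key.2 hp)
    · have ht := terminal_one hs
      have t1 : ∀ u, 0 ≤ num cs oneFun x u := fun u => not_lt.1 fun h =>
        ht u (num_one_neg_iff.1 h)
      have t0 : ∀ u, 0 ≤ num cs (wallFun s) x u := fun u => not_lt.1 fun h =>
        ht u (descent_of_num_wall_neg h)
      constructor
      · intro hp; rw [hp.eq_of_terminal t0]; exact OnPath.refl x
      · intro hp; rw [hp.eq_of_terminal t1]; exact OnPath.refl x

theorem Near.of_step {f g : B → ℝ} {C : ℕ} {x y : W} (S : Setting cs f) (h1 : Step cs f x y)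
    (h2 : Step cs g x y) (h : Near cs f g C y y) : Near cs f g C x x := by
  intro p hp
  rcases hp.cases_step S h1 with rfl | hp
  · exact ⟨p, OnPath.refl p, by rw [wdist_self]; exact Nat.zero_le _⟩
  · obtain ⟨q, hq, hpq⟩ := h p hp
    exact ⟨q, h2.onPath.trans hq, hpq⟩

theorem Near.of_terminal {f g : B → ℝ} {C : ℕ} {x : W} (h : ∀ u, 0 ≤ num cs f x u) :
    Near cs f g C x x := by
  intro p hp
  rw [hp.eq_of_terminal h]
  exact ⟨x, OnPath.refl x, by rw [wdist_self]; exact Nat.zero_le _⟩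

theorem length_lt_simple_mul_of_eq {s t u : B} {x h : W} (htu : t ≠ u) (hm : M t u ≠ 0)
    (hu : x * cs.simple u = cs.simple s * x) (ht : ¬ cs.IsRightDescent h t)
    (hu' : ¬ cs.IsRightDescent h u) (hx : x = h * wab cs t u) :
    cs.length h < cs.length (cs.simple s * h) := by
  have hw := wab_mul_self cs htu hm
  have hh : h = x * wab cs t u := by rw [hx, mul_assoc, hw, mul_one]
  have e : cs.simple s * h = h * (wab cs t u * cs.simple u * wab cs t u) := by
    conv_lhs => rw [hh, ← mul_assoc, ← hu, hx]
    simp only [mul_assoc]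
  have hd := MulMemClass.mul_mem (MulMemClass.mul_mem (wab_mem_dih cs t u)
    (simple_mem_dih_right cs t u)) (wab_mem_dih cs t u)
  rw [e, length_mul_dih cs ht hu' hd]
  have : cs.length (wab cs t u * cs.simple u * wab cs t u) ≠ 0 := by
    rw [Ne, cs.length_eq_zero_iff]
    intro h1
    have h2 : cs.simple u = 1 := by
      have h3 : wab cs t u * (wab cs t u * cs.simple u * wab cs t u) * wab cs t u
          = cs.simple u := by
        rw [← mul_assoc, ← mul_assoc, hw, one_mul, mul_assoc, hw, mul_one]
      rw [← h3, h1, mul_one, hw]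
    have h4 := cs.length_simple u
    rw [h2, length_one] at h4
    exact absurd h4 (by omega)
  omega

theorem near_wall (hT : TriangleCond M) (s : B) (x : W) :
    Near cs oneFun (wallFun s) (4 * mBound M) x x ∧
      Near cs (wallFun s) oneFun (4 * mBound M) x x := by
  have S1 : Setting cs oneFun := Setting.one hT
  have S0 : Setting cs (wallFun s) := Setting.wall hT s
  have hK := one_le_mBound (M := M)
  induction hn : cs.length x using Nat.strong_induction_on generalizing x with
  | _ n ih =>
    by_cases H : ∀ u, cs.IsRightDescent x u → num cs (wallFun s) x u < 0
    · by_cases hs : ∃ y, Step cs oneFun x y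
      · obtain ⟨y, hy⟩ := hs
        have hy0 := step_wall_of_step H hy
        obtain ⟨l1, l2, -⟩ := hy.length_eq S1
        obtain ⟨n1, n2⟩ := ih (cs.length y) (by omega) y rfl
        exact ⟨Near.of_step S1 hy hy0 n1, Near.of_step S0 hy0 hy n2⟩
      · have ht := terminal_one hs
        exact ⟨Near.of_terminal fun u => not_lt.1 fun h => ht u (num_one_neg_iff.1 h),
          Near.of_terminal fun u => not_lt.1 fun h => ht u (descent_of_num_wall_neg h)⟩
    · push Not at H
      obtain ⟨u, hu, hn0⟩ := H
      have hsu := (num_wall_neg_or hu).resolve_left (not_lt.2 hn0)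
      by_cases hs : ∃ t, t ≠ u ∧ cs.IsRightDescent x t
      · obtain ⟨t, htu, ht⟩ := hs
        obtain ⟨hm, h, ht', hu', hx, -⟩ := exists_eq_mul_wab cs htu ht hu
        have hfar := length_lt_simple_mul_of_eq htu hm hsu ht' hu' hx
        have hh : h = x * wab cs t u := by
          rw [hx, mul_assoc, wab_mul_self cs htu hm, mul_one]
        have st : Step cs oneFun x h := hh ▸ step_two htu (num_one_neg_iff.2 ht)
          (num_one_neg_iff.2 hu)
        have hc : Close cs x h := Or.inr ⟨t, u, htu, hm, by
          rw [hh, inv_mul_cancel_left]; exact wab_mem_dih cs t u⟩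
        have key := onPath_iff_of_not_descent hT hfar
        constructor
        · intro p hp
          rcases hp.cases_step S1 st with rfl | hp
          · exact ⟨p, OnPath.refl p, by rw [wdist_self]; exact Nat.zero_le _⟩
          · exact S0.near_of_close hc.symm p ((key p).2 hp)
        · intro p hp
          obtain ⟨q, hq, hpq⟩ := S0.near_of_close hc p hp
          exact ⟨q, st.onPath.trans ((key q).1 hq), hpq⟩
      · push Not at hs
        have t0 : ∀ v, 0 ≤ num cs (wallFun s) x v := fun v => not_lt.1 fun h => by
          by_cases hv : v = u
          · rw [hv] at h; exact absurd hn0 (not_le.2 h)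
          · exact hs v hv (descent_of_num_wall_neg h)
        have st : Step cs oneFun x (x * cs.simple u) := step_one (num_one_neg_iff.2 hu)
          fun v hv => not_lt.1 fun h => hs v hv (num_one_neg_iff.1 h)
        have t1 : ∀ v, 0 ≤ num cs oneFun (x * cs.simple u) v := fun v => not_lt.1 fun h => by
          have hv := num_one_neg_iff.1 h
          rw [hsu] at hv
          rcases num_wall_neg_or hv with h0 | h0
          · rw [num_wall_simple_mul] at h0
            exact absurd (t0 v) (not_le.2 h0)
          · rw [simple_mul_simple_cancel_left] at h0
            rw [cs.isRightDescent_iff, h0] at hv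
            rw [cs.isRightDescent_iff, hsu] at hu
            omega
        refine ⟨fun p hp => ⟨x, OnPath.refl x, ?_⟩, Near.of_terminal t0⟩
        rcases hp.cases_step S1 st with rfl | hp
        · rw [wdist_self]; exact Nat.zero_le _
        · rw [hp.eq_of_terminal t1, wdist_comm, wdist, inv_mul_cancel_left, length_simple]
          omega

theorem near_simple_mul (hT : TriangleCond M) (s : B) (g p : W) (hp : OnPath cs oneFun g p) :
    ∃ q, OnPath cs oneFun (cs.simple s * g) q ∧
      wdist cs p (cs.simple s * q) ≤ 8 * mBound M := by
  obtain ⟨p', hp', d1⟩ := (near_wall hT s g).1 p hp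
  obtain ⟨q, hq, d2⟩ := (near_wall hT s (cs.simple s * g)).2 _ hp'.simple_mul
  refine ⟨q, hq, ?_⟩
  have t := wdist_triangle (cs := cs) p p' (cs.simple s * q)
  have e := wdist_mul_left (cs := cs) (cs.simple s) p' (cs.simple s * q)
  rw [simple_mul_simple_cancel_left] at e
  omega

theorem wg_spec {g w : W} (hw : w ∈ descSubgroup cs g)
    (hmax : ∀ u ∈ descSubgroup cs g, cs.length u ≤ cs.length w) :
    wg cs g ∈ descSubgroup cs g ∧ cs.length w ≤ cs.length (wg cs g) := by
  have h : ∃ w₀ ∈ descSubgroup cs g, ∀ u ∈ descSubgroup cs g, cs.length u ≤ cs.length w₀ :=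
    ⟨w, hw, hmax⟩
  rw [wg, dif_pos h]
  exact ⟨h.choose_spec.1, h.choose_spec.2 w hw⟩

theorem wg_of_empty {g : W} (h : descentSet cs g = ∅) : wg cs g = 1 := by
  have hb : descSubgroup cs g = ⊥ := by
    rw [descSubgroup, h, Set.image_empty, Subgroup.closure_empty]
  have := (wg_spec (cs := cs) (g := g) (w := 1) (one_mem _) (fun u hu => by
    rw [hb, Subgroup.mem_bot] at hu; rw [hu])).1
  rwa [hb, Subgroup.mem_bot] at this

theorem wg_of_singleton {g : W} {a : B} (h : descentSet cs g = {a}) :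
    wg cs g = cs.simple a := by
  have hb : ∀ u ∈ descSubgroup cs g, u = 1 ∨ u = cs.simple a := by
    intro u hu
    rw [descSubgroup, h, Set.image_singleton] at hu
    induction hu using Subgroup.closure_induction with
    | mem x hx => exact Or.inr hx
    | one => exact Or.inl rfl
    | mul x y _ _ hx hy =>
      rcases hx with rfl | rfl <;> rcases hy with rfl | rfl <;> simp
    | inv x _ hx => rcases hx with rfl | rfl <;> simp
  have hm : cs.simple a ∈ descSubgroup cs g := by
    rw [descSubgroup, h]
    exact Subgroup.subset_closure ⟨a, rfl, rfl⟩
  obtain ⟨h1, h2⟩ := wg_spec hm fun u hu => by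
    rcases hb u hu with rfl | rfl
    · rw [length_one]; exact Nat.zero_le _
    · exact le_rfl
  rcases hb _ h1 with h3 | h3
  · rw [h3, length_one, length_simple] at h2
    omega
  · exact h3

theorem wg_of_pair {g : W} {a b : B} (hab : a ≠ b) (hm : M a b ≠ 0)
    (h : descentSet cs g = {a, b}) : wg cs g = wab cs a b := by
  have hb : descSubgroup cs g = dih cs a b := by rw [descSubgroup, h, dih]
  obtain ⟨h1, h2⟩ := wg_spec (cs := cs) (g := g) (w := wab cs a b)
    (by rw [hb]; exact wab_mem_dih cs a b) fun u hu => by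
      rw [length_wab cs hab]
      exact length_le_of_mem_dih cs hab hm (by rwa [hb] at hu)
  rw [hb] at h1
  rw [length_wab cs hab] at h2
  refine eq_wab_of_descents cs hab h1 ?_ ?_
  · by_contra hd
    exact absurd (length_lt_of_not_descent cs hab hm h1 hd) (not_lt.2 h2)
  · by_contra hd
    rw [dih_symm] at h1
    rw [M.symmetric] at h2 hm
    exact absurd (length_lt_of_not_descent cs hab.symm hm h1 hd) (not_lt.2 h2)

theorem eq_mul_wg_of_step (hT : TriangleCond M) {g y : W} (h : Step cs oneFun g y) :
    y = g * wg cs g := by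
  have S : Setting cs oneFun := Setting.one hT
  rcases h with ⟨a, ha, ha', rfl⟩ | ⟨a, b, hab, ha, hb, rfl⟩
  · rw [wg_of_singleton (a := a)]
    ext u
    simp only [descentSet, Set.mem_ofPred_eq, Set.mem_singleton_iff]
    refine ⟨fun hu => ?_, fun hu => hu ▸ num_one_neg_iff.1 ha⟩
    by_contra hn
    exact absurd (num_one_neg_iff.2 hu) (not_lt.2 (ha' u hn))
  · rw [wg_of_pair hab (S.finite_of_neg (x := g) (by linarith))]
    ext u
    simp only [descentSet, Set.mem_ofPred_eq, Set.mem_insert_iff, Set.mem_singleton_iff]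
    constructor
    · intro hu
      by_contra hn
      push Not at hn
      exact S.false_of_three hab hn.1.symm hn.2.symm ha hb (num_one_neg_iff.2 hu).le
    · rintro (rfl | rfl)
      · exact num_one_neg_iff.1 ha
      · exact num_one_neg_iff.1 hb

theorem step_wg (hT : TriangleCond M) {g : W} (hg : g ≠ 1) :
    Step cs oneFun g (g * wg cs g) := by
  obtain ⟨a, ha⟩ : ∃ a, cs.IsRightDescent g a := by
    by_contra h
    push Not at h
    exact hg (eq_one_of_no_descent cs h)
  obtain ⟨y, hy⟩ := exists_step (num_one_neg_iff.2 ha)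
  rwa [← eq_mul_wg_of_step hT hy]

theorem wg_one : wg cs (1 : W) = 1 := by
  apply wg_of_empty
  ext u
  simp [descentSet, isRightDescent_iff]

theorem wg_mul_self (hT : TriangleCond M) (g : W) : wg cs g * wg cs g = 1 := by
  by_cases hg : g = 1
  · rw [hg, wg_one, mul_one]
  have S : Setting cs oneFun := Setting.one hT
  rcases step_wg hT hg with ⟨a, -, -, h⟩ | ⟨a, b, hab, ha, hb, h⟩
  · rw [mul_left_cancel h]; simp
  · rw [mul_left_cancel h]
    exact wab_mul_self cs hab (S.finite_of_neg (x := g) (by linarith))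

theorem length_wg (hT : TriangleCond M) {g : W} (hg : g ≠ 1) :
    cs.length g = cs.length (g * wg cs g) + cs.length (wg cs g) ∧ 0 < cs.length (wg cs g) ∧
      cs.length (wg cs g) ≤ mBound M := by
  have := (step_wg (cs := cs) hT hg).length_eq (Setting.one hT)
  rwa [wdist, inv_mul_cancel_left] at this

theorem StdLang.length_eq (hT : TriangleCond M) {v : List B} (h : StdLang cs v) :
    cs.length (cs.wordProd v) = v.length ∧ (v = [] ∨ ∃ x b, v = x ++ b ∧ StdLang cs x ∧
      b ≠ [] ∧ cs.wordProd b = wg cs (cs.wordProd v) ∧ b.length = cs.length (cs.wordProd b) ∧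
      cs.wordProd x = cs.wordProd v * wg cs (cs.wordProd v)) := by
  induction h with
  | nil => simp
  | step v hne hpre hsuf ih =>
    obtain ⟨l1, l2, l3⟩ := length_wg hT hne
    set k := cs.length (wg cs (cs.wordProd v)) with hk
    have hx : cs.wordProd (v.take (v.length - k)) = cs.wordProd v * wg cs (cs.wordProd v) := by
      have h1 : cs.wordProd v = cs.wordProd (v.take (v.length - k))
          * cs.wordProd (v.drop (v.length - k)) := by
        rw [← wordProd_append, List.take_append_drop]
      rw [hsuf] at h1
      rw [← mul_one (cs.wordProd (v.take (v.length - k))), ← wg_mul_self (cs := cs) hT, ← mul_assoc,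
        ← h1]
    have ih1 := ih.1
    rw [hx, List.length_take] at ih1
    have hle := cs.length_wordProd_le v
    have hl : cs.length (cs.wordProd v) = v.length := by omega
    refine ⟨hl, Or.inr ⟨_, _, (List.take_append_drop _ v).symm, hpre, ?_, hsuf, ?_, hx⟩⟩
    · intro h0
      have := congrArg List.length h0
      rw [List.length_drop, List.length_nil] at this
      omega
    · rw [hsuf, List.length_drop, ← hk]
      omega

theorem StdLang.append {x b : List B} (h : StdLang cs x)
    (hb : cs.wordProd b ≠ 1) (h1 : cs.wordProd b = wg cs (cs.wordProd (x ++ b)))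
    (h2 : b.length = cs.length (cs.wordProd b)) : StdLang cs (x ++ b) := by
  have e : (x ++ b).length - cs.length (wg cs (cs.wordProd (x ++ b))) = x.length := by
    rw [← h1, ← h2, List.length_append]; omega
  refine StdLang.step _ ?_ ?_ ?_
  · intro h0
    rw [h0, wg_one] at h1
    exact hb h1
  · rw [e, List.take_left]
    exact h
  · rw [e, List.drop_left]
    exact h1

theorem exists_stdLang (hT : TriangleCond M) (g : W) :
    ∃ v, StdLang cs v ∧ cs.wordProd v = g := by
  induction hn : cs.length g using Nat.strong_induction_on generalizing g with
  | _ n ih =>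
    by_cases hg : g = 1
    · exact ⟨[], StdLang.nil, by rw [wordProd_nil, hg]⟩
    · obtain ⟨l1, l2, -⟩ := length_wg (cs := cs) hT hg
      obtain ⟨x, hx, hxg⟩ := ih _ (by omega) (g * wg cs g) rfl
      obtain ⟨b, hb, hbg⟩ := cs.exists_isReduced (wg cs g)
      have e : cs.wordProd (x ++ b) = g := by
        rw [wordProd_append, hxg, ← hbg, mul_assoc, wg_mul_self hT, mul_one]
      refine ⟨x ++ b, hx.append ?_ ?_ ?_, e⟩
      · rw [← hbg]
        intro h
        rw [h, length_one] at l2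
        omega
      · rw [e, hbg]
      · exact hb.symm

theorem StdLang.take_of_onPath (hT : TriangleCond M) {v : List B} (h : StdLang cs v) {p : W}
    (hp : OnPath cs oneFun (cs.wordProd v) p) :
    cs.wordProd (v.take (cs.length p)) = p ∧ cs.length p ≤ v.length := by
  have S : Setting cs oneFun := Setting.one hT
  induction hn : v.length using Nat.strong_induction_on generalizing v with
  | _ n ih =>
    subst hn
    obtain ⟨hl, rfl | ⟨x, b, hv, hx, hb, hbw, hbl, hxw⟩⟩ := h.length_eq hT
    · have : p = 1 := hp.eq_of_terminal fun u => not_lt.1 fun hu => by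
        have := num_one_neg_iff.1 hu
        simp [isRightDescent_iff] at this
      subst this
      simp
    · have hne : cs.wordProd v ≠ 1 := by
        intro h1
        rw [h1, length_one] at hl
        have := congrArg List.length hv
        rw [List.length_append] at this
        exact hb (List.length_eq_zero_iff.1 (by omega))
      rcases hp.cases_step S (step_wg hT hne) with rfl | hp
      · rw [hl]
        exact ⟨by rw [List.take_length], le_rfl⟩
      · rw [← hxw] at hp
        have hbp := List.length_pos_of_ne_nil hb
        have hlen : v.length = x.length + b.length := by rw [hv, List.length_append]
        obtain ⟨h1, h2⟩ := ih x.length (by omega) hx hp rfl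
        refine ⟨?_, by omega⟩
        rw [hv, List.take_append_of_le_length h2, h1]

theorem StdLang.exists_near_onPath (hT : TriangleCond M) {v : List B} (h : StdLang cs v) {n : ℕ}
    (hn : n ≤ v.length) : ∃ p, OnPath cs oneFun (cs.wordProd v) p ∧ n ≤ cs.length p ∧
      cs.length p ≤ n + mBound M ∧ wdist cs (cs.wordProd (v.take n)) p ≤ mBound M := by
  induction hl : v.length using Nat.strong_induction_on generalizing v with
  | _ l ih =>
    subst hl
    obtain ⟨hl, rfl | ⟨x, b, hv, hx, hb, hbw, hbl, hxw⟩⟩ := h.length_eq hT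
    · refine ⟨_, OnPath.refl _, ?_⟩
      have : n = 0 := by simpa using hn
      subst this
      simp [wdist]
    · have hbp := List.length_pos_of_ne_nil hb
      have hlen : v.length = x.length + b.length := by rw [hv, List.length_append]
      have hne : cs.wordProd v ≠ 1 := by
        intro h1
        rw [h1, length_one] at hl
        omega
      obtain ⟨-, -, l3⟩ := length_wg hT hne
      rw [← hbw, ← hbl] at l3
      rcases le_or_gt n x.length with hnx | hnx
      · obtain ⟨p, hp, h1, h2, h3⟩ := ih _ (by omega) hx hnx rfl
        refine ⟨p, (step_wg hT hne).onPath.trans (by rwa [← hxw]), h1, h2, ?_⟩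
        rwa [hv, List.take_append_of_le_length hnx]
      · refine ⟨_, OnPath.refl _, by omega, by omega, ?_⟩
        have e : cs.wordProd v = cs.wordProd (v.take n) * cs.wordProd (v.drop n) := by
          rw [← wordProd_append, List.take_append_drop]
        have hd := cs.length_wordProd_le (v.drop n)
        rw [List.length_drop] at hd
        rw [wdist, inv_mul_eq_of_eq_mul e]
        omega

theorem wdist_take_le (v : List B) {i j : ℕ} (hij : i ≤ j) :
    wdist cs (cs.wordProd (v.take i)) (cs.wordProd (v.take j)) ≤ j - i := by
  have e : v.take j = v.take i ++ (v.take j).drop i := by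
    conv_lhs => rw [← List.take_append_drop i (v.take j), List.take_take, min_eq_left hij]
  rw [e, wordProd_append, wdist, inv_mul_cancel_left]
  refine (cs.length_wordProd_le _).trans ?_
  rw [List.length_drop, List.length_take]
  omega

theorem fellow_travel (hT : TriangleCond M) {v v' : List B} (h : StdLang cs v)
    (h' : StdLang cs v') {z : W} (hz : cs.length z ≤ 1) {C : ℕ}
    (hN : ∀ p, OnPath cs oneFun (cs.wordProd v) p →
      ∃ q, OnPath cs oneFun (cs.wordProd v') q ∧ wdist cs p (z * q) ≤ C)
    (hl : cs.length (cs.wordProd v) ≤ cs.length (cs.wordProd v') + 1)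
    (hl' : cs.length (cs.wordProd v') ≤ cs.length (cs.wordProd v) + 1) (n : ℕ) :
    wdist cs (cs.wordProd (v.take n)) (z * cs.wordProd (v'.take n))
      ≤ 2 * mBound M + 2 * C + 2 := by
  rw [(h.length_eq hT).1, (h'.length_eq hT).1] at hl hl'
  have e1 : v.take n = v.take (min n v.length) := by
    rcases le_total n v.length with hn | hn
    · rw [min_eq_left hn]
    · rw [min_eq_right hn, List.take_length, List.take_of_length_le hn]
  have e2 : v'.take n = v'.take (min n v'.length) := by
    rcases le_total n v'.length with hn | hn
    · rw [min_eq_left hn]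
    · rw [min_eq_right hn, List.take_length, List.take_of_length_le hn]
  obtain ⟨p, hp, p1, p2, p3⟩ := h.exists_near_onPath hT (min_le_right n v.length)
  obtain ⟨q, hq, q1⟩ := hN p hp
  obtain ⟨q2, q3⟩ := h'.take_of_onPath hT hq
  rw [e1, e2]
  have t1 := wdist_triangle (cs := cs) (cs.wordProd (v.take (min n v.length))) p
    (z * cs.wordProd (v'.take (min n v'.length)))
  have t2 := wdist_triangle (cs := cs) p (z * q) (z * cs.wordProd (v'.take (min n v'.length)))
  rw [wdist_mul_left] at t2
  have l1 := length_le_add_wdist (cs := cs) p (z * q)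
  have l2 := length_le_add_wdist (cs := cs) (z * q) p
  rw [wdist_comm] at l2
  have l3 := cs.length_mul_le z q
  have l4 := cs.length_mul_le z⁻¹ (z * q)
  rw [inv_mul_cancel_left, cs.length_inv] at l4
  have t3 : wdist cs q (cs.wordProd (v'.take (min n v'.length))) ≤ mBound M + C + 2 := by
    rw [← q2]
    rcases le_total (cs.length q) (min n v'.length) with hc | hc
    · have := wdist_take_le (cs := cs) v' hc
      omega
    · have := wdist_take_le (cs := cs) v' hc
      rw [wdist_comm] at this
      omega
  omega

theorem fellow_travel_right (hT : TriangleCond M) {v v' : List B} (h : StdLang cs v)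
    (h' : StdLang cs v') {s : B} (hv : cs.wordProd v' = cs.wordProd v * cs.simple s) (n : ℕ) :
    wdist cs (cs.wordProd (v.take n)) (cs.wordProd (v'.take n)) ≤ 18 * mBound M + 2 := by
  have hl := cs.length_mul_simple (cs.wordProd v) s
  rw [← hv] at hl
  have := fellow_travel (cs := cs) hT h h' (z := 1) (by rw [length_one]; omega)
    (C := 8 * mBound M) (fun p hp => by
      obtain ⟨q, hq, hpq⟩ := near_mul_simple hT (cs.wordProd v) s p hp
      exact ⟨q, by rwa [hv], by rw [one_mul]; omega⟩) (by omega) (by omega) n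
  rw [one_mul] at this
  omega

theorem fellow_travel_left (hT : TriangleCond M) {v v' : List B} (h : StdLang cs v)
    (h' : StdLang cs v') {s : B} (hv : cs.wordProd v' = cs.simple s * cs.wordProd v) (n : ℕ) :
    wdist cs (cs.wordProd (v.take n)) (cs.simple s * cs.wordProd (v'.take n))
      ≤ 18 * mBound M + 2 := by
  have hl := cs.length_simple_mul (cs.wordProd v) s
  rw [← hv] at hl
  have := fellow_travel (cs := cs) hT h h' (z := cs.simple s) (by rw [length_simple])
    (C := 8 * mBound M) (fun p hp => by
      obtain ⟨q, hq, hpq⟩ := near_simple_mul hT s (cs.wordProd v) p hp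
      exact ⟨q, by rwa [hv], hpq⟩) (by omega) (by omega) n
  omega

theorem stepN_one_eq_iterate (hT : TriangleCond M) {n : ℕ} {x y : W}
    (h : StepN cs oneFun n x y) : y = (PiMap cs)^[n] x := by
  induction n generalizing x with
  | zero => cases h; rfl
  | succ n ih =>
    obtain ⟨z, hz, h⟩ := h
    rw [Function.iterate_succ_apply, PiMap, ← eq_mul_wg_of_step hT hz]
    exact ih h

theorem wdist_piMap_iterate_le (hT : TriangleCond M) (g : W) (n : ℕ) :
    wdist cs ((PiMap cs)^[n] g) g ≤ n * mBound M := by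
  induction n generalizing g with
  | zero => simp [wdist_self]
  | succ n ih =>
    rw [Function.iterate_succ_apply]
    have h1 := wdist_triangle (cs := cs) ((PiMap cs)^[n] (PiMap cs g)) (PiMap cs g) g
    have h2 := ih (PiMap cs g)
    have h3 : wdist cs (PiMap cs g) g ≤ mBound M := by
      rw [wdist_comm, wdist, PiMap, inv_mul_cancel_left]
      by_cases hg : g = 1
      · rw [hg, wg_one, length_one]; exact Nat.zero_le _
      · exact (length_wg hT hg).2.2
    rw [Nat.succ_mul]
    omega

/-- The finite data attached to `g` which determine the continuations of standard words
representing `g`: the descent set, and for the first points `Π^j(g)` the relative position to `g`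
and the lengths of the elements close to `Π^j(g)`, relative to the length of `g`. -/
noncomputable def state (cs : CoxeterSystem M W) (g : W) :
    Set B × (Fin 3 → W × ({u : W // Close cs 1 u} → ℤ)) :=
  (descentSet cs g, fun j => (((PiMap cs)^[j] g)⁻¹ * g,
    fun u => (cs.length ((PiMap cs)^[j] g * u) : ℤ) - cs.length g))

theorem state_eq_iff {g g' : W} : state cs g = state cs g' ↔
    descentSet cs g = descentSet cs g' ∧ ∀ j < 3,
      ((PiMap cs)^[j] g)⁻¹ * g = ((PiMap cs)^[j] g')⁻¹ * g' ∧ ∀ u, Close cs 1 u →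
        (cs.length ((PiMap cs)^[j] g * u) : ℤ) - cs.length g =
          cs.length ((PiMap cs)^[j] g' * u) - cs.length g' := by
  simp only [state, Prod.ext_iff, funext_iff, Subtype.forall, Fin.forall_iff]

theorem finite_close : {u : W | Close cs 1 u}.Finite := by
  refine (finite_length_le cs (mBound M)).subset fun u hu => ?_
  have := Close.wdist_le (cs := cs) hu
  rwa [wdist, inv_one, one_mul] at this

theorem finite_range_state (hT : TriangleCond M) : (Set.range (state cs)).Finite := by
  have : Finite {u : W // Close cs 1 u} := finite_close.to_subtype
  set m := mBound M with hm
  have hfin : ((Set.univ : Set (Set B)) ×ˢ Set.pi Set.univ (fun _ : Fin 3 =>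
      {w : W | cs.length w ≤ 3 * m} ×ˢ Set.pi Set.univ
        (fun _ : {u : W // Close cs 1 u} => Set.Icc (-(4 * m : ℤ)) (4 * m)))).Finite :=
    Set.finite_univ.prod (Set.Finite.pi fun _ => (finite_length_le cs _).prod
      (Set.Finite.pi fun _ => Set.finite_Icc _ _))
  refine hfin.subset ?_
  rintro _ ⟨g, rfl⟩
  refine ⟨Set.mem_univ _, fun j _ => ?_⟩
  have h1 : wdist cs ((PiMap cs)^[j] g) g ≤ 3 * m :=
    (wdist_piMap_iterate_le hT g j).trans (Nat.mul_le_mul_right _ (by omega))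
  refine ⟨h1, fun u _ => ?_⟩
  have h2 : cs.length u.1 ≤ m := by
    have := Close.wdist_le (cs := cs) u.2
    rwa [wdist, inv_one, one_mul] at this
  have h3 : wdist cs ((PiMap cs)^[j] g) ((PiMap cs)^[j] g * u) ≤ m := by
    rwa [wdist, inv_mul_cancel_left]
  have h4 := wdist_triangle (cs := cs) g ((PiMap cs)^[j] g) ((PiMap cs)^[j] g * u)
  rw [wdist_comm g ((PiMap cs)^[j] g)] at h4
  have h5 := length_le_add_wdist (cs := cs) g ((PiMap cs)^[j] g * u)
  have h6 := length_le_add_wdist (cs := cs) ((PiMap cs)^[j] g * u) g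
  rw [wdist_comm ((PiMap cs)^[j] g * u) g] at h6
  simp only [state, Set.mem_Icc]
  omega

theorem close_one_iff {x y : W} : Close cs 1 (x⁻¹ * y) ↔ Close cs x y := by
  simp only [Close, inv_one, one_mul, eq_comm (a := (1 : W)), inv_mul_eq_one]

theorem descentSet_of_state_eq (hT : TriangleCond M) {g g' b : W} (hs : state cs g = state cs g')
    (hb : b ≠ 1) (hw : wg cs (g * b) = b) :
    descentSet cs (g' * b) = descentSet cs (g * b) ∧ wg cs (g' * b) = b := by
  have S : Setting cs oneFun := Setting.one hT
  obtain ⟨hd, hs⟩ := state_eq_iff.1 hs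
  have hne : g * b ≠ 1 := fun h => hb (by rw [← hw, h, wg_one])
  have hbb : b * b = 1 := by
    have := wg_mul_self (cs := cs) hT (g * b)
    rwa [hw] at this
  have hst := step_wg (cs := cs) hT hne
  rw [hw] at hst
  rcases hst with ⟨a, ha, ha', h⟩ | ⟨a, t, hat, ha, ht, h⟩
  · have hba : b = cs.simple a := mul_left_cancel h
    subst hba
    have hds : ∀ u, cs.IsRightDescent (g * cs.simple a) u → u = a := fun u hu => by
      by_contra hn
      exact absurd (num_one_neg_iff.2 hu) (not_lt.2 (ha' u hn))
    have had := num_one_neg_iff.1 ha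
    have hga : ¬ cs.IsRightDescent g a := by
      rw [isRightDescent_iff_not_isRightDescent_mul] at had
      simpa using had
    have hga' : ¬ cs.IsRightDescent g' a := by
      intro h
      have : a ∈ descentSet cs g := hd ▸ h
      exact hga this
    have had' : cs.IsRightDescent (g' * cs.simple a) a := by
      rw [isRightDescent_iff_not_isRightDescent_mul]
      simpa using hga'
    have l1 := cs.not_isRightDescent_iff.1 hga
    have l1' := cs.not_isRightDescent_iff.1 hga'
    have e1 : descentSet cs (g * cs.simple a) = {a} :=
      Set.ext fun u => ⟨hds u, fun hu => hu ▸ had⟩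
    have e2 : descentSet cs (g' * cs.simple a) = {a} := by
      refine Set.ext fun t => ⟨fun ht => ?_, fun hu => hu ▸ had'⟩
      by_contra hta
      have hat : a ≠ t := fun h => hta h.symm
      obtain ⟨hm, k, -, -, hk, hl⟩ := exists_eq_mul_wab cs hat had' ht
      have hww := wab_mul_self cs hat hm
      have hk' : k = g' * (cs.simple a * wab cs a t) := by
        rw [← mul_assoc, hk, mul_assoc, hww, mul_one]
      have hu : Close cs 1 (cs.simple a * wab cs a t) := by
        refine Or.inr ⟨a, t, hat, hm, ?_⟩
        rw [inv_one, one_mul]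
        exact mul_mem (simple_mem_dih_left cs a t) (wab_mem_dih cs a t)
      have h3 := (hs 0 (by omega)).2 _ hu
      simp only [Function.iterate_zero, id] at h3
      rw [← hk'] at h3
      have h4 : cs.length (wab cs a t * cs.simple t) < cs.length (wab cs a t) := by
        have := wab_descent_left cs hat.symm (by rwa [M.symmetric])
        rwa [wab_symm] at this
      rw [length_wab cs hat] at h4
      have h5 := cs.length_mul_le (g * (cs.simple a * wab cs a t)) (wab cs a t * cs.simple t)
      have h6 : g * (cs.simple a * wab cs a t) * (wab cs a t * cs.simple t)
          = g * cs.simple a * cs.simple t := by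
        rw [← mul_assoc, ← mul_assoc, mul_assoc (g * cs.simple a), hww, mul_one]
      rw [h6] at h5
      refine hta (hds t ?_)
      rw [IsRightDescent]
      omega
    exact ⟨e2.trans e1.symm, wg_of_singleton e2⟩
  · have hbw : b = wab cs a t := mul_left_cancel h
    subst hbw
    have hm := S.finite_of_neg (x := g * wab cs a t) (a := a) (b := t) (by linarith)
    have hww := wab_mul_self cs hat hm
    obtain ⟨-, k, hka, hkt, hk, -⟩ :=
      exists_eq_mul_wab cs hat (num_one_neg_iff.1 ha) (num_one_neg_iff.1 ht)
    rw [← mul_right_cancel hk] at hka hkt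
    have hga' : ¬ cs.IsRightDescent g' a := fun h => hka (show a ∈ descentSet cs g from hd ▸ h)
    have hgt' : ¬ cs.IsRightDescent g' t := fun h => hkt (show t ∈ descentSet cs g from hd ▸ h)
    have key : ∀ x, ¬ cs.IsRightDescent x a → ¬ cs.IsRightDescent x t →
        descentSet cs (x * wab cs a t) = {a, t} := by
      intro x hxa hxt
      have d : ∀ u, cs.IsRightDescent (wab cs a t) u → cs.simple u ∈ dih cs a t →
          cs.IsRightDescent (x * wab cs a t) u := by
        intro u hu hud
        rw [IsRightDescent] at hu ⊢
        rw [mul_assoc, length_mul_dih cs hxa hxt (mul_mem (wab_mem_dih cs a t) hud),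
          length_mul_dih cs hxa hxt (wab_mem_dih cs a t)]
        omega
      have da := d a (wab_descent_left cs hat hm) (simple_mem_dih_left cs a t)
      have dt := d t (by
        have := wab_descent_left cs hat.symm (by rwa [M.symmetric])
        rwa [wab_symm] at this) (simple_mem_dih_right cs a t)
      ext u
      simp only [descentSet, Set.mem_ofPred_eq, Set.mem_insert_iff, Set.mem_singleton_iff]
      constructor
      · intro hu
        by_contra hn
        push Not at hn
        exact S.false_of_three hat hn.1.symm hn.2.symm (num_one_neg_iff.2 da)
          (num_one_neg_iff.2 dt) (num_one_neg_iff.2 hu).le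
      · rintro (rfl | rfl)
        · exact da
        · exact dt
    exact ⟨(key _ hga' hgt').trans (key _ hka hkt).symm, wg_of_pair hat hm (key _ hga' hgt')⟩

theorem exists_onPath_close (hT : TriangleCond M) {h x : W} (hh : h ≠ 1) (hx : Close cs h x) :
    ∃ j x', j < 3 ∧ OnPath cs oneFun x x' ∧ Close cs ((PiMap cs)^[j + 1] h) x' := by
  have S : Setting cs oneFun := Setting.one hT
  generalize hl : cs.length x = l
  induction l using Nat.strong_induction_on generalizing x with
  | _ l ih =>
    rcases S.meet hx with h0 | ⟨i, j, h', x', hi, hj, hij, h1, h2, h3⟩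
    · refine absurd (eq_one_of_no_descent cs fun u hu => ?_) hh
      exact absurd (num_one_neg_iff.2 hu) (not_lt.2 (h0.1 u))
    · cases i with
      | zero =>
        cases h1
        obtain ⟨l1, -, l3⟩ := h2.facts S
        obtain ⟨k, y, hk, hy, hc⟩ := ih _ (by omega) h3 rfl
        exact ⟨k, y, hk, OnPath.trans ⟨_, h2⟩ hy, hc⟩
      | succ i =>
        rw [stepN_one_eq_iterate hT h1] at h3
        exact ⟨i, x', by omega, ⟨_, h2⟩, h3⟩

theorem OnPath.length_eq (S : Setting cs f) {x p : W} (h : OnPath cs f x p) :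
    cs.length x = cs.length p + wdist cs x p := by
  obtain ⟨n, h⟩ := h
  exact (h.facts S).1

theorem length_le_of_state_eq (hT : TriangleCond M) {g g' b : W} (hs : state cs g = state cs g')
    (hb : b ≠ 1) (hw : wg cs (g * b) = b) {u : W} (hu : Close cs 1 u) :
    (cs.length (g' * b * u) : ℤ) - cs.length g' ≤ cs.length (g * b * u) - cs.length g := by
  have S : Setting cs oneFun := Setting.one hT
  have hs' := (state_eq_iff.1 hs).2
  have hne : g * b ≠ 1 := fun h => hb (by rw [← hw, h, wg_one])
  have hbb : b * b = 1 := by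
    have := wg_mul_self (cs := cs) hT (g * b)
    rwa [hw] at this
  have hP : PiMap cs (g * b) = g := by rw [PiMap, hw, mul_assoc, hbb, mul_one]
  have hc : Close cs (g * b) (g * b * u) := by
    rw [← close_one_iff, inv_mul_cancel_left]; exact hu
  obtain ⟨j, x', hj, hx, hx'⟩ := exists_onPath_close hT hne hc
  rw [Function.iterate_succ_apply, hP] at hx'
  obtain ⟨hs1, hs2⟩ := hs' j hj
  set v := ((PiMap cs)^[j] g)⁻¹ * x' with hv
  have hxv : x' = (PiMap cs)^[j] g * v := by rw [hv, mul_inv_cancel_left]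
  have h1 := hs2 v (close_one_iff.2 hx')
  have h2 := hx.length_eq S
  have h3 := length_le_add_wdist (cs := cs) ((PiMap cs)^[j] g' * v) (g' * b * u)
  rw [wdist_comm] at h3
  have e : wdist cs (g' * b * u) ((PiMap cs)^[j] g' * v) = wdist cs (g * b * u) x' := by
    have e1 : ∀ p x : W, (x * b * u)⁻¹ * (p * v) = u⁻¹ * b⁻¹ * (p⁻¹ * x)⁻¹ * v := by
      intro p x; group
    rw [hxv, wdist, wdist, e1, e1, hs1]
  rw [e] at h3
  rw [← hxv] at h1
  omega

theorem state_mul (hT : TriangleCond M) {g g' b : W} (hs : state cs g = state cs g')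
    (hb : b ≠ 1) (hw : wg cs (g * b) = b) : state cs (g * b) = state cs (g' * b) := by
  obtain ⟨hd, hw'⟩ := descentSet_of_state_eq hT hs hb hw
  have len : ∀ x, wg cs (x * b) = b → PiMap cs (x * b) = x ∧
      cs.length (x * b) = cs.length x + cs.length b := by
    intro x hx
    have hne : x * b ≠ 1 := fun h => hb (by rw [← hx, h, wg_one])
    have hbb := wg_mul_self (cs := cs) hT (x * b)
    rw [hx] at hbb
    have hP : PiMap cs (x * b) = x := by rw [PiMap, hx, mul_assoc, hbb, mul_one]
    have := (length_wg (cs := cs) hT hne).1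
    rw [hx, mul_assoc, hbb, mul_one] at this
    exact ⟨hP, this⟩
  obtain ⟨p, l⟩ := len g hw
  obtain ⟨p', l'⟩ := len g' hw'
  refine state_eq_iff.2 ⟨hd.symm, fun j hj => ?_⟩
  cases j with
  | zero =>
    refine ⟨by simp, fun u hu => ?_⟩
    have h1 := length_le_of_state_eq hT hs hb hw hu
    have h2 := length_le_of_state_eq hT hs.symm hb hw' hu
    simp only [Function.iterate_zero, id]
    omega
  | succ j =>
    obtain ⟨h1, h2⟩ := (state_eq_iff.1 hs).2 j (by omega)
    rw [Function.iterate_succ_apply, Function.iterate_succ_apply, p, p']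
    refine ⟨by rw [← mul_assoc, ← mul_assoc, h1], fun u hu => ?_⟩
    have := h2 u hu
    omega

/-- `w` is a concatenation of blocks along which a standard word representing `g` extends to
longer standard words. -/
inductive BlockWord (cs : CoxeterSystem M W) : W → List B → Prop
  | nil (g : W) : BlockWord cs g []
  | block (g : W) (b w : List B) (hb : cs.wordProd b ≠ 1)
      (hw : cs.wordProd b = wg cs (g * cs.wordProd b)) (hl : b.length = cs.length (cs.wordProd b))
      (h : BlockWord cs (g * cs.wordProd b) w) : BlockWord cs g (b ++ w)

theorem BlockWord.append {g : W} {w w' : List B} (h : BlockWord cs g w)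
    (h' : BlockWord cs (g * cs.wordProd w) w') : BlockWord cs g (w ++ w') := by
  induction h with
  | nil g => simpa using h'
  | block g b w hb hw hl h ih =>
    rw [List.append_assoc]
    refine .block g b _ hb hw hl (ih ?_)
    rwa [wordProd_append, ← mul_assoc] at h'

theorem BlockWord.stdLang {g : W} {v w : List B} (h : BlockWord cs g w) (hv : StdLang cs v)
    (hg : cs.wordProd v = g) : StdLang cs (v ++ w) := by
  induction h generalizing v with
  | nil g => simpa using hv
  | block g b w hb hw hl h ih =>
    rw [← List.append_assoc]
    refine ih (hv.append hb ?_ hl) ?_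
    · rw [wordProd_append, hg, ← hw]
    · rw [wordProd_append, hg]

theorem BlockWord.of_state_eq (hT : TriangleCond M) {g g' : W} {w : List B}
    (h : BlockWord cs g w) (hs : state cs g = state cs g') : BlockWord cs g' w := by
  induction h generalizing g' with
  | nil g => exact .nil g'
  | block g b w hb hw hl h ih =>
    exact .block g' b w hb (descentSet_of_state_eq hT hs hb hw.symm).2.symm hl
      (ih (state_mul hT hs hb hw.symm))

theorem StdLang.exists_blockWord (hT : TriangleCond M) {x y : List B} (h : StdLang cs (x ++ y)) :
    ∃ v p, x = v ++ p ∧ StdLang cs v ∧ p.length ≤ mBound M ∧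
      BlockWord cs (cs.wordProd v) (p ++ y) := by
  generalize hn : y.length = n
  induction n using Nat.strong_induction_on generalizing y with
  | _ n ih =>
    obtain ⟨-, h0 | ⟨x', b, hv, hx, hb, hbw, hbl, -⟩⟩ := h.length_eq hT
    · obtain ⟨rfl, rfl⟩ := List.append_eq_nil_iff.1 h0
      exact ⟨[], [], rfl, .nil, Nat.zero_le _, .nil _⟩
    · have hb1 : cs.wordProd b ≠ 1 := by
        intro h1
        rw [h1, length_one] at hbl
        exact hb (List.eq_nil_of_length_eq_zero hbl)
      rw [hv, wordProd_append] at hbw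
      have hbm : b.length ≤ mBound M := by
        have hne : cs.wordProd x' * cs.wordProd b ≠ 1 := by
          intro h1
          rw [h1, wg_one] at hbw
          exact hb1 hbw
        rw [hbl, hbw]
        exact (length_wg hT hne).2.2
      have hblock : BlockWord cs (cs.wordProd x') b := by
        have := BlockWord.block _ b [] hb1 hbw hbl (.nil _)
        rwa [List.append_nil] at this
      rcases List.append_eq_append_iff.1 hv with ⟨y₁, h1, h2⟩ | ⟨p, h1, h2⟩
      · rw [h1] at hx
        obtain ⟨v, p, e1, e2, e3, e4⟩ := ih y₁.length (by
          rw [← hn, h2, List.length_append]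
          have := List.length_pos_of_ne_nil hb
          omega) hx rfl
        refine ⟨v, p, e1, e2, e3, ?_⟩
        rw [h2, ← List.append_assoc]
        refine e4.append ?_
        rwa [← wordProd_append, ← List.append_assoc, ← e1, ← h1]
      · refine ⟨x', p, h1, hx, ?_, h2 ▸ hblock⟩
        rw [h2, List.length_append] at hbm
        omega

theorem isRegular_stdLang (hT : TriangleCond M) :
    Language.IsRegular {v : List B | StdLang cs v} := by
  apply Language.IsRegular.of_finite_range_leftQuotient
  set P := Set.range (state cs) ×ˢ {p : List B | p.length ≤ mBound M} with hP
  have hfin : P.Finite := (finite_range_state hT).prod (List.finite_length_le B _)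
  refine (hfin.finite_subsets.image fun σ => ({y | ∃ q ∈ σ, ∃ g, state cs g = q.1 ∧
    BlockWord cs g (q.2 ++ y)} : Language B)).subset ?_
  rintro _ ⟨x, rfl⟩
  refine ⟨{q | ∃ v p, x = v ++ p ∧ StdLang cs v ∧ p.length ≤ mBound M ∧
    q = (state cs (cs.wordProd v), p)}, ?_, ?_⟩
  · rintro _ ⟨v, p, -, -, hp, rfl⟩
    exact ⟨⟨_, rfl⟩, hp⟩
  · refine Set.ext fun y => ⟨?_, fun h => ?_⟩
    · rintro ⟨_, ⟨v, p, rfl, hv, -, rfl⟩, g, hg, hw⟩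
      have := (hw.of_state_eq hT hg).stdLang hv rfl
      rwa [← List.append_assoc] at this
    · obtain ⟨v, p, e1, e2, e3, e4⟩ := StdLang.exists_blockWord (cs := cs) (x := x) (y := y) hT h
      exact ⟨_, ⟨v, p, e1, e2, e3, rfl⟩, _, rfl, e4⟩

end

/-- **Theorem (main).** If `W` is a 2-dimensional Coxeter group, then it is biautomatic,
witnessed by its standard language. -/
theorem two_dimensional_coxeter_biautomatic
    (cs : CoxeterSystem M W) (h2 : TwoDimensional cs) :
    Language.IsRegular { v : List B | StdLang cs v } ∧
    (∀ g : W, ∃ v : List B, StdLang cs v ∧ cs.wordProd v = g) ∧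
    ∃ C : ℕ, 0 < C ∧
      (∀ (i : B) (g g' : W), g' = g * cs.simple i →
        ∀ v v' : List B, StdLang cs v → StdLang cs v' →
          cs.wordProd v = g → cs.wordProd v' = g' →
          ∀ n : ℕ, 1 ≤ n →
            cs.length ((cs.wordProd (v.take n))⁻¹ * cs.wordProd (v'.take n)) ≤ C) ∧
      (∀ (i : B) (g g' : W), g' = cs.simple i * g →
        ∀ v v' : List B, StdLang cs v → StdLang cs v' →
          cs.wordProd v = g → cs.wordProd v' = g' →
          ∀ n : ℕ, 1 ≤ n →
            cs.length ((cs.wordProd (v.take n))⁻¹ * (cs.simple i)⁻¹ * cs.wordProd (v'.take n)) ≤ C) := by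
  have hT := triangleCond_of_twoDimensional cs h2
  refine ⟨isRegular_stdLang hT, exists_stdLang hT, 18 * mBound M + 2, by omega, ?_, ?_⟩
  · rintro i g g' rfl v v' hv hv' rfl hg n -
    exact fellow_travel_right hT hv hv' hg n
  · rintro i g g' rfl v v' hv hv' rfl hg n -
    have := fellow_travel_left hT hv hv' hg n
    rwa [wdist, ← mul_assoc, ← inv_simple cs i] at this

end CoxeterPaper
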